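/- arXiv:1305.4262 — 2 statements merged into one kernel-verified Lean document; each statement's English description precedes it below -/
import Mathlib

section
/- Let n ≥ 2, let A(D) be an elliptic homogeneous linear differential operator of order k on ℝⁿ from V to E, and let ℓ ∈ {1, …, min(k, n−1)}. Then there exists a constant C > 0 such that the Hardy inequality ∫_{ℝⁿ} |D^{k−ℓ}u(x)| / |x|^ℓ dx ≤ C ∫_{ℝⁿ} |A(D)u(x)| dx holds for every u ∈ C_c^∞(ℝⁿ; V) if and only if A(D) is canceling. -/
open MeasureTheory ENNReal
open scoped NNReal RealInnerProductSpace

noncomputable section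

/-- A homogeneous linear differential operator `A(D)` of order `k` from `V` to `E` on a
Euclidean space `X`, represented through its action `u ↦ A (D^k u)` on the `k`-th
iterated (Fréchet) derivative; this is equivalent to the data of a family of coefficients
`(A_α)_{|α| = k}`, `A_α ∈ 𝓛(V; E)`, acting by `A(D)u = ∑_{|α|=k} A_α (∂^α u)`. -/
abbrev DiffOperator (X : Type*) [NormedAddCommGroup X] [InnerProductSpace ℝ X]
    (k : ℕ) (V E : Type*) [NormedAddCommGroup V] [NormedSpace ℝ V]
    [NormedAddCommGroup E] [NormedSpace ℝ E] :=
  ContinuousMultilinearMap ℝ (fun _ : Fin k => X) V →L[ℝ] E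

namespace DiffOperator

variable {X : Type*} [NormedAddCommGroup X] [InnerProductSpace ℝ X]
  {k : ℕ} {V E : Type*} [NormedAddCommGroup V] [NormedSpace ℝ V]
  [NormedAddCommGroup E] [NormedSpace ℝ E]

/-- The action `A(D)u` of the differential operator on a function `u : X → V`. -/
noncomputable def app (A : DiffOperator X k V E) (u : X → V) (x : X) : E :=
  A (iteratedFDeriv ℝ k u x)

/-- The symbol `A(ξ) = ∑_{|α|=k} ξ^α A_α ∈ 𝓛(V; E)` of the operator: it sends `v : V` to
`A` applied to the `k`-linear map `(w₁, …, w_k) ↦ (⟪ξ,w₁⟫ ⋯ ⟪ξ,w_k⟫) • v`. -/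
noncomputable def symbol (A : DiffOperator X k V E) (ξ : X) : V →L[ℝ] E :=
  A.comp (((ContinuousMultilinearMap.compContinuousLinearMapL
      (fun _ : Fin k => innerSL ℝ ξ)).comp
    (ContinuousMultilinearMap.piFieldEquiv ℝ (Fin k)
      V).toContinuousLinearEquiv.toContinuousLinearMap))

/-- `A(D)` is elliptic if its symbol `A(ξ)` is injective for every `ξ ≠ 0`. -/
def IsElliptic (A : DiffOperator X k V E) : Prop :=
  ∀ ξ : X, ξ ≠ 0 → Function.Injective (A.symbol ξ)

/-- `A(D)` is canceling if `⋂_{ξ ≠ 0} A(ξ)[V] = {0}`. -/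
def IsCanceling (A : DiffOperator X k V E) : Prop :=
  (⋂ (ξ : X) (_ : ξ ≠ 0), Set.range (A.symbol ξ)) = {0}

end DiffOperator

/-- `u ∈ C_c^∞`: a smooth compactly supported function. -/
def IsTestFun {X V : Type*} [NormedAddCommGroup X] [NormedSpace ℝ X]
    [NormedAddCommGroup V] [NormedSpace ℝ V] (u : X → V) : Prop :=
  ContDiff ℝ (⊤ : ℕ∞) u ∧ HasCompactSupport u


set_option linter.unusedSectionVars false
set_option linter.deprecated false
set_option linter.unusedSimpArgs false

/-! ### Part 1: algebra of symbols -/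
namespace HardyCanc

section Algebra

variable {X : Type*} [NormedAddCommGroup X] [InnerProductSpace ℝ X] [FiniteDimensional ℝ X]
  {k : ℕ} {V E : Type*} [NormedAddCommGroup V] [NormedSpace ℝ V]
  [NormedAddCommGroup E] [NormedSpace ℝ E]

/-- The map `v ↦ (w ↦ ∏ ⟪c i, w i⟫ • v)`. -/
def tens (c : Fin k → X) : V →L[ℝ] ContinuousMultilinearMap ℝ (fun _ : Fin k => X) V :=
  (ContinuousMultilinearMap.compContinuousLinearMapL (fun i : Fin k => innerSL ℝ (c i))).comp
    (ContinuousMultilinearMap.piFieldEquiv ℝ (Fin k)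
      V).toContinuousLinearEquiv.toContinuousLinearMap

lemma tens_apply (c : Fin k → X) (v : V) (w : Fin k → X) :
    tens c v w = (∏ i, ⟪c i, w i⟫) • v := by
  simp [tens, ContinuousMultilinearMap.piFieldEquiv]

lemma tens_expand (T : ContinuousMultilinearMap ℝ (fun _ : Fin k => X) V) :
    T = ∑ J : Fin k → Fin (Module.finrank ℝ X),
      tens (fun i => stdOrthonormalBasis ℝ X (J i)) (T fun i => stdOrthonormalBasis ℝ X (J i)) := by
  ext w
  rw [ContinuousMultilinearMap.sum_apply]
  simp only [tens_apply]
  conv_lhs =>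
    rw [show w = fun i => ∑ j, ⟪stdOrthonormalBasis ℝ X j, w i⟫ • stdOrthonormalBasis ℝ X j from
      funext fun i => ((stdOrthonormalBasis ℝ X).sum_repr' (w i)).symm]
  rw [ContinuousMultilinearMap.map_sum]
  refine Finset.sum_congr rfl fun J _ => ?_
  exact ContinuousMultilinearMap.map_smul_univ _ _ _

lemma symbol_apply (A : DiffOperator X k V E) (ξ : X) (v : V) :
    A.symbol ξ v = A (tens (fun _ => ξ) v) := rfl

lemma symbol_expand (A : DiffOperator X k V E) (ξ : X) :
    A.symbol ξ = ∑ J : Fin k → Fin (Module.finrank ℝ X),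
      (∏ i, ⟪ξ, stdOrthonormalBasis ℝ X (J i)⟫) •
        (A.comp (tens (fun i => stdOrthonormalBasis ℝ X (J i)))) := by
  ext v
  rw [symbol_apply, tens_expand (tens (fun _ => ξ) v), map_sum, ContinuousLinearMap.sum_apply]
  refine Finset.sum_congr rfl fun J _ => ?_
  simp [tens_apply]

lemma symbol_smul (A : DiffOperator X k V E) (c : ℝ) (ξ : X) :
    A.symbol (c • ξ) = c ^ k • A.symbol ξ := by
  rw [symbol_expand, symbol_expand, Finset.smul_sum]
  refine Finset.sum_congr rfl fun J _ => ?_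
  simp [inner_smul_left, Finset.prod_mul_distrib, smul_smul]

lemma contDiff_symbol (A : DiffOperator X k V E) : ContDiff ℝ (⊤ : ℕ∞) A.symbol := by
  rw [show A.symbol = _ from funext fun ξ => symbol_expand A ξ]
  apply ContDiff.sum
  intro J _
  apply ContDiff.fun_smul
  · apply contDiff_prod
    intro i _
    exact (contDiff_id (𝕜 := ℝ) (E := X)).inner ℝ contDiff_const
  · exact contDiff_const

lemma app_expand (A : DiffOperator X k V E) (u : X → V) (x : X) :
    A.app u x = ∑ J : Fin k → Fin (Module.finrank ℝ X),
      (A.comp (tens (fun i => stdOrthonormalBasis ℝ X (J i))))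
        (iteratedFDeriv ℝ k u x fun i => stdOrthonormalBasis ℝ X (J i)) := by
  rw [DiffOperator.app]
  conv_lhs => rw [tens_expand (iteratedFDeriv ℝ k u x)]
  rw [map_sum]
  rfl

end Algebra

section Pinv

variable {X : Type*} [NormedAddCommGroup X] [InnerProductSpace ℝ X] [FiniteDimensional ℝ X]
  {k : ℕ} {V E : Type*} [NormedAddCommGroup V] [InnerProductSpace ℝ V] [FiniteDimensional ℝ V]
  [NormedAddCommGroup E] [InnerProductSpace ℝ E] [FiniteDimensional ℝ E]

/-- adjoint as a continuous linear map -/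
def adjL : (V →L[ℝ] E) →L[ℝ] (E →L[ℝ] V) :=
  LinearMap.toContinuousLinearMap
    { toFun := fun f => ContinuousLinearMap.adjoint f
      map_add' := fun f g => by simp
      map_smul' := fun c f => by simp }

lemma adjL_apply (f : V →L[ℝ] E) : adjL f = ContinuousLinearMap.adjoint f := rfl

/-- Moore-Penrose inverse of the symbol -/
def pinv (A : DiffOperator X k V E) (ξ : X) : E →L[ℝ] V :=
  (Ring.inverse ((adjL (A.symbol ξ)).comp (A.symbol ξ))).comp (adjL (A.symbol ξ))

/-- projection on the kernel of the adjoint -/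
def proj (A : DiffOperator X k V E) (ξ : X) : E →L[ℝ] E :=
  ContinuousLinearMap.id ℝ E - (A.symbol ξ).comp (pinv A ξ)

lemma isUnit_gram (A : DiffOperator X k V E) (hA : A.IsElliptic) {ξ : X} (hξ : ξ ≠ 0) :
    IsUnit ((adjL (A.symbol ξ)).comp (A.symbol ξ)) := by
  rw [ContinuousLinearMap.isUnit_iff_bijective]
  have hinj : Function.Injective ((adjL (A.symbol ξ)).comp (A.symbol ξ)) := by
    rw [injective_iff_map_eq_zero]
    intro v hv
    have h1 : ⟪(adjL (A.symbol ξ)).comp (A.symbol ξ) v, v⟫ = 0 := by rw [hv]; simp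
    rw [ContinuousLinearMap.comp_apply, adjL_apply, ContinuousLinearMap.adjoint_inner_left,
      inner_self_eq_zero] at h1
    exact (injective_iff_map_eq_zero _).1 (hA ξ hξ) v h1
  exact ⟨hinj, (LinearMap.injective_iff_surjective
    (f := (((adjL (A.symbol ξ)).comp (A.symbol ξ) : V →L[ℝ] V) : V →ₗ[ℝ] V))).1 hinj⟩

lemma pinv_comp (A : DiffOperator X k V E) (hA : A.IsElliptic) {ξ : X} (hξ : ξ ≠ 0) :
    (pinv A ξ).comp (A.symbol ξ) = ContinuousLinearMap.id ℝ V := by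
  rw [pinv, ContinuousLinearMap.comp_assoc]
  exact Ring.inverse_mul_cancel _ (isUnit_gram A hA hξ)

lemma contDiffAt_pinv (A : DiffOperator X k V E) (hA : A.IsElliptic) {ξ : X} (hξ : ξ ≠ 0) :
    ContDiffAt ℝ (⊤ : ℕ∞) (pinv A) ξ := by
  have h1 : ContDiff ℝ (⊤ : ℕ∞) (fun ξ => adjL (A.symbol ξ)) :=
    (adjL (V := V) (E := E)).contDiff.comp (contDiff_symbol A)
  have h2 : ContDiff ℝ (⊤ : ℕ∞) (fun ξ => (adjL (A.symbol ξ)).comp (A.symbol ξ)) :=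
    h1.clm_comp (contDiff_symbol A)
  obtain ⟨z, hz⟩ := isUnit_gram A hA hξ
  have h3 : ContDiffAt ℝ (⊤ : ℕ∞) (Ring.inverse : (V →L[ℝ] V) → _)
    ((adjL (A.symbol ξ)).comp (A.symbol ξ)) := by
    rw [← hz]
    exact contDiffAt_ringInverse ℝ z
  exact (h3.comp ξ h2.contDiffAt).clm_comp h1.contDiffAt

lemma contDiffAt_proj (A : DiffOperator X k V E) (hA : A.IsElliptic) {ξ : X} (hξ : ξ ≠ 0) :
    ContDiffAt ℝ (⊤ : ℕ∞) (proj A) ξ :=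
  contDiffAt_const.sub ((contDiff_symbol A).contDiffAt.clm_comp (contDiffAt_pinv A hA hξ))

lemma proj_comp (A : DiffOperator X k V E) (hA : A.IsElliptic) {ξ : X} (hξ : ξ ≠ 0) :
    (proj A ξ).comp (A.symbol ξ) = 0 := by
  rw [proj, ContinuousLinearMap.sub_comp, ContinuousLinearMap.comp_assoc, pinv_comp A hA hξ]
  simp

lemma inner_proj (A : DiffOperator X k V E) (hA : A.IsElliptic) {ξ : X} (hξ : ξ ≠ 0) (e : E) :
    ⟪proj A ξ e, e⟫ = ‖proj A ξ e‖ ^ 2 := by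
  have h0 : adjL (A.symbol ξ) (proj A ξ e) = 0 := by
    have := Ring.mul_inverse_cancel _ (isUnit_gram A hA hξ)
    have h1 := congrArg (fun f : V →L[ℝ] V => f (adjL (A.symbol ξ) e)) this
    simp only [ContinuousLinearMap.mul_apply, ContinuousLinearMap.comp_apply,
      ContinuousLinearMap.one_apply] at h1
    simp only [proj, pinv, ContinuousLinearMap.sub_apply, ContinuousLinearMap.comp_apply,
      ContinuousLinearMap.id_apply, map_sub]
    rw [h1, sub_self]
  have h2 : e = proj A ξ e + A.symbol ξ (pinv A ξ e) := by simp [proj]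
  have h3 : ⟪proj A ξ e, e⟫ = ⟪proj A ξ e, proj A ξ e + A.symbol ξ (pinv A ξ e)⟫ := by rw [← h2]
  rw [h3]
  rw [inner_add_right, real_inner_self_eq_norm_sq, ← ContinuousLinearMap.adjoint_inner_left,
    ← adjL_apply, h0]
  simp

end Pinv

end HardyCanc

/-! ### Part 2: Fourier lemmas -/
namespace HardyCanc

open FourierTransform

section Fourier

variable {X : Type*} [NormedAddCommGroup X] [InnerProductSpace ℝ X] [FiniteDimensional ℝ X]
  [MeasurableSpace X] [BorelSpace X]
  {k : ℕ} {V E : Type*} [NormedAddCommGroup V] [NormedSpace ℝ V]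
  [NormedAddCommGroup E] [NormedSpace ℝ E]

lemma testFun_deriv_cont {u : X → V} (hu : IsTestFun u) (j : ℕ) :
    Continuous (iteratedFDeriv ℝ j u) :=
  hu.1.continuous_iteratedFDeriv (mod_cast le_top)

lemma testFun_deriv_supp {u : X → V} (hu : IsTestFun u) (j : ℕ) :
    HasCompactSupport (iteratedFDeriv ℝ j u) :=
  hu.2.iteratedFDeriv j

lemma testFun_deriv_integrable {u : X → V} (hu : IsTestFun u) (j : ℕ) :
    Integrable (iteratedFDeriv ℝ j u) :=
  (testFun_deriv_cont hu j).integrable_of_hasCompactSupport (testFun_deriv_supp hu j)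

lemma testFun_comp {u : X → V} (hu : IsTestFun u) (α : V →L[ℝ] E) :
    IsTestFun (fun y => α (u y)) :=
  ⟨α.contDiff.comp hu.1, hu.2.comp_left (map_zero α)⟩

lemma app_cont (A : DiffOperator X k V E) {u : X → V} (hu : IsTestFun u) :
    Continuous (A.app u) :=
  A.continuous.comp (testFun_deriv_cont hu k)

lemma app_supp (A : DiffOperator X k V E) {u : X → V} (hu : IsTestFun u) :
    HasCompactSupport (A.app u) :=
  (testFun_deriv_supp hu k).comp_left (map_zero A)

lemma app_integrable (A : DiffOperator X k V E) {u : X → V} (hu : IsTestFun u) :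
    Integrable (A.app u) :=
  (app_cont A hu).integrable_of_hasCompactSupport (app_supp A hu)

lemma deriv_apply_integrable {u : X → V} (hu : IsTestFun u) {j : ℕ} (α : V →L[ℝ] ℂ)
    (w : Fin j → X) : Integrable (fun y => α (iteratedFDeriv ℝ j u y w)) :=
  (α.comp (ContinuousMultilinearMap.apply ℝ (fun _ : Fin j => X) V w)).integrable_comp
    (testFun_deriv_integrable hu j)

lemma iteratedFDeriv_comp_clm {u : X → V} (hu : ContDiff ℝ (⊤ : ℕ∞) u) {j : ℕ} (α : V →L[ℝ] E)
    (w : Fin j → X) (y : X) :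
    iteratedFDeriv ℝ j (fun y => α (u y)) y w = α (iteratedFDeriv ℝ j u y w) := by
  have := α.iteratedFDeriv_comp_left (f := u) (x := y) (i := j) (n := (⊤ : ℕ∞)) hu.contDiffAt
    (mod_cast le_top)
  rw [show (fun y => α (u y)) = α ∘ u from rfl, this]
  rfl

lemma fourier_deriv {u : X → V} (hu : IsTestFun u) {j : ℕ} (α : V →L[ℝ] ℂ)
    (w : Fin j → X) (ξ : X) :
    𝓕 (fun y => α (iteratedFDeriv ℝ j u y w)) ξ
      = (2 * Real.pi * Complex.I) ^ j * ((∏ i, ⟪ξ, w i⟫ : ℝ) : ℂ) * 𝓕 (fun y => α (u y)) ξ := by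
  have h1 := testFun_comp hu α
  have h2 := Real.fourier_iteratedFDeriv (N := ⊤) (f := fun y => α (u y)) h1.1
    (fun n _ => testFun_deriv_integrable h1 n) (n := j) le_top
  have h3 := congrArg (fun F => F ξ w) h2
  simp only at h3
  rw [Real.fourier_continuousMultilinearMap_apply (testFun_deriv_integrable h1 j)] at h3
  simp only [iteratedFDeriv_comp_clm hu.1] at h3
  rw [h3]
  simp only [VectorFourier.fourierPowSMulRight_apply, ContinuousLinearMap.neg_apply,
    innerSL_apply_apply, smul_eq_mul, Complex.real_smul, Finset.prod_neg, Complex.ofReal_mul]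
  rw [neg_pow (2 * Real.pi * Complex.I : ℂ)]
  push_cast
  simp only [Finset.card_univ, Fintype.card_fin]
  have hh : ∀ i, (innerSL ℝ ξ) (w i) = ⟪ξ, w i⟫ := fun i => rfl
  simp only [hh]
  have : ((-1 : ℂ) ^ j) * (-1) ^ j = 1 := by rw [← mul_pow]; simp
  linear_combination ((2 * Real.pi * Complex.I) ^ j * (∏ i, (⟪ξ, w i⟫ : ℂ)) *
    𝓕 (fun y => α (u y)) ξ) * this

lemma fourier_app (A : DiffOperator X k V E) {u : X → V} (hu : IsTestFun u) (η : E →L[ℝ] ℂ)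
    (ξ : X) :
    𝓕 (fun y => η (A.app u y)) ξ
      = (2 * Real.pi * Complex.I) ^ k * 𝓕 (fun y => η (A.symbol ξ (u y))) ξ := by
  have hIntg : ∀ (α : V →L[ℝ] ℂ), Integrable (fun y => α (u y)) := fun α =>
    (testFun_comp hu α).1.continuous.integrable_of_hasCompactSupport (testFun_comp hu α).2
  simp only [app_expand, symbol_expand A ξ, map_sum, ContinuousLinearMap.sum_apply,
    ContinuousLinearMap.smul_apply, map_smul]
  simp only [Real.fourier_eq]
  simp only [Finset.smul_sum]
  rw [integral_finset_sum, integral_finset_sum, Finset.mul_sum]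
  · refine Finset.sum_congr rfl fun J _ => ?_
    have := fourier_deriv hu (η.comp (A.comp (tens fun i => stdOrthonormalBasis ℝ X (J i))))
      (fun i => stdOrthonormalBasis ℝ X (J i)) ξ
    simp only [Real.fourier_eq, ContinuousLinearMap.comp_apply] at this ⊢
    rw [this, mul_assoc]
    congr 1
    rw [← integral_const_mul]
    congr 1
    ext y
    simp only [Circle.smul_def, smul_eq_mul, Complex.real_smul]
    ring
  · intro J _
    have := (hIntg (η.comp (A.comp (tens fun i => stdOrthonormalBasis ℝ X (J i))))).smul
      (∏ i, ⟪ξ, stdOrthonormalBasis ℝ X (J i)⟫)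
    exact (Real.fourierIntegral_convergent_iff ξ).2 this
  · intro J _
    have := deriv_apply_integrable hu (η.comp (A.comp (tens fun i => stdOrthonormalBasis ℝ X (J i))))
      (fun i => stdOrthonormalBasis ℝ X (J i))
    exact (Real.fourierIntegral_convergent_iff ξ).2 this

lemma fubini_pairing {m : X → (E →L[ℝ] ℂ)} (hm : Continuous m) (hmi : Integrable m)
    {f : X → E} (hf : Continuous f) (hfi : Integrable f) (x : X) :
    ∫ y, (𝓕⁻ m (x - y)) (f y) = ∫ ξ, Real.fourierChar ⟪ξ, x⟫ • 𝓕 (fun y => m ξ (f y)) ξ := by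
  have hcont : Continuous (fun p : X × X => Real.fourierChar ⟪p.2, x - p.1⟫ • (m p.2) (f p.1)) := by
    refine Continuous.smul ?_ ?_
    · have h0 : Continuous (fun p : X × X => ⟪p.2, x - p.1⟫) := by fun_prop
      exact continuous_subtype_val.comp (Real.continuous_fourierChar.comp h0)
    · exact (hm.comp continuous_snd).clm_apply (hf.comp continuous_fst)
  have hIntg : Integrable (fun p : X × X => Real.fourierChar ⟪p.2, x - p.1⟫ • (m p.2) (f p.1))
      (volume.prod volume) := by
    refine (Integrable.mul_prod hfi.norm hmi.norm).mono hcont.aestronglyMeasurable ?_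
    refine Filter.Eventually.of_forall fun p => ?_
    rw [Circle.norm_smul, norm_mul, norm_norm, norm_norm, mul_comm]
    exact (m p.2).le_opNorm _
  have h1 : ∀ y, (𝓕⁻ m (x - y)) (f y)
      = ∫ ξ, Real.fourierChar ⟪ξ, x - y⟫ • (m ξ) (f y) := by
    intro y
    rw [Real.fourierInv_eq, ContinuousLinearMap.integral_apply]
    · rfl
    · have := (Real.fourierIntegral_convergent_iff (μ := volume) (f := m) (-(x - y))).2 hmi
      simpa only [inner_neg_right, neg_neg] using this
  simp_rw [h1]
  rw [integral_integral_swap hIntg]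
  congr 1
  ext ξ
  rw [Real.fourier_eq]
  simp only [Circle.smul_def, smul_eq_mul]
  rw [← integral_const_mul]
  congr 1
  ext y
  rw [inner_sub_right, sub_eq_add_neg, AddChar.map_add_eq_mul, Circle.coe_mul, mul_assoc,
    real_inner_comm ξ y]

lemma fourierInv_scale {G : Type*} [NormedAddCommGroup G] [NormedSpace ℂ G] (m : X → G) {t : ℝ}
    (ht : 0 < t) (x : X) :
    𝓕⁻ (fun ξ => m (t⁻¹ • ξ)) x = ((t ^ Module.finrank ℝ X : ℝ) : ℂ) • 𝓕⁻ m (t • x) := by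
  rw [Real.fourierInv_eq, Real.fourierInv_eq]
  have := Measure.integral_comp_inv_smul_of_nonneg (volume : Measure X)
    (fun v => Real.fourierChar ⟪v, t • x⟫ • m v) ht.le
  rw [Complex.coe_smul, ← this]
  congr 1
  ext v
  rw [real_inner_smul_left, real_inner_smul_right, ← mul_assoc, inv_mul_cancel₀ ht.ne', one_mul]

end Fourier

section Cut

variable {X : Type*} [NormedAddCommGroup X] [InnerProductSpace ℝ X] [FiniteDimensional ℝ X]
  {G : Type*} [NormedAddCommGroup G] [NormedSpace ℝ G]

/-- a smooth cutoff -/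
def chiB (X : Type*) [NormedAddCommGroup X] [InnerProductSpace ℝ X] : ContDiffBump (0 : X) :=
  ⟨1, 2, one_pos, one_lt_two⟩

/-- a smooth cutoff, as a function -/
def chi (ξ : X) : ℝ := chiB X ξ

/-- a smooth annular cutoff -/
def rho (ξ : X) : ℝ := chi ((2 : ℝ)⁻¹ • ξ) - chi ξ

lemma chi_contDiff : ContDiff ℝ (⊤ : ℕ∞) (chi : X → ℝ) := (chiB X).contDiff

lemma chi_eq_one {ξ : X} (h : ‖ξ‖ ≤ 1) : chi ξ = 1 :=
  (chiB X).one_of_mem_closedBall (by simpa [chiB] using h)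

lemma chi_eq_zero {ξ : X} (h : 2 ≤ ‖ξ‖) : chi ξ = 0 :=
  (chiB X).zero_of_le_dist (by simpa [chiB] using h)

lemma chi_supp : HasCompactSupport (chi : X → ℝ) := (chiB X).hasCompactSupport

lemma rho_contDiff : ContDiff ℝ (⊤ : ℕ∞) (rho : X → ℝ) :=
  (chi_contDiff.comp (contDiff_const_smul _)).sub chi_contDiff

lemma rho_eq_zero_small {ξ : X} (h : ‖ξ‖ ≤ 1) : rho ξ = 0 := by
  rw [rho, chi_eq_one h, chi_eq_one, sub_self]
  rw [norm_smul]; norm_num; linarith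

lemma rho_eq_zero_large {ξ : X} (h : 4 ≤ ‖ξ‖) : rho ξ = 0 := by
  rw [rho, chi_eq_zero (ξ := ξ) (by linarith), chi_eq_zero, sub_self]
  rw [norm_smul]; norm_num; linarith

lemma rho_eq_one {ξ : X} (h : ‖ξ‖ = 2) : rho ξ = 1 := by
  rw [rho, chi_eq_zero (ξ := ξ) (by linarith), chi_eq_one, sub_zero]
  rw [norm_smul, h]; norm_num

lemma rho_nonneg (ξ : X) : 0 ≤ rho ξ := by
  rw [rho, sub_nonneg]
  rcases le_total ‖ξ‖ 2 with h | h
  · rw [chi_eq_one (ξ := (2 : ℝ)⁻¹ • ξ)]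
    · exact (chiB X).le_one
    · rw [norm_smul]; norm_num; linarith
  · rw [chi_eq_zero h]; exact (chiB X).nonneg

lemma rho_supp : HasCompactSupport (rho : X → ℝ) := by
  refine HasCompactSupport.intro (isCompact_closedBall (0 : X) 4) fun x hx => ?_
  refine rho_eq_zero_large ?_
  simp only [Metric.mem_closedBall, dist_zero_right, not_le] at hx
  exact hx.le

lemma rho_smul_contDiff {F : X → G} (hF : ∀ ξ, ξ ≠ 0 → ContDiffAt ℝ (⊤ : ℕ∞) F ξ) :
    ContDiff ℝ (⊤ : ℕ∞) (fun ξ => rho ξ • F ξ) := by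
  rw [contDiff_iff_contDiffAt]
  intro ξ
  by_cases h : ξ = 0
  · subst h
    have : (fun ξ => rho ξ • F ξ) =ᶠ[nhds 0] fun _ => 0 := by
      filter_upwards [Metric.ball_mem_nhds (0 : X) one_pos] with y hy
      rw [rho_eq_zero_small (by simpa using (Metric.mem_ball.1 hy).le), zero_smul]
    exact contDiffAt_const.congr_of_eventuallyEq this
  · exact rho_contDiff.contDiffAt.smul (hF ξ h)

lemma rho_smul_supp (F : X → G) : HasCompactSupport (fun ξ => rho ξ • F ξ) :=
  rho_supp.smul_right

end Cut

end HardyCanc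

/-! ### Part 3: kernels -/
namespace HardyCanc

open FourierTransform

section Kernel

variable {X : Type*} [NormedAddCommGroup X] [InnerProductSpace ℝ X] [FiniteDimensional ℝ X]

lemma tele {t : ℝ} (ht : 0 < t) {r : ℝ} (hr : 0 ≤ r) {s : ℕ} (hs : 1 ≤ s) (M : ℕ) :
    ∑ i ∈ Finset.range M, (2 ^ i * t * r) ^ s / (1 + 2 ^ i * t * r) ^ (s + 1) ≤ 2 := by
  have key : ∀ a : ℝ, 0 ≤ a → a ^ s / (1 + a) ^ (s + 1) ≤ 2 * (1 / (1 + a) - 1 / (1 + 2 * a)) := by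
    intro a ha
    obtain ⟨q, rfl⟩ : ∃ q, s = q + 1 := ⟨s - 1, by omega⟩
    have h1 : a ^ (q + 1) / (1 + a) ^ (q + 1 + 1) ≤ a / (1 + a) ^ 2 := by
      rw [div_le_div_iff₀ (by positivity) (by positivity)]
      have : a ^ q ≤ (1 + a) ^ q := pow_le_pow_left₀ ha (by linarith) q
      calc a ^ (q + 1) * (1 + a) ^ 2 = a ^ q * (a * (1 + a) ^ 2) := by ring
        _ ≤ (1 + a) ^ q * (a * (1 + a) ^ 2) := by gcongr
        _ = a * (1 + a) ^ (q + 1 + 1) := by ring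
    refine h1.trans ?_
    rw [div_sub_div _ _ (by positivity) (by positivity), mul_div_assoc', div_le_div_iff₀
      (by positivity) (by positivity)]
    nlinarith [mul_nonneg ha ha, mul_nonneg (mul_nonneg ha ha) ha]
  calc ∑ i ∈ Finset.range M, (2 ^ i * t * r) ^ s / (1 + 2 ^ i * t * r) ^ (s + 1)
      ≤ ∑ i ∈ Finset.range M, 2 * (1 / (1 + 2 ^ i * t * r) - 1 / (1 + 2 ^ (i + 1) * t * r)) := by
        refine Finset.sum_le_sum fun i _ => ?_
        have := key (2 ^ i * t * r) (by positivity)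
        rw [show 2 ^ (i + 1) * t * r = 2 * (2 ^ i * t * r) by ring]
        exact this
    _ = 2 * (1 / (1 + 2 ^ 0 * t * r) - 1 / (1 + 2 ^ M * t * r)) := by
        rw [← Finset.mul_sum, Finset.sum_range_sub' (fun i : ℕ => 1 / (1 + 2 ^ i * t * r))]
    _ ≤ 2 * (1 - 0) := by
        gcongr
        · rw [div_le_one (by positivity)]
          have : 0 ≤ 2 ^ 0 * t * r := by positivity
          linarith
        · positivity
    _ = 2 := by norm_num

/-- dyadic sum of dilations of a kernel -/
def dySum {G : Type*} [NormedAddCommGroup G] [NormedSpace ℝ G] (h : X → G) (s : ℕ) (t : ℝ) (M : ℕ)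
    (x : X) : G :=
  ∑ i ∈ Finset.range M, ((2 : ℝ) ^ i * t) ^ s • h (((2 : ℝ) ^ i * t) • x)

lemma dySum_bound {G : Type*} [NormedAddCommGroup G] [NormedSpace ℝ G] {h : X → G} {s : ℕ}
    (hs : 1 ≤ s) {C : ℝ} (hC : 0 ≤ C) (hh : ∀ x, ‖h x‖ * (1 + ‖x‖) ^ (s + 1) ≤ C) {t : ℝ}
    (ht : 0 < t) (M : ℕ) (x : X) :
    ‖dySum h s t M x‖ * ‖x‖ ^ s ≤ 2 * C := by
  calc ‖dySum h s t M x‖ * ‖x‖ ^ s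
      ≤ (∑ i ∈ Finset.range M, ‖((2 : ℝ) ^ i * t) ^ s • h (((2 : ℝ) ^ i * t) • x)‖) * ‖x‖ ^ s := by
        gcongr
        exact norm_sum_le _ _
    _ = ∑ i ∈ Finset.range M, ‖((2 : ℝ) ^ i * t) ^ s • h (((2 : ℝ) ^ i * t) • x)‖ * ‖x‖ ^ s := by
        rw [Finset.sum_mul]
    _ ≤ ∑ i ∈ Finset.range M, C * ((2 ^ i * t * ‖x‖) ^ s / (1 + 2 ^ i * t * ‖x‖) ^ (s + 1)) := by
        refine Finset.sum_le_sum fun i _ => ?_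
        have h1 := hh (((2 : ℝ) ^ i * t) • x)
        have hti : 0 < (2 : ℝ) ^ i * t := by positivity
        rw [norm_smul, Real.norm_of_nonneg hti.le] at h1
        rw [norm_smul, Real.norm_of_nonneg (by positivity), mul_div_assoc', le_div_iff₀
          (by positivity), mul_pow (2 ^ i * t) ‖x‖]
        calc _ = (((2 : ℝ) ^ i * t) ^ s * ‖x‖ ^ s) * (‖h (((2 : ℝ) ^ i * t) • x)‖ *
              (1 + 2 ^ i * t * ‖x‖) ^ (s + 1)) := by ring
          _ ≤ (((2 : ℝ) ^ i * t) ^ s * ‖x‖ ^ s) * C := by gcongr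
          _ = _ := by ring
    _ ≤ C * 2 := by
        rw [← Finset.mul_sum]
        gcongr
        exact tele ht (norm_nonneg x) hs M
    _ = 2 * C := by ring

lemma dySum_diff {G : Type*} [NormedAddCommGroup G] [NormedSpace ℝ G] {h : X → G} {s : ℕ}
    {C : ℝ} (hC : 0 ≤ C) (hd : Differentiable ℝ h)
    (hh : ∀ x, ‖fderiv ℝ h x‖ * (1 + ‖x‖) ^ (s + 2) ≤ C) {t : ℝ}
    (ht : 0 < t) (M : ℕ) (x y : X) (hxy : ‖y‖ ≤ ‖x‖ / 2) :
    ‖dySum h s t M (x - y) - dySum h s t M x‖ * (‖x‖ / 2) ^ (s + 1) ≤ 2 * C * ‖y‖ := by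
  set r := ‖x‖ / 2 with hr
  have hr0 : 0 ≤ r := by positivity
  have step : ∀ τ : ℝ, 0 < τ → ‖h (τ • (x - y)) - h (τ • x)‖ ≤
      C / (1 + τ * r) ^ (s + 2) * (τ * ‖y‖) := by
    intro τ hτ
    have hb : ∀ z ∈ Metric.closedBall (τ • x) (τ * r), ‖fderiv ℝ h z‖ ≤ C / (1 + τ * r) ^ (s + 2) := by
      intro z hz
      have hz1 : τ * r ≤ ‖z‖ := by
        have h1 : ‖τ • x‖ ≤ ‖z‖ + ‖z - τ • x‖ := by
          have := norm_sub_le z (z - τ • x)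
          simpa using this
        rw [Metric.mem_closedBall, dist_eq_norm] at hz
        rw [norm_smul, Real.norm_of_nonneg hτ.le] at h1
        have : ‖x‖ = 2 * r := by rw [hr]; ring
        rw [this] at h1
        linarith
      rw [le_div_iff₀ (by positivity)]
      refine le_trans ?_ (hh z)
      gcongr
    have := (convex_closedBall (τ • x) (τ * r)).norm_image_sub_le_of_norm_fderiv_le
      (fun z _ => hd z) hb (x := τ • x) (y := τ • (x - y))
      (Metric.mem_closedBall_self (by positivity)) (by
        rw [Metric.mem_closedBall, dist_eq_norm, ← smul_sub, norm_smul, Real.norm_of_nonneg hτ.le]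
        simp only [sub_sub_cancel_left, norm_neg]
        gcongr)
    refine this.trans (le_of_eq ?_)
    rw [← smul_sub, norm_smul, Real.norm_of_nonneg hτ.le]
    simp
  have e1 : dySum h s t M (x - y) - dySum h s t M x = ∑ i ∈ Finset.range M,
      ((2 : ℝ) ^ i * t) ^ s • (h (((2 : ℝ) ^ i * t) • (x - y)) - h (((2 : ℝ) ^ i * t) • x)) := by
    simp only [dySum, smul_sub, Finset.sum_sub_distrib]
  rw [e1]
  calc _ ≤ (∑ i ∈ Finset.range M, ‖((2 : ℝ) ^ i * t) ^ s • (h (((2 : ℝ) ^ i * t) • (x - y)) -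
          h (((2 : ℝ) ^ i * t) • x))‖) * r ^ (s + 1) := by
        gcongr
        exact norm_sum_le _ _
    _ = ∑ i ∈ Finset.range M, ‖((2 : ℝ) ^ i * t) ^ s • (h (((2 : ℝ) ^ i * t) • (x - y)) -
          h (((2 : ℝ) ^ i * t) • x))‖ * r ^ (s + 1) := by
        rw [Finset.sum_mul]
    _ ≤ ∑ i ∈ Finset.range M, C * ‖y‖ *
          ((2 ^ i * t * r) ^ (s + 1) / (1 + 2 ^ i * t * r) ^ (s + 1 + 1)) := by
        refine Finset.sum_le_sum fun i _ => ?_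
        have hti : 0 < (2 : ℝ) ^ i * t := by positivity
        have h1 := step _ hti
        rw [norm_smul, Real.norm_of_nonneg (by positivity)]
        calc _ ≤ ((2 : ℝ) ^ i * t) ^ s * (C / (1 + 2 ^ i * t * r) ^ (s + 2) * (2 ^ i * t * ‖y‖))
              * r ^ (s + 1) := by gcongr
          _ = _ := by rw [mul_pow (2 ^ i * t) r]; ring
    _ ≤ C * ‖y‖ * 2 := by
        rw [← Finset.mul_sum]
        gcongr
        exact tele ht hr0 (by omega) M
    _ = 2 * C * ‖y‖ := by ring

variable [MeasurableSpace X] [BorelSpace X]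

lemma kernel_props {G : Type*} [NormedAddCommGroup G] [NormedSpace ℂ G] {m : X → G}
    (hm : ContDiff ℝ (⊤ : ℕ∞) m) (hs : HasCompactSupport m) (p : ℕ) :
    ContDiff ℝ (⊤ : ℕ∞) (𝓕⁻ m) ∧ ∃ C : ℝ, 0 < C ∧ (∀ x, ‖𝓕⁻ m x‖ * (1 + ‖x‖) ^ p ≤ C) ∧
      (∀ x, ‖fderiv ℝ (𝓕⁻ m) x‖ * (1 + ‖x‖) ^ p ≤ C) := by
  set S : SchwartzMap X G := 𝓕⁻ (hs.toSchwartzMap hm) with hS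
  have hco : (S : X → G) = 𝓕⁻ m := by
    rw [hS, SchwartzMap.fourierInv_coe]; rfl
  rw [← hco]
  refine ⟨S.smooth _, ?_⟩
  set C := 2 ^ p * (Finset.Iic ((p, 1) : ℕ × ℕ)).sup
    (fun m => SchwartzMap.seminorm ℝ (E := X) (F := G) m.1 m.2) S
  refine ⟨|C| + 1, by positivity, fun x => ?_, fun x => ?_⟩
  · have := SchwartzMap.one_add_le_sup_seminorm_apply (𝕜 := ℝ) (m := (p, 1)) (k := p) (n := 0)
      le_rfl (by simp) S x
    rw [norm_iteratedFDeriv_zero, mul_comm] at this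
    exact this.trans ((le_abs_self C).trans (by linarith))
  · have := SchwartzMap.one_add_le_sup_seminorm_apply (𝕜 := ℝ) (m := (p, 1)) (k := p) (n := 1)
      le_rfl (by simp) S x
    rw [norm_iteratedFDeriv_one, mul_comm] at this
    exact this.trans ((le_abs_self C).trans (by linarith))

variable {E : Type*} [NormedAddCommGroup E] [NormedSpace ℝ E]

/-- version for spaces of linear maps -/
lemma kernel_props' {m : X → (E →L[ℝ] ℂ)}
    (hm : ContDiff ℝ (⊤ : ℕ∞) m) (hs : HasCompactSupport m) (p : ℕ) :
    ContDiff ℝ (⊤ : ℕ∞) (𝓕⁻ m) ∧ ∃ C : ℝ, 0 < C ∧ (∀ x, ‖𝓕⁻ m x‖ * (1 + ‖x‖) ^ p ≤ C) ∧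
      (∀ x, ‖fderiv ℝ (𝓕⁻ m) x‖ * (1 + ‖x‖) ^ p ≤ C) :=
  kernel_props hm hs p

end Kernel

end HardyCanc

namespace HardyCanc
open FourierTransform Filter

section Repro
variable {X : Type*} [NormedAddCommGroup X] [InnerProductSpace ℝ X] [FiniteDimensional ℝ X]
  [MeasurableSpace X] [BorelSpace X]
  {k : ℕ} {V E : Type*} [NormedAddCommGroup V] [InnerProductSpace ℝ V] [FiniteDimensional ℝ V]
  [NormedAddCommGroup E] [InnerProductSpace ℝ E] [FiniteDimensional ℝ E]

/-- the symbol of one dyadic piece of the representation kernel -/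
def mk (A : DiffOperator X k V E) {j : ℕ} (l : ℕ) (w : Fin j → X) (α : V →L[ℝ] ℂ) (ξ : X) :
    E →L[ℝ] ℂ :=
  rho ξ • ((∏ i, ⟪ξ, w i⟫) •
    ((((2 * Real.pi * Complex.I : ℂ) ^ l)⁻¹ • α).comp (pinv A ξ)))

lemma mk_contDiff (A : DiffOperator X k V E) (hA : A.IsElliptic) {j : ℕ} (l : ℕ) (w : Fin j → X)
    (α : V →L[ℝ] ℂ) : ContDiff ℝ (⊤ : ℕ∞) (mk A l w α) := by
  unfold mk
  apply rho_smul_contDiff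
  intro ξ hξ
  have h1 : ContDiffAt ℝ (⊤ : ℕ∞) (fun ξ : X => ∏ i, ⟪ξ, w i⟫) ξ :=
    (contDiff_prod fun i _ => contDiff_id.inner ℝ contDiff_const).contDiffAt
  have h2 : ContDiffAt ℝ (⊤ : ℕ∞) (fun ξ : X =>
      (((2 * Real.pi * Complex.I : ℂ) ^ l)⁻¹ • α).comp (pinv A ξ)) ξ :=
    contDiffAt_const.clm_comp (contDiffAt_pinv A hA hξ)
  exact h1.fun_smul h2

lemma mk_supp (A : DiffOperator X k V E) {j : ℕ} (l : ℕ) (w : Fin j → X)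
    (α : V →L[ℝ] ℂ) : HasCompactSupport (mk A l w α) := by
  exact rho_smul_supp (fun ξ => (∏ i, ⟪ξ, w i⟫) •
    ((((2 * Real.pi * Complex.I : ℂ) ^ l)⁻¹ • α).comp (pinv A ξ)))

lemma mk_symbol (A : DiffOperator X k V E) (hA : A.IsElliptic) {j l : ℕ} (hjl : j + l = k)
    (w : Fin j → X) (α : V →L[ℝ] ℂ) {t : ℝ} (ht : 0 < t) (ξ : X) (v : V) :
    mk A l w α (t⁻¹ • ξ) (A.symbol ξ v)
      = ((t ^ l * rho (t⁻¹ • ξ) * (∏ i, ⟪ξ, w i⟫) : ℝ) : ℂ)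
        * (((2 * Real.pi * Complex.I : ℂ) ^ l)⁻¹ * α v) := by
  by_cases h0 : ξ = 0
  · subst h0
    simp [mk, rho_eq_zero_small (X := X) (ξ := 0) (by simp)]
  set ζ := t⁻¹ • ξ with hζ
  have hξ : ξ = t • ζ := by rw [hζ, smul_smul, mul_inv_cancel₀ ht.ne', one_smul]
  have hζ0 : ζ ≠ 0 := by
    intro h; rw [h, smul_zero] at hξ; exact h0 hξ
  have h1 : pinv A ζ (A.symbol ζ v) = v := by
    have := congrArg (fun F => F v) (pinv_comp A hA hζ0)
    simpa using this
  rw [hξ, symbol_smul]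
  simp only [mk, ContinuousLinearMap.smul_apply, ContinuousLinearMap.comp_apply, map_smul, h1,
    inner_smul_left, Finset.prod_mul_distrib, Finset.prod_const, Finset.card_univ, Fintype.card_fin]
  simp only [Complex.real_smul, smul_eq_mul, conj_trivial]
  rw [← hjl]
  push_cast
  ring

lemma piece (A : DiffOperator X k V E) (hA : A.IsElliptic) {j l s : ℕ} (hjl : j + l = k)
    (hs : s + l = Module.finrank ℝ X)
    (w : Fin j → X) (α : V →L[ℝ] ℂ) {u : X → V} (hu : IsTestFun u) {t : ℝ} (ht : 0 < t) (x : X) :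
    ∫ y, (t ^ s • 𝓕⁻ (mk A l w α) (t • (x - y))) (A.app u y)
      = ∫ ξ, Real.fourierChar ⟪ξ, x⟫ • ((rho (t⁻¹ • ξ) : ℂ)
          * 𝓕 (fun y => α (iteratedFDeriv ℝ j u y w)) ξ) := by
  have hc : Continuous (fun ξ => mk A l w α (t⁻¹ • ξ)) :=
    (mk_contDiff A hA l w α).continuous.comp (continuous_const_smul _)
  have hi : Integrable (fun ξ => mk A l w α (t⁻¹ • ξ)) := by
    have := ((mk_contDiff A hA l w α).continuous.integrable_of_hasCompactSupport
      (mk_supp A l w α) (μ := volume))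
    exact this.comp_smul (inv_ne_zero ht.ne')
  have h1 := fubini_pairing hc hi (app_cont A hu) (app_integrable A hu) x
  have h2 : ∀ y, (t ^ s • 𝓕⁻ (mk A l w α) (t • (x - y))) (A.app u y)
      = (((t ^ l)⁻¹ : ℝ) : ℂ) * (𝓕⁻ (fun ξ => mk A l w α (t⁻¹ • ξ)) (x - y)) (A.app u y) := by
    intro y
    rw [fourierInv_scale _ ht, ← hs, pow_add]
    simp only [ContinuousLinearMap.smul_apply, smul_eq_mul, Complex.real_smul]
    have : (t : ℂ) ≠ 0 := by exact_mod_cast ht.ne'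
    push_cast
    field_simp
  simp_rw [h2]
  rw [integral_const_mul, h1, ← integral_const_mul]
  congr 1
  ext ξ
  rw [mul_smul_comm]
  congr 1
  rw [fourier_app A hu, fourier_deriv hu]
  simp_rw [mk_symbol A hA hjl w α ht]
  have h3 : 𝓕 (fun y => ((t ^ l * rho (t⁻¹ • ξ) * (∏ i, ⟪ξ, w i⟫) : ℝ) : ℂ)
        * (((2 * Real.pi * Complex.I : ℂ) ^ l)⁻¹ * α (u y))) ξ
      = ((t ^ l * rho (t⁻¹ • ξ) * (∏ i, ⟪ξ, w i⟫) : ℝ) : ℂ)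
        * (((2 * Real.pi * Complex.I : ℂ) ^ l)⁻¹ * 𝓕 (fun y => α (u y)) ξ) := by
    simp only [Real.fourier_eq]
    rw [← integral_const_mul, ← integral_const_mul]
    congr 1
    ext y
    simp only [Circle.smul_def, smul_eq_mul]
    ring
  rw [h3, ← hjl, pow_add]
  have h4 : (2 * Real.pi * Complex.I : ℂ) ≠ 0 := Complex.two_pi_I_ne_zero
  have : (t : ℂ) ≠ 0 := by exact_mod_cast ht.ne'
  push_cast
  field_simp

lemma rho_sum (t : ℝ) (ht : 0 < t) (M : ℕ) (ξ : X) :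
    ∑ i ∈ Finset.range M, rho (((2 : ℝ) ^ i * t)⁻¹ • ξ)
      = chi (((2 : ℝ) ^ M * t)⁻¹ • ξ) - chi (t⁻¹ • ξ) := by
  have : ∀ i, rho (((2 : ℝ) ^ i * t)⁻¹ • ξ)
      = chi (((2 : ℝ) ^ (i + 1) * t)⁻¹ • ξ) - chi (((2 : ℝ) ^ i * t)⁻¹ • ξ) := by
    intro i
    rw [rho, smul_smul, pow_succ]
    congr 3
    field_simp
  simp_rw [this]
  rw [Finset.sum_range_sub (fun i => chi (((2 : ℝ) ^ i * t)⁻¹ • ξ))]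
  simp

lemma chi_abs_le (ξ : X) : |chi ξ| ≤ 1 := by
  rw [abs_of_nonneg (show 0 ≤ chi ξ from (chiB X).nonneg)]; exact (chiB X).le_one

lemma deriv_isTest {u : X → V} (hu : IsTestFun u) {j : ℕ} (α : V →L[ℝ] ℂ) (w : Fin j → X) :
    IsTestFun (fun y => α (iteratedFDeriv ℝ j u y w)) := by
  have h0 : IsTestFun (iteratedFDeriv ℝ j u) := by
    refine ⟨hu.1.iteratedFDeriv_right ?_, testFun_deriv_supp hu j⟩
    exact_mod_cast le_top
  exact testFun_comp h0 (α.comp (ContinuousMultilinearMap.apply ℝ (fun _ : Fin j => X) V w))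

lemma test_fourier_integrable {g : X → ℂ} (hg : IsTestFun g) : Integrable (𝓕 g) := by
  have := (𝓕 (hg.2.toSchwartzMap hg.1)).integrable (μ := volume)
  rw [SchwartzMap.fourier_coe] at this
  exact this

lemma chi_lim_one (ξ : X) : ∀ᶠ N : ℕ in atTop, chi (((2 : ℝ) ^ N)⁻¹ • ξ) = 1 := by
  have h : Tendsto (fun N : ℕ => (2 : ℝ) ^ N) atTop atTop :=
    tendsto_pow_atTop_atTop_of_one_lt one_lt_two
  filter_upwards [h.eventually_ge_atTop ‖ξ‖] with N hN
  apply chi_eq_one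
  rw [norm_smul, norm_inv, Real.norm_of_nonneg (by positivity), inv_mul_le_iff₀ (by positivity)]
  simpa using hN

lemma chi_lim_zero {ξ : X} (hξ : ξ ≠ 0) : ∀ᶠ N : ℕ in atTop, chi (((2 : ℝ) ^ N) • ξ) = 0 := by
  have h : Tendsto (fun N : ℕ => (2 : ℝ) ^ N) atTop atTop :=
    tendsto_pow_atTop_atTop_of_one_lt one_lt_two
  filter_upwards [h.eventually_ge_atTop (2 / ‖ξ‖)] with N hN
  apply chi_eq_zero
  rw [norm_smul, Real.norm_of_nonneg (by positivity)]
  have : 0 < ‖ξ‖ := norm_pos_iff.2 hξ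
  rwa [div_le_iff₀ this] at hN

lemma repro (hd : 0 < Module.finrank ℝ X)
    (A : DiffOperator X k V E) (hA : A.IsElliptic) {j l s : ℕ} (hjl : j + l = k)
    (hs : s + l = Module.finrank ℝ X)
    (w : Fin j → X) (α : V →L[ℝ] ℂ) {u : X → V} (hu : IsTestFun u) (x : X) :
    Tendsto (fun N : ℕ => ∫ y, dySum (𝓕⁻ (mk A l w α)) s (((2 : ℝ) ^ N)⁻¹) (2 * N) (x - y)
      (A.app u y)) atTop (nhds (α (iteratedFDeriv ℝ j u x w))) := by
  set g : X → ℂ := fun y => α (iteratedFDeriv ℝ j u y w) with hg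
  have hgt : IsTestFun g := deriv_isTest hu α w
  have hgi : Integrable (𝓕 g) := test_fourier_integrable hgt
  have hgint : Integrable g := hgt.1.continuous.integrable_of_hasCompactSupport hgt.2
  have hinv : 𝓕⁻ (𝓕 g) x = g x :=
    congrFun (hgt.1.continuous.fourierInv_fourier_eq hgint hgi) x
  have hkc : Continuous (𝓕⁻ (mk A l w α)) :=
    (kernel_props' (mk_contDiff A hA l w α) (mk_supp A l w α) 1).1.continuous
  have hchar : Continuous (fun ξ : X => Real.fourierChar ⟪ξ, x⟫) :=
    Real.continuous_fourierChar.comp (by fun_prop)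
  have hrint : ∀ t : ℝ, Integrable (fun ξ => Real.fourierChar ⟪ξ, x⟫ • ((rho (t⁻¹ • ξ) : ℂ)
          * 𝓕 g ξ)) := by
    intro t
    refine (hgi.norm.const_mul 2).mono' ?_ ?_
    · refine AEStronglyMeasurable.smul (f := fun ξ : X => (Real.fourierChar ⟪ξ, x⟫))
        hchar.aestronglyMeasurable ?_
      refine AEStronglyMeasurable.mul ?_ hgi.1
      exact (Complex.continuous_ofReal.comp
        (rho_contDiff.continuous.comp (continuous_const_smul _))).aestronglyMeasurable
    · refine Eventually.of_forall fun ξ => ?_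
      rw [Circle.norm_smul, norm_mul]
      gcongr
      rw [Complex.norm_real, rho, Real.norm_eq_abs]
      have h1 := chi_abs_le ((2 : ℝ)⁻¹ • t⁻¹ • ξ)
      have h2 := chi_abs_le (t⁻¹ • ξ)
      have := abs_sub (chi ((2 : ℝ)⁻¹ • t⁻¹ • ξ)) (chi (t⁻¹ • ξ))
      linarith
  have hform : ∀ N : ℕ, ∫ y, dySum (𝓕⁻ (mk A l w α)) s (((2 : ℝ) ^ N)⁻¹) (2 * N) (x - y)
      (A.app u y) = ∫ ξ, Real.fourierChar ⟪ξ, x⟫ • (((chi (((2 : ℝ) ^ N)⁻¹ • ξ)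
        - chi (((2 : ℝ) ^ N) • ξ) : ℝ) : ℂ) * 𝓕 g ξ) := by
    intro N
    simp only [dySum, ContinuousLinearMap.sum_apply]
    rw [integral_finset_sum]
    · have hp : ∀ i : ℕ, 0 < (2 : ℝ) ^ i * ((2 : ℝ) ^ N)⁻¹ := fun i => by positivity
      simp_rw [fun i => piece A hA hjl hs w α hu (hp i) x]
      rw [← integral_finset_sum]
      · congr 1
        ext ξ
        rw [← Finset.smul_sum, ← Finset.sum_mul]
        congr 2
        rw [← Complex.ofReal_sum, rho_sum _ (by positivity)]
        rw [inv_inv]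
        congr 4
        rw [two_mul, pow_add]
        field_simp
      · intro i _
        exact hrint _
    · intro i _
      refine Continuous.integrable_of_hasCompactSupport ?_ ?_
      · refine Continuous.clm_apply ?_ (app_cont A hu)
        have h5 : Continuous (fun y : X => ((2 : ℝ) ^ i * ((2 : ℝ) ^ N)⁻¹) • (x - y)) := by fun_prop
        exact (hkc.comp h5).const_smul (((2 : ℝ) ^ i * ((2 : ℝ) ^ N)⁻¹) ^ s)
      · refine (app_supp A hu).mono fun y hy => ?_
        contrapose! hy
        simp only [Function.notMem_support] at hy ⊢
        rw [hy, map_zero]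
  simp_rw [hform]
  rw [show α (iteratedFDeriv ℝ j u x w) = g x from rfl, ← hinv, Real.fourierInv_eq]
  refine tendsto_integral_of_dominated_convergence (fun ξ => 2 * ‖𝓕 g ξ‖) ?_ (hgi.norm.const_mul 2)
    ?_ ?_
  · intro N
    refine AEStronglyMeasurable.smul (f := fun ξ : X => (Real.fourierChar ⟪ξ, x⟫))
        hchar.aestronglyMeasurable ?_
    refine AEStronglyMeasurable.mul ?_ hgi.1
    exact (Complex.continuous_ofReal.comp
        ((chi_contDiff.continuous.comp (continuous_const_smul _)).sub
        (chi_contDiff.continuous.comp (continuous_const_smul _)))).aestronglyMeasurable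
  · intro N
    refine Eventually.of_forall fun ξ => ?_
    rw [Circle.norm_smul, norm_mul]
    gcongr
    rw [Complex.norm_real, Real.norm_eq_abs]
    have h1 := chi_abs_le (((2 : ℝ) ^ N)⁻¹ • ξ)
    have h2 := chi_abs_le (((2 : ℝ) ^ N) • ξ)
    have := abs_sub (chi (((2 : ℝ) ^ N)⁻¹ • ξ)) (chi (((2 : ℝ) ^ N) • ξ))
    linarith
  · have : Nontrivial X := Module.nontrivial_of_finrank_pos hd
    have h0 : ∀ᵐ ξ : X, ξ ≠ 0 := by
      simp [ae_iff, measure_singleton]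
    filter_upwards [h0] with ξ hξ
    refine tendsto_const_nhds.congr' ?_
    filter_upwards [chi_lim_one ξ, chi_lim_zero hξ] with N h1 h2
    rw [h1, h2]
    simp

end Repro
end HardyCanc

namespace HardyCanc
open FourierTransform Filter

section Canc
variable {X : Type*} [NormedAddCommGroup X] [InnerProductSpace ℝ X] [FiniteDimensional ℝ X]
  [MeasurableSpace X] [BorelSpace X]
  {k : ℕ} {V E : Type*} [NormedAddCommGroup V] [InnerProductSpace ℝ V] [FiniteDimensional ℝ V]
  [NormedAddCommGroup E] [InnerProductSpace ℝ E] [FiniteDimensional ℝ E]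

lemma rhoproj_contDiff (A : DiffOperator X k V E) (hA : A.IsElliptic) :
    ContDiff ℝ (⊤ : ℕ∞) (fun ξ => rho ξ • proj A ξ) :=
  rho_smul_contDiff fun _ hξ => contDiffAt_proj A hA hξ

lemma rhoproj_integrable (A : DiffOperator X k V E) (hA : A.IsElliptic) :
    Integrable (fun ξ => rho ξ • proj A ξ) :=
  (rhoproj_contDiff A hA).continuous.integrable_of_hasCompactSupport (rho_smul_supp (proj A))

lemma exists_proj_ne (A : DiffOperator X k V E) (hc : A.IsCanceling) {e : E}
    (he : e ≠ 0) : ∃ ξ : X, ‖ξ‖ = 2 ∧ proj A ξ e ≠ 0 := by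
  have h : e ∉ (⋂ (ξ : X) (_ : ξ ≠ 0), Set.range (A.symbol ξ)) := by
    rw [hc]; simpa using he
  simp only [Set.mem_iInter, not_forall] at h
  obtain ⟨ξ, hξ, hr⟩ := h
  have hn : 0 < ‖ξ‖ := norm_pos_iff.2 hξ
  refine ⟨(2 / ‖ξ‖) • ξ, ?_, ?_⟩
  · rw [norm_smul, Real.norm_of_nonneg (by positivity)]
    field_simp
  · intro h
    apply hr
    have h2 : e - A.symbol ((2 / ‖ξ‖) • ξ) (pinv A ((2 / ‖ξ‖) • ξ) e) = 0 := h
    rw [symbol_smul] at h2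
    refine ⟨(2 / ‖ξ‖) ^ k • pinv A ((2 / ‖ξ‖) • ξ) e, ?_⟩
    rw [map_smul]
    exact (sub_eq_zero.1 h2).symm

lemma proj_int_inj (A : DiffOperator X k V E) (hA : A.IsElliptic) (hc : A.IsCanceling) :
    Function.Injective (∫ ξ, rho ξ • proj A ξ : E →L[ℝ] E) := by
  rw [injective_iff_map_eq_zero]
  intro e he
  by_contra hne
  obtain ⟨ξ0, h2, hp⟩ := exists_proj_ne A hc hne
  have hξ0 : ξ0 ≠ 0 := by rw [← norm_pos_iff, h2]; norm_num
  have hcont : Continuous (fun ξ => ⟪(rho ξ • proj A ξ) e, e⟫) :=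
    ((rhoproj_contDiff A hA).continuous.clm_apply continuous_const).inner continuous_const
  have hrw : ∀ ξ, ⟪(rho ξ • proj A ξ) e, e⟫ = rho ξ * ‖proj A ξ e‖ ^ 2 := by
    intro ξ
    by_cases h0 : ξ = 0
    · subst h0; simp [rho_eq_zero_small (X := X) (ξ := 0) (by simp)]
    · rw [ContinuousLinearMap.smul_apply, inner_smul_left, inner_proj A hA h0]; simp
  have hpos : 0 < ∫ ξ, ⟪(rho ξ • proj A ξ) e, e⟫ := by
    refine hcont.integral_pos_of_hasCompactSupport_nonneg_nonzero (x := ξ0) ?_ ?_ ?_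
    · refine (rho_smul_supp (proj A)).mono fun y hy => ?_
      contrapose! hy
      simp only [Function.notMem_support] at hy ⊢
      rw [hy]; simp
    · intro ξ
      simp only [hrw, Pi.zero_apply]
      exact mul_nonneg (rho_nonneg ξ) (by positivity)
    · rw [hrw, rho_eq_one h2]
      simpa using hp
  have heq : ∫ ξ, ⟪(rho ξ • proj A ξ) e, e⟫ = ⟪(∫ ξ, rho ξ • proj A ξ) e, e⟫ := by
    have h3 := ContinuousLinearMap.integral_comp_comm
      ((innerSL ℝ e).comp (ContinuousLinearMap.apply ℝ E e)) (rhoproj_integrable A hA)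
    simp only [ContinuousLinearMap.comp_apply, innerSL_apply_apply,
      ContinuousLinearMap.apply_apply] at h3
    rw [real_inner_comm, ← h3]
    simp_rw [real_inner_comm e]
  rw [heq, he] at hpos
  simp at hpos

lemma corrector (A : DiffOperator X k V E) (hA : A.IsElliptic) (hc : A.IsCanceling)
    (η : E →L[ℝ] ℂ) : ∃ Ψ : X → (E →L[ℝ] ℂ), ContDiff ℝ (⊤ : ℕ∞) Ψ ∧ Ψ 0 = η ∧
      (∃ C : ℝ, 0 < C ∧ (∀ x, ‖Ψ x‖ * (1 + ‖x‖) ^ 1 ≤ C) ∧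
        (∀ x, ‖fderiv ℝ Ψ x‖ * (1 + ‖x‖) ^ 1 ≤ C)) ∧
      ∀ u : X → V, IsTestFun u → ∀ r : ℝ, 0 < r →
        ∫ y, Ψ (-(r⁻¹ • y)) (A.app u y) = 0 := by
  set S : E →L[ℝ] E := ∫ ξ, rho ξ • proj A ξ with hS
  have hinj : Function.Injective (S : E →ₗ[ℝ] E) := proj_int_inj A hA hc
  set Si : E →L[ℝ] E :=
    LinearMap.toContinuousLinearMap ((LinearEquiv.ofInjectiveEndo _ hinj).symm : E →ₗ[ℝ] E) with hSi
  have hSiS : ∀ e, Si (S e) = e := by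
    intro e
    exact (LinearEquiv.ofInjectiveEndo _ hinj).symm_apply_apply e
  set L : (E →L[ℝ] E) →L[ℝ] (E →L[ℝ] ℂ) := ContinuousLinearMap.compL ℝ E E ℂ (η.comp Si) with hL
  have hLa : ∀ T e, L T e = η (Si (T e)) := fun T e => rfl
  set m : X → (E →L[ℝ] ℂ) := fun ξ => L (rho ξ • proj A ξ) with hm
  have hmc : ContDiff ℝ (⊤ : ℕ∞) m := L.contDiff.comp (rhoproj_contDiff A hA)
  have hms : HasCompactSupport m := (rho_smul_supp (proj A)).comp_left (map_zero L)
  have hmi : Integrable m := hmc.continuous.integrable_of_hasCompactSupport hms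
  refine ⟨𝓕⁻ m, (kernel_props' hmc hms 1).1, ?_, (kernel_props' hmc hms 1).2, ?_⟩
  · rw [Real.fourierInv_eq]
    simp only [inner_zero_right, AddChar.map_zero_eq_one, one_smul]
    rw [hm, L.integral_comp_comm (rhoproj_integrable A hA), ← hS]
    ext e
    rw [hLa, hSiS]
  · intro u hu r hr
    have hr' : 0 < r⁻¹ := inv_pos.2 hr
    have hc' : Continuous (fun ξ => m ((r⁻¹)⁻¹ • ξ)) :=
      hmc.continuous.comp (continuous_const_smul _)
    have hi' : Integrable (fun ξ => m ((r⁻¹)⁻¹ • ξ)) := hmi.comp_smul (inv_ne_zero hr'.ne')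
    have h1 := fubini_pairing hc' hi' (app_cont A hu) (app_integrable A hu) 0
    have h2 : ∀ ξ : X, ∀ v : V, m ((r⁻¹)⁻¹ • ξ) (A.symbol ξ v) = 0 := by
      intro ξ v
      by_cases h0 : ξ = 0
      · subst h0
        simp [hm, rho_eq_zero_small (X := X) (ξ := 0) (by simp)]
      set ζ := (r⁻¹)⁻¹ • ξ with hζ
      have hξ : ξ = r⁻¹ • ζ := by rw [hζ, smul_smul, mul_inv_cancel₀ hr'.ne', one_smul]
      have hζ0 : ζ ≠ 0 := by
        intro h; rw [h, smul_zero] at hξ; exact h0 hξ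
      have h4 : proj A ζ (A.symbol ζ v) = 0 := by
        have := congrArg (fun F => F v) (proj_comp A hA hζ0)
        simpa using this
      rw [hξ, symbol_smul]
      simp only [hm, hLa, ContinuousLinearMap.smul_apply, map_smul, h4, map_zero, smul_zero]
    have h3 : ∀ ξ, 𝓕 (fun y => m ((r⁻¹)⁻¹ • ξ) (A.app u y)) ξ = 0 := by
      intro ξ
      rw [fourier_app A hu]
      simp_rw [h2, Real.fourier_eq]
      simp
    simp_rw [h3, fourierInv_scale m hr'] at h1
    simp only [zero_sub, smul_zero, integral_zero, ContinuousLinearMap.smul_apply, smul_neg,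
      smul_eq_mul, integral_const_mul, mul_eq_zero] at h1
    rcases h1 with h1 | h1
    · exfalso
      have : (0 : ℝ) < (r⁻¹) ^ Module.finrank ℝ X := by positivity
      exact this.ne' (by exact_mod_cast h1)
    · exact h1

end Canc
end HardyCanc

namespace HardyCanc
open FourierTransform Filter

section Suff
variable {X : Type*} [NormedAddCommGroup X] [InnerProductSpace ℝ X] [FiniteDimensional ℝ X]
  [MeasurableSpace X] [BorelSpace X]
  {k : ℕ} {V E : Type*} [NormedAddCommGroup V] [InnerProductSpace ℝ V] [FiniteDimensional ℝ V]
  [NormedAddCommGroup E] [InnerProductSpace ℝ E] [FiniteDimensional ℝ E]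

/-- the majorant of the modified kernel -/
def kap (q : ℕ) (x y : X) : ℝ :=
  open Classical in
  if ‖y‖ ≤ ‖x‖ / 2 then ‖y‖ / ‖x‖ ^ (q + 2) else 1 / ‖x - y‖ ^ (q + 1) + 1 / (‖x‖ ^ q * ‖y‖)

lemma kap_nonneg (q : ℕ) (x y : X) : 0 ≤ kap q x y := by
  unfold kap; split_ifs <;> positivity

/-- dual basis, complex valued -/
def etab (i : Fin (Module.finrank ℝ E)) : E →L[ℝ] ℂ :=
  Complex.ofRealCLM.comp (innerSL ℝ (stdOrthonormalBasis ℝ E i))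

lemma etab_expand (T : E →L[ℝ] ℂ) :
    T = ∑ i, T (stdOrthonormalBasis ℝ E i) • etab (E := E) i := by
  ext e
  conv_lhs => rw [← (stdOrthonormalBasis ℝ E).sum_repr' e]
  simp only [map_sum, map_smul, ContinuousLinearMap.sum_apply, ContinuousLinearMap.smul_apply, etab,
    ContinuousLinearMap.comp_apply, innerSL_apply_apply, Complex.ofRealCLM_apply, smul_eq_mul,
    Complex.real_smul]
  exact Finset.sum_congr rfl fun i _ => mul_comm _ _

/-- the modified kernel -/
def modK (H : X → (E →L[ℝ] ℂ)) (Ψ : Fin (Module.finrank ℝ E) → X → (E →L[ℝ] ℂ)) (x y : X) :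
    E →L[ℝ] ℂ :=
  H (x - y) - ∑ i, H x (stdOrthonormalBasis ℝ E i) • Ψ i (-(‖x‖⁻¹ • y))

lemma modK_bound {q : ℕ} {H : X → (E →L[ℝ] ℂ)} {Ψ : Fin (Module.finrank ℝ E) → X → (E →L[ℝ] ℂ)}
    {B : ℝ} (hB : 0 ≤ B) (hH : ∀ x, ‖H x‖ * ‖x‖ ^ (q + 1) ≤ B)
    (hH' : ∀ x y, ‖y‖ ≤ ‖x‖ / 2 → ‖H (x - y) - H x‖ * (‖x‖ / 2) ^ (q + 2) ≤ B * ‖y‖)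
    {C : Fin (Module.finrank ℝ E) → ℝ} (hC : ∀ i, 0 < C i) (hΨ0 : ∀ i, Ψ i 0 = etab i)
    (hΨd : ∀ i, Differentiable ℝ (Ψ i))
    (hΨ : ∀ i x, ‖Ψ i x‖ * (1 + ‖x‖) ^ 1 ≤ C i)
    (hΨ' : ∀ i x, ‖fderiv ℝ (Ψ i) x‖ * (1 + ‖x‖) ^ 1 ≤ C i)
    (x y : X) (hx : x ≠ 0) (hxy : x ≠ y) :
    ‖modK H Ψ x y‖ ≤ (B * 2 ^ (q + 2) + ∑ i, B * C i) * kap q x y := by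
  have hx0 : 0 < ‖x‖ := norm_pos_iff.2 hx
  have hxy0 : 0 < ‖x - y‖ := norm_pos_iff.2 (sub_ne_zero.2 hxy)
  have hHx : ‖H x‖ ≤ B / ‖x‖ ^ (q + 1) := by
    rw [le_div_iff₀ (by positivity)]; exact hH x
  have hb : ∀ i, ‖H x (stdOrthonormalBasis ℝ E i)‖ ≤ B / ‖x‖ ^ (q + 1) := by
    intro i
    refine le_trans ((H x).le_opNorm _) ?_
    rw [(stdOrthonormalBasis ℝ E).norm_eq_one, mul_one]; exact hHx
  have hz : ‖-(‖x‖⁻¹ • y)‖ = ‖y‖ / ‖x‖ := by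
    rw [norm_neg, norm_smul, norm_inv, norm_norm]; field_simp
  unfold kap
  split_ifs with hc
  · have h1 : modK H Ψ x y = (H (x - y) - H x)
        + ∑ i, H x (stdOrthonormalBasis ℝ E i) • (Ψ i 0 - Ψ i (-(‖x‖⁻¹ • y))) := by
      unfold modK
      simp_rw [smul_sub, hΨ0, Finset.sum_sub_distrib]
      rw [← etab_expand (H x)]
      abel
    have h2 : ‖H (x - y) - H x‖ ≤ B * 2 ^ (q + 2) * (‖y‖ / ‖x‖ ^ (q + 2)) := by
      have := hH' x y hc
      rw [div_pow, mul_div_assoc', div_le_iff₀ (by positivity)] at this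
      rw [mul_div_assoc', le_div_iff₀ (by positivity)]
      linarith
    have h3 : ∀ i, ‖H x (stdOrthonormalBasis ℝ E i) • (Ψ i 0 - Ψ i (-(‖x‖⁻¹ • y)))‖
        ≤ B * C i * (‖y‖ / ‖x‖ ^ (q + 2)) := by
      intro i
      have hl : ‖Ψ i 0 - Ψ i (-(‖x‖⁻¹ • y))‖ ≤ C i * ‖0 - (-(‖x‖⁻¹ • y))‖ := by
        refine Convex.norm_image_sub_le_of_norm_fderiv_le (s := Set.univ) (𝕜 := ℝ)
          (fun z _ => hΨd i z) (fun z _ => ?_) convex_univ (Set.mem_univ _) (Set.mem_univ _)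
        refine le_trans ?_ (hΨ' i z)
        rw [pow_one]
        exact le_mul_of_one_le_right (norm_nonneg _) (by linarith [norm_nonneg z])
      rw [zero_sub, norm_neg, hz] at hl
      rw [norm_smul]
      calc _ ≤ B / ‖x‖ ^ (q + 1) * (C i * (‖y‖ / ‖x‖)) :=
            mul_le_mul (hb i) hl (norm_nonneg _) (by positivity)
        _ = _ := by field_simp; ring
    rw [h1]
    refine (norm_add_le _ _).trans ?_
    rw [add_mul, Finset.sum_mul]
    exact add_le_add h2 ((norm_sum_le _ _).trans (Finset.sum_le_sum fun i _ => h3 i))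
  · push Not at hc
    have hy0 : 0 < ‖y‖ := by linarith
    have hsum : 0 ≤ ∑ i, B * C i := Finset.sum_nonneg fun i _ => mul_nonneg hB (hC i).le
    have h2 : ‖H (x - y)‖ ≤ B * (1 / ‖x - y‖ ^ (q + 1)) := by
      rw [mul_one_div, le_div_iff₀ (by positivity)]; exact hH _
    have h3 : ∀ i, ‖H x (stdOrthonormalBasis ℝ E i) • Ψ i (-(‖x‖⁻¹ • y))‖
        ≤ B * C i * (1 / (‖x‖ ^ q * ‖y‖)) := by
      intro i
      have hl : ‖Ψ i (-(‖x‖⁻¹ • y))‖ ≤ C i / (‖y‖ / ‖x‖) := by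
        rw [le_div_iff₀ (by positivity)]
        refine le_trans ?_ (hΨ i (-(‖x‖⁻¹ • y)))
        rw [hz, pow_one]
        gcongr
        linarith
      rw [norm_smul]
      calc _ ≤ B / ‖x‖ ^ (q + 1) * (C i / (‖y‖ / ‖x‖)) :=
            mul_le_mul (hb i) hl (norm_nonneg _) (by positivity)
        _ = _ := by field_simp; ring
    unfold modK
    refine (norm_sub_le _ _).trans ?_
    have h4 : ‖∑ i, H x (stdOrthonormalBasis ℝ E i) • Ψ i (-(‖x‖⁻¹ • y))‖
        ≤ (∑ i, B * C i) * (1 / (‖x‖ ^ q * ‖y‖)) := by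
      rw [Finset.sum_mul]
      exact ((norm_sum_le _ _).trans (Finset.sum_le_sum fun i _ => h3 i))
    have h5 : B ≤ B * 2 ^ (q + 2) + ∑ i, B * C i := by
      have : B * 1 ≤ B * 2 ^ (q + 2) := by
        gcongr; exact one_le_pow₀ (by norm_num)
      linarith
    have h6 : (∑ i, B * C i) ≤ B * 2 ^ (q + 2) + ∑ i, B * C i := by
      have : 0 ≤ B * 2 ^ (q + 2) := by positivity
      linarith
    rw [mul_add]
    refine add_le_add (h2.trans ?_) (h4.trans ?_) <;> gcongr

lemma pointwise (hd : 0 < Module.finrank ℝ X)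
    (A : DiffOperator X k V E) (hA : A.IsElliptic) (hcan : A.IsCanceling)
    {j l q : ℕ} (hjl : j + l = k)
    (hs : (q + 1) + l = Module.finrank ℝ X)
    (w : Fin j → X) (α : V →L[ℝ] ℂ) :
    ∃ C : ℝ, 0 < C ∧ ∀ u : X → V, IsTestFun u → ∀ x : X, x ≠ 0 →
      ‖α (iteratedFDeriv ℝ j u x w)‖ₑ
        ≤ ∫⁻ y, ENNReal.ofReal (C * kap q x y) * ‖A.app u y‖ₑ := by
  have : Nontrivial X := Module.nontrivial_of_finrank_pos hd
  choose Ψ hΨs hΨ0 hΨC hΨan using fun i => corrector A hA hcan (etab (E := E) i)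
  choose C hC hCΨ hCΨ' using hΨC
  obtain ⟨hks, B, hB, hkB, hkB'⟩ := kernel_props' (mk_contDiff A hA l w α) (mk_supp A l w α)
    (q + 1 + 2)
  set h := 𝓕⁻ (mk A l w α) with hh
  have hkB1 : ∀ x, ‖h x‖ * (1 + ‖x‖) ^ (q + 1 + 1) ≤ B := by
    intro x
    refine le_trans ?_ (hkB x)
    gcongr
    · linarith [norm_nonneg x]
    · norm_num
  have hsum : 0 ≤ ∑ i, 2 * B * C i := Finset.sum_nonneg fun i _ => mul_nonneg (by positivity) (hC i).le
  refine ⟨2 * B * 2 ^ (q + 2) + ∑ i, 2 * B * C i, by positivity, ?_⟩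
  intro u hu x hx
  have hlim := repro hd A hA hjl hs w α hu x
  rw [← hh] at hlim
  refine le_of_tendsto (hlim.enorm) (Eventually.of_forall fun N => ?_)
  set H := dySum h (q + 1) (((2 : ℝ) ^ N)⁻¹) (2 * N) with hH
  have hHc : Continuous H := by
    have hc := hks.continuous
    rw [hH]
    unfold dySum
    refine continuous_finset_sum _ fun i _ => ?_
    exact (hc.comp (continuous_const_smul ((2 : ℝ) ^ i * ((2 : ℝ) ^ N)⁻¹))).const_smul
      (((2 : ℝ) ^ i * ((2 : ℝ) ^ N)⁻¹) ^ (q + 1))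
  have hIntg : ∀ (F : X → (E →L[ℝ] ℂ)), Continuous F → Integrable (fun y => F y (A.app u y)) := by
    intro F hF
    refine Continuous.integrable_of_hasCompactSupport (hF.clm_apply (app_cont A hu)) ?_
    refine (app_supp A hu).mono fun y hy => ?_
    contrapose! hy
    simp only [Function.notMem_support] at hy ⊢
    rw [hy, map_zero]
  have hΨc : ∀ i, Continuous (fun y => Ψ i (-(‖x‖⁻¹ • y))) := fun i =>
    (hΨs i).continuous.comp (by fun_prop)
  have heq : ∫ y, H (x - y) (A.app u y) = ∫ y, modK H Ψ x y (A.app u y) := by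
    simp only [modK, ContinuousLinearMap.sub_apply, ContinuousLinearMap.sum_apply,
      ContinuousLinearMap.smul_apply]
    have hHx : Integrable (fun y => H (x - y) (A.app u y)) :=
      hIntg (fun y => H (x - y)) (hHc.comp (by fun_prop))
    rw [integral_sub hHx, integral_finset_sum]
    · simp_rw [integral_smul, fun i => hΨan i u hu ‖x‖ (norm_pos_iff.2 hx)]
      simp
    · intro i _
      exact (hIntg _ (hΨc i)).smul (H x (stdOrthonormalBasis ℝ E i))
    · exact integrable_finset_sum _ fun i _ =>
        (hIntg _ (hΨc i)).smul (H x (stdOrthonormalBasis ℝ E i))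
  rw [heq]
  refine (enorm_integral_le_lintegral_enorm _).trans ?_
  refine lintegral_mono_ae ?_
  have hae : ∀ᵐ y : X, y ≠ x := by simp [ae_iff, measure_singleton]
  filter_upwards [hae] with y hy
  have hb := modK_bound (q := q) (H := H) (Ψ := Ψ) (B := 2 * B) (by positivity)
    (fun x => dySum_bound (by omega) hB.le hkB1 (by positivity) _ x)
    (fun x y hxy => dySum_diff hB.le (hks.differentiable (by simp)) hkB' (by positivity) _ x y hxy)
    hC hΨ0 (fun i => (hΨs i).differentiable (by simp)) hCΨ hCΨ' x y hx hy.symm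
  calc ‖modK H Ψ x y (A.app u y)‖ₑ ≤ ‖modK H Ψ x y‖ₑ * ‖A.app u y‖ₑ :=
        ContinuousLinearMap.le_opENorm _ _
    _ ≤ _ := by
      gcongr
      rw [← ofReal_norm_eq_enorm]
      exact ENNReal.ofReal_le_ofReal hb

end Suff
end HardyCanc

namespace HardyCanc
open FourierTransform Filter

section Suff2
variable {X : Type*} [NormedAddCommGroup X] [InnerProductSpace ℝ X] [FiniteDimensional ℝ X]
  [MeasurableSpace X] [BorelSpace X]
  {k : ℕ} {V E : Type*} [NormedAddCommGroup V] [InnerProductSpace ℝ V] [FiniteDimensional ℝ V]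
  [NormedAddCommGroup E] [InnerProductSpace ℝ E] [FiniteDimensional ℝ E]

/-- local power singularity -/
def locP (p : ℕ) (x : X) : ℝ :=
  Set.indicator (Metric.ball (0 : X) 3) (fun x => (‖x‖ ^ p)⁻¹) x

/-- integrable tail -/
def tailP (p : ℕ) (x : X) : ℝ := ((1 + ‖x‖) ^ (p + 1))⁻¹

lemma locP_nonneg (p : ℕ) (x : X) : 0 ≤ locP p x := by
  unfold locP; exact Set.indicator_nonneg (fun _ _ => by positivity) _

lemma locP_eq (p : ℕ) {x : X} (hx : ‖x‖ < 3) : locP p x = (‖x‖ ^ p)⁻¹ := by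
  unfold locP; exact Set.indicator_of_mem (by simpa using hx) _

lemma tailP_nonneg (p : ℕ) (x : X) : 0 ≤ tailP p x := by
  unfold tailP; positivity

lemma locP_meas (p : ℕ) : Measurable (locP p : X → ℝ) := by
  unfold locP
  exact ((measurable_norm.pow_const p).inv).indicator Metric.isOpen_ball.measurableSet

lemma locP_int {p : ℕ} (hp : p < Module.finrank ℝ X) : Integrable (locP p : X → ℝ) := by
  have : IntegrableOn (fun x : X => (‖x‖ ^ p)⁻¹) (Metric.ball 0 3) := by
    refine integrableOn_ball_of_norm_le_rpow (C := 1) (α := p) (by omega) (by exact_mod_cast hp) ?_ ?_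
    · refine Eventually.of_forall fun x => ?_
      rw [Real.rpow_neg (norm_nonneg x), Real.rpow_natCast, one_mul,
        Real.norm_of_nonneg (by positivity)]
    · exact ((measurable_norm.pow_const p).inv).aestronglyMeasurable
  exact this.integrable_indicator Metric.isOpen_ball.measurableSet

lemma tailP_int : Integrable (tailP (Module.finrank ℝ X) : X → ℝ) := by
  have := integrable_one_add_norm (E := X) (μ := volume) (r := (Module.finrank ℝ X : ℝ) + 1)
    (by linarith)
  refine this.congr (Eventually.of_forall fun x => ?_)
  simp only [tailP]
  rw [Real.rpow_neg (by positivity)]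
  norm_cast

lemma kap_dom {q l : ℕ} (x y : X) (hx : x ≠ 0) (hxy : x ≠ y) (hy : ‖y‖ = 1) :
    kap q x y * (‖x‖ ^ l)⁻¹ ≤ 2 ^ (q + l + 2) * (tailP (q + 1 + l) x + locP (q + l) x + locP l x
      + locP (q + 1) (x - y)) := by
  have hx0 : 0 < ‖x‖ := norm_pos_iff.2 hx
  have hxy0 : 0 < ‖x - y‖ := norm_pos_iff.2 (sub_ne_zero.2 hxy)
  have n1 := locP_nonneg (q + l) x
  have n2 := locP_nonneg l x
  have n3 := locP_nonneg (q + 1) (x - y)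
  have n4 := tailP_nonneg (q + 1 + l) x
  unfold kap
  split_ifs with hc
  · have h1 : ‖y‖ / ‖x‖ ^ (q + 2) * (‖x‖ ^ l)⁻¹ ≤ 2 ^ (q + l + 2) * tailP (q + 1 + l) x := by
      have e : ‖y‖ / ‖x‖ ^ (q + 2) * (‖x‖ ^ l)⁻¹ = (‖x‖ ^ (q + l + 2))⁻¹ := by
        rw [hy, one_div, ← mul_inv, ← pow_add]; congr 2; ring
      rw [e, tailP, ← div_eq_mul_inv, inv_eq_one_div, div_le_div_iff₀ (by positivity) (by positivity),
        one_mul, ← mul_pow, show q + 1 + l + 1 = q + l + 2 by ring]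
      gcongr
      rw [hy] at hc
      linarith
    refine h1.trans ?_
    gcongr
    linarith
  · push Not at hc
    rw [hy] at hc
    have hx3 : ‖x‖ < 3 := by linarith
    have hxy3 : ‖x - y‖ < 3 := by
      have := norm_sub_le x y
      linarith
    rw [locP_eq _ hx3, locP_eq _ hxy3, locP_eq _ hx3] at *
    rw [hy, mul_one, add_mul, one_div, one_div, ← mul_inv, ← mul_inv, ← pow_add]
    have hmain : (‖x - y‖ ^ (q + 1) * ‖x‖ ^ l)⁻¹ ≤ 2 ^ (q + l + 2) * ((‖x‖ ^ l)⁻¹ + (‖x - y‖ ^ (q + 1))⁻¹) := by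
      have h12 : 1 / 2 ≤ ‖x‖ ∨ 1 / 2 ≤ ‖x - y‖ := by
        by_contra hcon
        push Not at hcon
        have := norm_sub_norm_le y (y - x)
        rw [show y - (y - x) = x by abel, norm_sub_rev y x, hy] at this
        linarith [hcon.1, hcon.2]
      have hpow : ∀ (a : ℝ) (p : ℕ), 0 < a → 1 / 2 ≤ a → p ≤ q + l + 2 →
          (a ^ p)⁻¹ ≤ 2 ^ (q + l + 2) := by
        intro a p ha ha2 hp
        have : a⁻¹ ≤ 2 := by
          rw [inv_le_comm₀ ha (by norm_num)]; linarith
        rw [← inv_pow]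
        calc (a⁻¹) ^ p ≤ 2 ^ p := by gcongr
          _ ≤ 2 ^ (q + l + 2) := pow_le_pow_right₀ (by norm_num) hp
      rw [mul_inv, mul_add]
      rcases h12 with h | h
      · have := hpow _ l hx0 h (by omega)
        have h7 : (‖x - y‖ ^ (q + 1))⁻¹ * (‖x‖ ^ l)⁻¹ ≤ (‖x - y‖ ^ (q + 1))⁻¹ * 2 ^ (q + l + 2) := by
          gcongr
        have : 0 ≤ (2 : ℝ) ^ (q + l + 2) * (‖x‖ ^ l)⁻¹ := by positivity
        linarith
      · have := hpow _ (q + 1) hxy0 h (by omega)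
        have h7 : (‖x - y‖ ^ (q + 1))⁻¹ * (‖x‖ ^ l)⁻¹ ≤ 2 ^ (q + l + 2) * (‖x‖ ^ l)⁻¹ := by
          gcongr
        have : 0 ≤ (2 : ℝ) ^ (q + l + 2) * (‖x - y‖ ^ (q + 1))⁻¹ := by positivity
        linarith
    have h8 : (‖x‖ ^ (q + l))⁻¹ ≤ 2 ^ (q + l + 2) * (‖x‖ ^ (q + l))⁻¹ :=
      le_mul_of_one_le_left (by positivity) (one_le_pow₀ (by norm_num))
    have h9 : 0 ≤ 2 ^ (q + l + 2) * tailP (q + 1 + l) x := by positivity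
    linarith

lemma kap_meas (q : ℕ) : Measurable (fun p : X × X => kap q p.1 p.2) := by
  unfold kap
  refine Measurable.ite ?_ ?_ ?_
  · exact measurableSet_le (by fun_prop) (by fun_prop)
  · fun_prop
  · fun_prop

lemma kap_smul (q : ℕ) (x y : X) {r : ℝ} (hr : 0 < r) :
    kap q (r • x) (r • y) = (r ^ (q + 1))⁻¹ * kap q x y := by
  unfold kap
  rw [← smul_sub]
  simp only [norm_smul, Real.norm_of_nonneg hr.le]
  have : r * ‖y‖ ≤ r * ‖x‖ / 2 ↔ ‖y‖ ≤ ‖x‖ / 2 := by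
    rw [mul_div_assoc]; exact mul_le_mul_iff_right₀ hr
  simp only [this]
  split_ifs
  · rw [mul_pow]
    by_cases hx : ‖x‖ = 0
    · simp [hx]
    · field_simp; ring
  · simp only [mul_pow, one_div, mul_inv]
    rw [mul_add, pow_succ r q, mul_inv]
    ring

lemma kap_int (hd : 0 < Module.finrank ℝ X) {q l : ℕ} (hl : 1 ≤ l)
    (hs : (q + 1) + l = Module.finrank ℝ X) :
    ∃ C : ℝ, 0 < C ∧ ∀ y : X, y ≠ 0 →
      ∫⁻ x, ENNReal.ofReal (kap q x y * (‖x‖ ^ l)⁻¹) ≤ ENNReal.ofReal C := by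
  have : Nontrivial X := Module.nontrivial_of_finrank_pos hd
  set F : X → ℝ := fun x => tailP (q + 1 + l) x + locP (q + l) x + locP l x with hF
  have hFi : Integrable F := by
    refine Integrable.add (Integrable.add ?_ (locP_int (by omega))) (locP_int (by omega))
    rw [hs]; exact tailP_int
  have hLi : Integrable (locP (q + 1) : X → ℝ) := locP_int (by omega)
  have hF0 : ∀ x, 0 ≤ F x := fun x => by
    have := locP_nonneg (q + l) x
    have := locP_nonneg l x
    have := tailP_nonneg (q + 1 + l) x
    simp only [hF]; positivity
  set D := 2 ^ (q + l + 2) * ((∫ x, F x) + ∫ x, locP (q + 1) (x : X)) with hD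
  have hD0 : 0 ≤ D := by
    have := integral_nonneg (μ := volume) (f := F) hF0
    have := integral_nonneg (μ := volume) (f := (locP (q + 1) : X → ℝ)) (locP_nonneg (q + 1))
    positivity
  refine ⟨D + 1, by linarith, ?_⟩
  have unit : ∀ y : X, ‖y‖ = 1 →
      ∫⁻ x, ENNReal.ofReal (kap q x y * (‖x‖ ^ l)⁻¹) ≤ ENNReal.ofReal D := by
    intro y hy
    have hi2 : Integrable (fun x => 2 ^ (q + l + 2) * (F x + locP (q + 1) (x - y))) :=
      (hFi.add (hLi.comp_sub_right y)).const_mul _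
    have hDe : D = ∫ x, 2 ^ (q + l + 2) * (F x + locP (q + 1) (x - y)) := by
      rw [integral_const_mul, integral_add hFi (hLi.comp_sub_right y),
        integral_sub_right_eq_self (μ := volume) (fun x => locP (q + 1) x) y]
    rw [hDe, ofReal_integral_eq_lintegral_ofReal hi2]
    · refine lintegral_mono_ae ?_
      have h0 : ∀ᵐ x : X, x ≠ 0 := by simp [ae_iff, measure_singleton]
      have h1 : ∀ᵐ x : X, x ≠ y := by simp [ae_iff, measure_singleton]
      filter_upwards [h0, h1] with x hx hxy
      exact ENNReal.ofReal_le_ofReal (kap_dom x y hx hxy hy)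
    · refine Eventually.of_forall fun x => ?_
      exact mul_nonneg (by positivity) (add_nonneg (hF0 x) (locP_nonneg _ _))
  intro y hy
  set r := ‖y‖ with hr
  have hr0 : 0 < r := norm_pos_iff.2 hy
  have hu := unit (r⁻¹ • y) (by
    rw [norm_smul, norm_inv, Real.norm_of_nonneg hr0.le, ← hr, inv_mul_cancel₀ hr0.ne'])
  refine le_trans (le_of_eq ?_) (hu.trans (ENNReal.ofReal_le_ofReal (by linarith)))
  have hmeas : ∀ y : X, Measurable (fun x => ENNReal.ofReal (kap q x y * (‖x‖ ^ l)⁻¹)) := by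
    intro y
    refine ENNReal.measurable_ofReal.comp (Measurable.mul ?_ (by fun_prop))
    exact (kap_meas q).comp (measurable_id.prodMk measurable_const)
  have hmap := Measure.map_addHaar_smul (volume : Measure X) hr0.ne'
  have h1 : ∫⁻ x, ENNReal.ofReal (kap q x y * (‖x‖ ^ l)⁻¹) ∂(Measure.map (r • ·) (volume : Measure X))
      = ENNReal.ofReal ((r ^ Module.finrank ℝ X)⁻¹)
        * ∫⁻ x, ENNReal.ofReal (kap q x (r⁻¹ • y) * (‖x‖ ^ l)⁻¹) := by
    rw [lintegral_map (hmeas y) (measurable_const_smul r), ← lintegral_const_mul _ (hmeas _)]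
    congr 1
    ext x
    rw [← ENNReal.ofReal_mul (by positivity)]
    congr 1
    have hyy : y = r • (r⁻¹ • y) := by rw [smul_smul, mul_inv_cancel₀ hr0.ne', one_smul]
    conv_lhs => rw [hyy, kap_smul q _ _ hr0]
    rw [← hs, norm_smul, Real.norm_of_nonneg hr0.le, mul_pow, pow_add r (q + 1) l, mul_inv, mul_inv]
    ring
  rw [hmap, lintegral_smul_measure, smul_eq_mul, abs_of_nonneg (by positivity)] at h1
  refine (ENNReal.mul_right_inj ?_ ?_).1 h1
  · simp; positivity
  · exact ENNReal.ofReal_ne_top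

lemma comp_hardy (hd : 0 < Module.finrank ℝ X)
    (A : DiffOperator X k V E) (hA : A.IsElliptic) (hcan : A.IsCanceling)
    {j l q : ℕ} (hl : 1 ≤ l) (hjl : j + l = k)
    (hs : (q + 1) + l = Module.finrank ℝ X)
    (w : Fin j → X) (α : V →L[ℝ] ℂ) :
    ∃ C : ℝ, 0 < C ∧ ∀ u : X → V, IsTestFun u →
      ∫⁻ x, ‖α (iteratedFDeriv ℝ j u x w)‖ₑ * ENNReal.ofReal ((‖x‖ ^ l)⁻¹)
        ≤ ENNReal.ofReal C * ∫⁻ y, ‖A.app u y‖ₑ := by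
  have : Nontrivial X := Module.nontrivial_of_finrank_pos hd
  obtain ⟨C, hC, hp⟩ := pointwise hd A hA hcan hjl hs w α
  obtain ⟨D, hD, hk⟩ := kap_int hd hl hs
  refine ⟨C * D, by positivity, fun u hu => ?_⟩
  have h0 : ∀ᵐ x : X, x ≠ 0 := by simp [ae_iff, measure_singleton]
  have hmf : Measurable (fun y => ‖A.app u y‖ₑ) := (app_cont A hu).enorm.measurable
  calc ∫⁻ x, ‖α (iteratedFDeriv ℝ j u x w)‖ₑ * ENNReal.ofReal ((‖x‖ ^ l)⁻¹)
      ≤ ∫⁻ x, ∫⁻ y, ENNReal.ofReal (C * (kap q x y * (‖x‖ ^ l)⁻¹)) * ‖A.app u y‖ₑ := by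
        refine lintegral_mono_ae ?_
        filter_upwards [h0] with x hx
        refine (mul_le_mul_left (hp u hu x hx) _).trans ?_
        rw [← lintegral_mul_const']
        · refine lintegral_mono fun y => le_of_eq ?_
          rw [mul_right_comm, ← ENNReal.ofReal_mul (mul_nonneg hC.le (kap_nonneg _ _ _)), mul_assoc]
        · exact ENNReal.ofReal_ne_top
    _ = ∫⁻ y, ∫⁻ x, ENNReal.ofReal (C * (kap q x y * (‖x‖ ^ l)⁻¹)) * ‖A.app u y‖ₑ := by
        refine lintegral_lintegral_swap ?_
        refine Measurable.aemeasurable ?_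
        refine Measurable.mul ?_ (hmf.comp measurable_snd)
        refine ENNReal.measurable_ofReal.comp ?_
        exact ((kap_meas q).mul (by fun_prop)).const_mul C
    _ ≤ ∫⁻ y, ENNReal.ofReal (C * D) * ‖A.app u y‖ₑ := by
        refine lintegral_mono_ae ?_
        filter_upwards [h0] with y hy
        rw [lintegral_mul_const' _ _ enorm_ne_top]
        gcongr
        simp_rw [ENNReal.ofReal_mul hC.le]
        rw [lintegral_const_mul' _ _ ENNReal.ofReal_ne_top]
        gcongr
        exact hk y hy
    _ = _ := lintegral_const_mul' _ _ ENNReal.ofReal_ne_top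

lemma sufficiency (hd : 0 < Module.finrank ℝ X)
    (A : DiffOperator X k V E) (hA : A.IsElliptic) (hcan : A.IsCanceling)
    {j l q : ℕ} (hl : 1 ≤ l) (hjl : j + l = k)
    (hs : (q + 1) + l = Module.finrank ℝ X) :
    ∃ C : ℝ, 0 < C ∧ ∀ u : X → V, IsTestFun u →
      ∫⁻ x, ‖iteratedFDeriv ℝ j u x‖ₑ * ENNReal.ofReal ((‖x‖ ^ l)⁻¹)
        ≤ ENNReal.ofReal C * ∫⁻ y, ‖A.app u y‖ₑ := by
  set bv : (Fin j → Fin (Module.finrank ℝ X)) → Fin j → X :=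
    fun J i => stdOrthonormalBasis ℝ X (J i) with hbv
  choose C hC hCu using fun J : Fin j → Fin (Module.finrank ℝ X) =>
    fun a : Fin (Module.finrank ℝ V) =>
      comp_hardy hd A hA hcan hl hjl hs (bv J) (etab (E := V) a)
  set D : ℝ≥0∞ := ∑ J, ‖(tens (bv J) : V →L[ℝ] _)‖ₑ * ∑ a, ENNReal.ofReal (C J a) with hD
  have hDt : D ≠ ⊤ := by
    rw [hD]
    refine ENNReal.sum_ne_top.2 fun J _ => ENNReal.mul_ne_top enorm_ne_top ?_
    exact ENNReal.sum_ne_top.2 fun a _ => ENNReal.ofReal_ne_top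
  refine ⟨D.toReal + 1, by positivity, fun u hu => ?_⟩
  have hv : ∀ v : V, ‖v‖ₑ ≤ ∑ a, ‖etab (E := V) a v‖ₑ := by
    intro v
    conv_lhs => rw [← (stdOrthonormalBasis ℝ V).sum_repr' v]
    refine (enorm_sum_le _ _).trans (Finset.sum_le_sum fun a _ => ?_)
    rw [enorm_smul]
    have : ‖stdOrthonormalBasis ℝ V a‖ₑ = 1 := by
      rw [← ofReal_norm_eq_enorm, (stdOrthonormalBasis ℝ V).norm_eq_one]; simp
    rw [this, mul_one, etab]
    simp only [ContinuousLinearMap.comp_apply, innerSL_apply_apply, Complex.ofRealCLM_apply]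
    rw [← ofReal_norm_eq_enorm, ← ofReal_norm_eq_enorm, Complex.norm_real]
  have hT : ∀ T : ContinuousMultilinearMap ℝ (fun _ : Fin j => X) V, ‖T‖ₑ ≤
      ∑ J, ‖(tens (bv J) : V →L[ℝ] _)‖ₑ * ∑ a, ‖etab (E := V) a (T (bv J))‖ₑ := by
    intro T
    conv_lhs => rw [tens_expand T]
    refine (enorm_sum_le Finset.univ
      (fun J => (tens (bv J) : V →L[ℝ] _) (T (bv J)))).trans (Finset.sum_le_sum fun J _ => ?_)
    refine (ContinuousLinearMap.le_opENorm _ _).trans ?_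
    gcongr
    exact hv _
  have hmeas : ∀ J a, Measurable (fun x => ‖etab (E := V) a (iteratedFDeriv ℝ j u x (bv J))‖ₑ
      * ENNReal.ofReal ((‖x‖ ^ l)⁻¹)) := by
    intro J a
    have h1 : Measurable (fun x => ‖etab (E := V) a (iteratedFDeriv ℝ j u x (bv J))‖ₑ) :=
      ((deriv_isTest hu (etab a) (bv J)).1.continuous).enorm.measurable
    have h2 : Measurable (fun x : X => ENNReal.ofReal ((‖x‖ ^ l)⁻¹)) := by fun_prop
    exact h1.mul h2
  calc ∫⁻ x, ‖iteratedFDeriv ℝ j u x‖ₑ * ENNReal.ofReal ((‖x‖ ^ l)⁻¹)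
      ≤ ∫⁻ x, ∑ J, ‖(tens (bv J) : V →L[ℝ] _)‖ₑ * ∑ a,
        (‖etab (E := V) a (iteratedFDeriv ℝ j u x (bv J))‖ₑ * ENNReal.ofReal ((‖x‖ ^ l)⁻¹)) := by
        refine lintegral_mono fun x => ?_
        refine (mul_le_mul_left (hT _) _).trans (le_of_eq ?_)
        simp_rw [Finset.sum_mul, mul_assoc, Finset.sum_mul]
    _ = ∑ J, ‖(tens (bv J) : V →L[ℝ] _)‖ₑ * ∑ a, ∫⁻ x,
        (‖etab (E := V) a (iteratedFDeriv ℝ j u x (bv J))‖ₑ * ENNReal.ofReal ((‖x‖ ^ l)⁻¹)) := by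
        rw [lintegral_finset_sum]
        · refine Finset.sum_congr rfl fun J _ => ?_
          rw [lintegral_const_mul' _ _ enorm_ne_top, lintegral_finset_sum]
          exact fun a _ => hmeas J a
        · intro J _
          exact (Finset.measurable_fun_sum _ fun a _ => hmeas J a).const_mul _
    _ ≤ ∑ J, ‖(tens (bv J) : V →L[ℝ] _)‖ₑ * ∑ a,
        (ENNReal.ofReal (C J a) * ∫⁻ y, ‖A.app u y‖ₑ) := by
        gcongr with J _ a _
        exact hCu J a u hu
    _ = D * ∫⁻ y, ‖A.app u y‖ₑ := by
        rw [hD]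
        simp_rw [Finset.sum_mul, mul_assoc, Finset.sum_mul]
    _ ≤ _ := by
        gcongr
        rw [← ENNReal.ofReal_toReal hDt]
        apply ENNReal.ofReal_le_ofReal
        rw [ENNReal.toReal_ofReal ENNReal.toReal_nonneg]
        linarith

end Suff2
end HardyCanc

namespace HardyCanc
open FourierTransform Filter

section Nec
variable {X : Type*} [NormedAddCommGroup X] [InnerProductSpace ℝ X] [FiniteDimensional ℝ X]
  [MeasurableSpace X] [BorelSpace X]
  {k : ℕ} {V E : Type*} [NormedAddCommGroup V] [InnerProductSpace ℝ V] [FiniteDimensional ℝ V]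
  [NormedAddCommGroup E] [InnerProductSpace ℝ E] [FiniteDimensional ℝ E]

/-- truncation -/
def trunc (u : X → V) (N : ℕ) (x : X) : V := chi (((2 : ℝ) ^ N)⁻¹ • x) • u x

lemma trunc_test {u : X → V} (hu : ContDiff ℝ (⊤ : ℕ∞) u) (N : ℕ) : IsTestFun (trunc u N) := by
  have h2 : ((2 : ℝ) ^ N)⁻¹ ≠ 0 := by positivity
  refine ⟨(chi_contDiff.comp (contDiff_const_smul _)).smul hu, ?_⟩
  exact HasCompactSupport.smul_right (chi_supp.comp_smul h2)

lemma trunc_eventually (u : X → V) (x : X) (i : ℕ) :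
    ∀ᶠ N in atTop, iteratedFDeriv ℝ i (trunc u N) x = iteratedFDeriv ℝ i u x := by
  have : Tendsto (fun N : ℕ => (2 : ℝ) ^ N) atTop atTop :=
    tendsto_pow_atTop_atTop_of_one_lt (by norm_num)
  filter_upwards [this.eventually_gt_atTop ‖x‖] with N hN
  have hev : trunc u N =ᶠ[nhds x] u := by
    have : ∀ᶠ y in nhds x, ‖y‖ < 2 ^ N := continuous_norm.continuousAt.eventually_lt_const hN
    filter_upwards [this] with y hy
    rw [trunc, chi_eq_one, one_smul]
    rw [norm_smul, Real.norm_of_nonneg (by positivity), inv_mul_le_iff₀ (by positivity), mul_one]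
    exact hy.le
  exact (hev.iteratedFDeriv ℝ i).eq_of_nhds

lemma trunc_bound {u : X → V} (hu : ContDiff ℝ (⊤ : ℕ∞) u) (i : ℕ) :
    ∃ B : ℝ, 0 ≤ B ∧ ∀ N x, ‖iteratedFDeriv ℝ i (trunc u N) x‖ ≤
      B * ∑ p ∈ Finset.range (i + 1), ‖iteratedFDeriv ℝ p u x‖ := by
  have hb : ∀ p : ℕ, ∃ C, ∀ x : X, ‖iteratedFDeriv ℝ p (chi : X → ℝ) x‖ ≤ C := by
    intro p
    have ht : IsTestFun (chi : X → ℝ) := ⟨chi_contDiff, chi_supp⟩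
    have h1 := testFun_deriv_cont ht p
    have h2 := testFun_deriv_supp ht p
    exact h2.exists_bound_of_continuous h1
  choose C hC using hb
  refine ⟨∑ p ∈ Finset.range (i + 1), (i.choose p : ℝ) * |C p|, by positivity, fun N x => ?_⟩
  have hs : ContDiff ℝ (⊤ : ℕ∞) (fun x : X => chi (((2 : ℝ) ^ N)⁻¹ • x)) :=
    chi_contDiff.comp (contDiff_const_smul _)
  have h1 := norm_iteratedFDeriv_smul_le (𝕜 := ℝ) hs hu x (n := i) (mod_cast le_top)
  refine h1.trans ?_
  rw [Finset.sum_mul]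
  refine Finset.sum_le_sum fun p hp => ?_
  have h2 : ‖iteratedFDeriv ℝ p (fun x : X => chi (((2 : ℝ) ^ N)⁻¹ • x)) x‖ ≤ |C p| := by
    rw [iteratedFDeriv_comp_const_smul (𝕜 := ℝ) (i := p) (f := (chi : X → ℝ)) (((2 : ℝ) ^ N)⁻¹)
      (chi_contDiff.of_le (mod_cast le_top)), norm_smul]
    have : ‖(((2 : ℝ) ^ N)⁻¹) ^ p‖ ≤ 1 := by
      rw [Real.norm_of_nonneg (by positivity)]
      exact pow_le_one₀ (by positivity) (inv_le_one_of_one_le₀ (one_le_pow₀ (by norm_num)))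
    calc _ ≤ 1 * |C p| := by gcongr; exact (hC p _).trans (le_abs_self _)
      _ = _ := one_mul _
  have h3 : ‖iteratedFDeriv ℝ (i - p) u x‖ ≤ ∑ p ∈ Finset.range (i + 1), ‖iteratedFDeriv ℝ p u x‖ :=
    Finset.single_le_sum (f := fun p => ‖iteratedFDeriv ℝ p u x‖) (fun _ _ => norm_nonneg _)
      (Finset.mem_range.2 (by omega))
  gcongr

lemma hardy_ext (A : DiffOperator X k V E) {j l : ℕ} {C : ℝ}
    (H : ∀ u : X → V, IsTestFun u →
      ∫⁻ x, ‖iteratedFDeriv ℝ j u x‖ₑ * ENNReal.ofReal ((‖x‖ ^ l)⁻¹)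
        ≤ ENNReal.ofReal C * ∫⁻ y, ‖A.app u y‖ₑ)
    {u : X → V} (hu : ContDiff ℝ (⊤ : ℕ∞) u) (hi : ∀ i, Integrable (iteratedFDeriv ℝ i u)) :
      ∫⁻ x, ‖iteratedFDeriv ℝ j u x‖ₑ * ENNReal.ofReal ((‖x‖ ^ l)⁻¹)
        ≤ ENNReal.ofReal C * ∫⁻ y, ‖A.app u y‖ₑ := by
  have hw : Measurable (fun x : X => ENNReal.ofReal ((‖x‖ ^ l)⁻¹)) := by fun_prop
  obtain ⟨B, hB, hBb⟩ := trunc_bound hu k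
  have hR : Tendsto (fun N => ∫⁻ y, ‖A.app (trunc u N) y‖ₑ) atTop (nhds (∫⁻ y, ‖A.app u y‖ₑ)) := by
    refine tendsto_lintegral_of_dominated_convergence
      (fun x => ENNReal.ofReal (‖A‖ * (B * ∑ p ∈ Finset.range (k + 1), ‖iteratedFDeriv ℝ p u x‖)))
      (fun N => (app_cont A (trunc_test hu N)).enorm.measurable) ?_ ?_ ?_
    · intro N
      refine Eventually.of_forall fun x => ?_
      simp only
      rw [← ofReal_norm_eq_enorm]
      refine ENNReal.ofReal_le_ofReal ((A.le_opNorm _).trans ?_)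
      gcongr
      exact hBb N x
    · have : Integrable (fun x => ‖A‖ * (B * ∑ p ∈ Finset.range (k + 1), ‖iteratedFDeriv ℝ p u x‖)) :=
        ((integrable_finset_sum _ fun p _ => (hi p).norm).const_mul _).const_mul _
      exact this.lintegral_lt_top.ne
    · refine Eventually.of_forall fun x => ?_
      refine tendsto_const_nhds.congr' ?_
      filter_upwards [trunc_eventually u x k] with N hN
      simp only [DiffOperator.app, hN]
  calc _ = ∫⁻ x, liminf (fun N => ‖iteratedFDeriv ℝ j (trunc u N) x‖ₑ
            * ENNReal.ofReal ((‖x‖ ^ l)⁻¹)) atTop := by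
        refine lintegral_congr fun x => ?_
        refine (Tendsto.liminf_eq ?_).symm
        refine tendsto_const_nhds.congr' ?_
        filter_upwards [trunc_eventually u x j] with N hN
        rw [hN]
    _ ≤ liminf (fun N => ∫⁻ x, ‖iteratedFDeriv ℝ j (trunc u N) x‖ₑ
            * ENNReal.ofReal ((‖x‖ ^ l)⁻¹)) atTop := by
        refine lintegral_liminf_le fun N => ?_
        exact (testFun_deriv_cont (trunc_test hu N) j).enorm.measurable.mul hw
    _ ≤ liminf (fun N => ENNReal.ofReal C * ∫⁻ y, ‖A.app (trunc u N) y‖ₑ) atTop :=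
        liminf_le_liminf (Eventually.of_forall fun N => H _ (trunc_test hu N))
    _ = _ := (ENNReal.Tendsto.const_mul hR (Or.inr ENNReal.ofReal_ne_top)).liminf_eq

lemma fourierInv_schwartz {Z : Type*} [NormedAddCommGroup Z] [NormedSpace ℂ Z] {m : X → Z}
    (hm : ContDiff ℝ (⊤ : ℕ∞) m) (hs : HasCompactSupport m) :
    ∃ S : SchwartzMap X Z, (S : X → Z) = 𝓕⁻ m := by
  refine ⟨𝓕⁻ (hs.toSchwartzMap hm), ?_⟩
  rw [SchwartzMap.fourierInv_coe]; rfl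

lemma schwartz_deriv_int {Z : Type*} [NormedAddCommGroup Z] [NormedSpace ℝ Z]
    (S : SchwartzMap X Z) (i : ℕ) : Integrable (iteratedFDeriv ℝ i S) := by
  have := S.integrable_pow_mul_iteratedFDeriv (μ := volume) 0 i
  simp only [pow_zero, one_mul] at this
  refine (integrable_norm_iff ?_).1 this
  exact ((S.smooth ⊤).continuous_iteratedFDeriv (mod_cast le_top)).aestronglyMeasurable

lemma iter_fourierInv {Z : Type*} [NormedAddCommGroup Z] [NormedSpace ℂ Z] {m : X → Z}
    (hm : ContDiff ℝ (⊤ : ℕ∞) m) (hs : HasCompactSupport m) {j : ℕ} (w : Fin j → X) (x : X) :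
    iteratedFDeriv ℝ j (𝓕⁻ m) x w
      = 𝓕⁻ (fun ξ => ((2 * Real.pi * Complex.I) ^ j * ((∏ i, ⟪ξ, w i⟫ : ℝ) : ℂ)) • m ξ) x := by
  set m' : X → Z := fun ξ => m (-ξ) with hm'
  have hmc' : ContDiff ℝ (⊤ : ℕ∞) m' := hm.comp contDiff_neg
  have hms' : HasCompactSupport m' := hs.comp_homeomorph (Homeomorph.neg X)
  have hIntg : ∀ n : ℕ, (n : ℕ∞) ≤ ⊤ → Integrable (fun v => ‖v‖ ^ n * ‖m' v‖) := by
    intro n _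
    refine Continuous.integrable_of_hasCompactSupport
      ((continuous_norm.pow n).mul hmc'.continuous.norm) ?_
    exact hms'.norm.mul_left
  have hae : AEStronglyMeasurable m' (volume : Measure X) := hmc'.continuous.aestronglyMeasurable
  rw [Real.fourierInv_eq_fourier_comp_neg, Real.fourierInv_eq_fourier_comp_neg]
  have h1 := Real.iteratedFDeriv_fourier (N := ⊤) hIntg hae (n := j) le_top
  rw [h1, Real.fourier_continuousMultilinearMap_apply]
  · refine congrArg (fun F : X → Z => 𝓕 F x) ?_
    ext v
    rw [VectorFourier.fourierPowSMulRight_apply]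
    have hh : ∀ i, (innerSL ℝ v) (w i) = ⟪v, w i⟫ := fun i => rfl
    simp only [hh, inner_neg_left, Finset.prod_neg, hm']
    rw [← Complex.coe_smul, smul_smul]
    congr 1
    rw [neg_pow (2 * Real.pi * Complex.I : ℂ)]
    simp only [Finset.card_univ, Fintype.card_fin]
    push_cast
    ring
  · exact VectorFourier.integrable_fourierPowSMulRight (innerSL ℝ) (hIntg j le_top) hae

end Nec
end HardyCanc

namespace HardyCanc
open FourierTransform Filter

section Nec2
variable {X : Type*} [NormedAddCommGroup X] [InnerProductSpace ℝ X] [FiniteDimensional ℝ X]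
  [MeasurableSpace X] [BorelSpace X]
  {k : ℕ} {V E : Type*} [NormedAddCommGroup V] [InnerProductSpace ℝ V] [FiniteDimensional ℝ V]
  [NormedAddCommGroup E] [InnerProductSpace ℝ E] [FiniteDimensional ℝ E]
  {G : Type*} [NormedAddCommGroup G] [NormedSpace ℝ G]

/-- wide annular cutoff -/
def cut (N : ℕ) (ξ : X) : ℝ := chi (((2 : ℝ) ^ N)⁻¹ • ξ) - chi ((2 : ℝ) ^ N • ξ)

lemma cut_contDiff (N : ℕ) : ContDiff ℝ (⊤ : ℕ∞) (cut N : X → ℝ) :=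
  (chi_contDiff.comp (contDiff_const_smul _)).sub (chi_contDiff.comp (contDiff_const_smul _))

lemma cut_supp (N : ℕ) : HasCompactSupport (cut N : X → ℝ) := by
  have h1 : ((2 : ℝ) ^ N)⁻¹ ≠ 0 := by positivity
  have h2 : ((2 : ℝ) ^ N) ≠ 0 := by positivity
  exact (chi_supp.comp_smul h1).sub (chi_supp.comp_smul h2)

lemma cut_small (N : ℕ) {ξ : X} (h : ‖ξ‖ ≤ ((2 : ℝ) ^ N)⁻¹) : cut N ξ = 0 := by
  have h3 : ((2 : ℝ) ^ N)⁻¹ ≤ 1 := inv_le_one_of_one_le₀ (one_le_pow₀ (by norm_num))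
  rw [cut, chi_eq_one, chi_eq_one, sub_self]
  · rw [norm_smul, Real.norm_of_nonneg (by positivity)]
    rwa [← le_inv_mul_iff₀ (by positivity), mul_one]
  · rw [norm_smul, Real.norm_of_nonneg (by positivity)]
    exact mul_le_one₀ h3 (norm_nonneg _) (h.trans h3)

lemma cut_zero (N : ℕ) : cut N (0 : X) = 0 := cut_small N (by simp)

lemma cut_one {N : ℕ} {ξ : X} (h1 : 2 * ((2 : ℝ) ^ N)⁻¹ ≤ ‖ξ‖) (h2 : ‖ξ‖ ≤ 2 ^ N) :
    cut N ξ = 1 := by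
  rw [cut, chi_eq_one, chi_eq_zero, sub_zero]
  · rw [norm_smul, Real.norm_of_nonneg (by positivity)]
    rwa [← div_eq_mul_inv, div_le_iff₀' (by positivity)] at h1
  · rw [norm_smul, Real.norm_of_nonneg (by positivity), inv_mul_le_iff₀ (by positivity), mul_one]
    exact h2

lemma cut_smul_contDiff (N : ℕ) {F : X → G} (hF : ∀ ξ, ξ ≠ 0 → ContDiffAt ℝ (⊤ : ℕ∞) F ξ) :
    ContDiff ℝ (⊤ : ℕ∞) (fun ξ => cut N ξ • F ξ) := by
  rw [contDiff_iff_contDiffAt]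
  intro ξ
  by_cases h : ξ = 0
  · subst h
    have hp : (0 : ℝ) < ((2 : ℝ) ^ N)⁻¹ := by positivity
    have : (fun ξ => cut N ξ • F ξ) =ᶠ[nhds 0] fun _ => 0 := by
      filter_upwards [Metric.ball_mem_nhds (0 : X) hp] with y hy
      rw [cut_small N (by simpa using (Metric.mem_ball.1 hy).le), zero_smul]
    exact contDiffAt_const.congr_of_eventuallyEq this
  · exact (cut_contDiff N).contDiffAt.smul (hF ξ h)

lemma cut_smul_supp (N : ℕ) (F : X → G) : HasCompactSupport (fun ξ => cut N ξ • F ξ) :=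
  (cut_supp N).smul_right

lemma ofReal_test {f : X → ℝ} (hf : IsTestFun f) : IsTestFun (fun ξ => ((f ξ : ℝ) : ℂ)) :=
  testFun_comp hf Complex.ofRealCLM

lemma csmul_test {Z : Type*} [NormedAddCommGroup Z] [NormedSpace ℂ Z] {f : X → ℂ} {g : X → Z}
    (hf : ContDiff ℝ (⊤ : ℕ∞) f) (hg : IsTestFun g) : IsTestFun (fun ξ => f ξ • g ξ) :=
  ⟨hf.fun_smul hg.1, hg.2.smul_left⟩

lemma test_int {Z : Type*} [NormedAddCommGroup Z] [NormedSpace ℝ Z] {g : X → Z}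
    (hg : IsTestFun g) : Integrable g :=
  hg.1.continuous.integrable_of_hasCompactSupport hg.2

lemma test_conv {Z : Type*} [NormedAddCommGroup Z] [NormedSpace ℂ Z] {m : X → Z}
    (h : IsTestFun m) (x : X) : Integrable (fun ξ => Real.fourierChar ⟪ξ, x⟫ • m ξ) := by
  have := (Real.fourierIntegral_convergent_iff (μ := volume) (-x)).2 (test_int h)
  simpa only [inner_neg_right, neg_neg] using this

lemma chi_L1 {t : ℝ} (ht : 0 < t) :
    ∫⁻ x, ‖𝓕⁻ (fun ξ : X => ((chi (t⁻¹ • ξ) : ℝ) : ℂ)) x‖ₑ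
      = ∫⁻ x, ‖𝓕⁻ (fun ξ : X => ((chi ξ : ℝ) : ℂ)) x‖ₑ := by
  have hsm : Continuous (𝓕⁻ (fun ξ : X => ((chi ξ : ℝ) : ℂ))) := by
    obtain ⟨h1, h2⟩ := ofReal_test (X := X) (f := chi) ⟨chi_contDiff, chi_supp⟩
    exact (kernel_props h1 h2 0).1.continuous
  simp_rw [fourierInv_scale (fun ξ : X => ((chi ξ : ℝ) : ℂ)) ht, enorm_smul]
  rw [lintegral_const_mul' _ _ enorm_ne_top]
  have hmap := Measure.map_addHaar_smul (volume : Measure X) ht.ne'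
  have h1 := lintegral_map (μ := (volume : Measure X)) hsm.enorm.measurable (measurable_const_smul t)
  rw [hmap, lintegral_smul_measure, smul_eq_mul] at h1
  rw [← h1, ← mul_assoc, ← ofReal_norm_eq_enorm, Complex.norm_real, ← ENNReal.ofReal_mul (norm_nonneg _),
    Real.norm_of_nonneg (by positivity), abs_of_nonneg (by positivity),
    mul_inv_cancel₀ (by positivity), ENNReal.ofReal_one, one_mul]

lemma cut_L1 (N : ℕ) :
    ∫⁻ x, ‖𝓕⁻ (fun ξ : X => ((cut N ξ : ℝ) : ℂ)) x‖ₑ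
      ≤ 2 * ∫⁻ x, ‖𝓕⁻ (fun ξ : X => ((chi ξ : ℝ) : ℂ)) x‖ₑ := by
  have hN : (0 : ℝ) < 2 ^ N := by positivity
  have ht : ∀ t : ℝ, 0 < t → IsTestFun (fun ξ : X => ((chi (t⁻¹ • ξ) : ℝ) : ℂ)) := by
    intro t ht
    exact ofReal_test ⟨chi_contDiff.comp (contDiff_const_smul _),
      chi_supp.comp_smul (inv_ne_zero ht.ne')⟩
  have e : ∀ x : X, 𝓕⁻ (fun ξ : X => ((cut N ξ : ℝ) : ℂ)) x =
      𝓕⁻ (fun ξ : X => ((chi (((2 : ℝ) ^ N)⁻¹ • ξ) : ℝ) : ℂ)) x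
      - 𝓕⁻ (fun ξ : X => ((chi ((((2 : ℝ) ^ N)⁻¹)⁻¹ • ξ) : ℝ) : ℂ)) x := by
    intro x
    simp only [Real.fourierInv_eq]
    rw [← integral_sub]
    · congr 1
      ext ξ
      rw [cut, inv_inv, ← smul_sub]
      push_cast
      rfl
    · exact test_conv (ht _ hN) x
    · exact test_conv (ht _ (inv_pos.2 hN)) x
  simp_rw [e]
  refine (lintegral_mono fun x => enorm_sub_le).trans ?_
  rw [lintegral_add_left, chi_L1 hN, chi_L1 (inv_pos.2 hN), two_mul]
  exact (kernel_props (ht _ hN).1 (ht _ hN).2 0).1.continuous.enorm.measurable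

/-- Riesz representative of `τ ∘ z` -/
def kapT (τ : ℂ →L[ℝ] ℝ) : (V →L[ℝ] ℂ) →L[ℝ] V :=
  ∑ a, (τ.comp (ContinuousLinearMap.apply ℝ ℂ (stdOrthonormalBasis ℝ V a))).smulRight
    (stdOrthonormalBasis ℝ V a)

lemma kapT_apply (τ : ℂ →L[ℝ] ℝ) (z : V →L[ℝ] ℂ) :
    kapT τ z = ∑ a, τ (z (stdOrthonormalBasis ℝ V a)) • stdOrthonormalBasis ℝ V a := by
  simp [kapT, ContinuousLinearMap.sum_apply]

lemma inner_kapT (τ : ℂ →L[ℝ] ℝ) (z : V →L[ℝ] ℂ) (w : V) : ⟪kapT τ z, w⟫ = τ (z w) := by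
  rw [kapT_apply, sum_inner]
  conv_rhs => rw [← (stdOrthonormalBasis ℝ V).sum_repr' w]
  simp only [map_sum, map_smul, inner_smul_left, smul_eq_mul]
  exact Finset.sum_congr rfl fun a _ => by simp [mul_comm]

/-- embedding of `V` -/
def emb : V →L[ℝ] (V →L[ℝ] ℂ) := (ContinuousLinearMap.compL ℝ V ℝ ℂ Complex.ofRealCLM).comp (innerSL ℝ)

lemma emb_apply (v w : V) : emb v w = ((⟪v, w⟫ : ℝ) : ℂ) := rfl

lemma kapT_emb (τ : ℂ →L[ℝ] ℝ) (c : ℂ) (v : V) : kapT τ (c • emb v) = τ c • v := by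
  refine ext_inner_right ℝ fun w => ?_
  rw [inner_kapT, ContinuousLinearMap.smul_apply, emb_apply, smul_eq_mul, mul_comm,
    ← Complex.real_smul, map_smul, inner_smul_left]
  simp [mul_comm]

/-- the multiplier -/
def mN (k N : ℕ) (v : X → V) (ξ : X) : V →L[ℝ] ℂ :=
  ((2 * Real.pi * Complex.I) ^ k)⁻¹ • (cut N ξ • emb (v ξ))

lemma mN_test (k N : ℕ) {v : X → V} (hv : ∀ ξ, ξ ≠ 0 → ContDiffAt ℝ (⊤ : ℕ∞) v ξ) :
    IsTestFun (mN k N v) := by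
  have h1 : IsTestFun (fun ξ => cut N ξ • emb (v ξ)) :=
    ⟨cut_smul_contDiff N fun ξ h => (emb (V := V)).contDiff.contDiffAt.comp ξ (hv ξ h),
      cut_smul_supp N (fun ξ => emb (v ξ))⟩
  exact csmul_test contDiff_const h1

lemma twopi_ne : (2 * Real.pi * Complex.I : ℂ) ≠ 0 := Complex.two_pi_I_ne_zero

lemma nec_app (A : DiffOperator X k V E) {v : X → V} {e : E}
    (hv : ∀ ξ, ξ ≠ 0 → ContDiffAt ℝ (⊤ : ℕ∞) v ξ)
    (hve : ∀ ξ, ξ ≠ 0 → A.symbol ξ (v ξ) = e) (N : ℕ) (τ : ℂ →L[ℝ] ℝ) (x : X) :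
    A.app (fun x => kapT τ (𝓕⁻ (mN k N v) x)) x
      = τ (𝓕⁻ (fun ξ : X => ((cut N ξ : ℝ) : ℂ)) x) • e := by
  have hm := mN_test k N hv
  have hs := (kernel_props hm.1 hm.2 0).1
  have hcut := ofReal_test (X := X) (f := cut N) ⟨cut_contDiff N, cut_supp N⟩
  set b : (Fin k → Fin (Module.finrank ℝ X)) → Fin k → X :=
    fun J i => stdOrthonormalBasis ℝ X (J i) with hb
  have hmJ : ∀ J, IsTestFun (fun ξ => ((2 * Real.pi * Complex.I) ^ k *
      ((∏ i, ⟪ξ, b J i⟫ : ℝ) : ℂ)) • mN k N v ξ) := by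
    intro J
    refine csmul_test ?_ hm
    have h0 : ContDiff ℝ (⊤ : ℕ∞) (fun ξ : X => ∏ i, ⟪ξ, b J i⟫) :=
      contDiff_prod fun i _ => contDiff_id.inner ℝ contDiff_const
    have h1 : ContDiff ℝ (⊤ : ℕ∞) (fun ξ : X => ((∏ i, ⟪ξ, b J i⟫ : ℝ) : ℂ)) :=
      Complex.ofRealCLM.contDiff.comp h0
    exact contDiff_const.mul h1
  rw [app_expand]
  simp_rw [iteratedFDeriv_comp_clm hs, iter_fourierInv hm.1 hm.2, Real.fourierInv_eq]
  have h1 : ∀ J, (A.comp (tens (b J))) (kapT τ (∫ ξ, Real.fourierChar ⟪ξ, x⟫ •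
      (((2 * Real.pi * Complex.I) ^ k * ((∏ i, ⟪ξ, b J i⟫ : ℝ) : ℂ)) • mN k N v ξ)))
      = ∫ ξ, (A.comp (tens (b J))) (kapT τ (Real.fourierChar ⟪ξ, x⟫ •
      (((2 * Real.pi * Complex.I) ^ k * ((∏ i, ⟪ξ, b J i⟫ : ℝ) : ℂ)) • mN k N v ξ))) := fun J =>
    (((A.comp (tens (b J))).comp (kapT τ)).integral_comp_comm (test_conv (hmJ J) x)).symm
  rw [Finset.sum_congr rfl fun J _ => h1 J, ← integral_finset_sum]
  · rw [← τ.integral_comp_comm (test_conv hcut x), ← integral_smul_const]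
    congr 1
    ext ξ
    have h2 : ∀ J, kapT τ (Real.fourierChar ⟪ξ, x⟫ •
      (((2 * Real.pi * Complex.I) ^ k * ((∏ i, ⟪ξ, b J i⟫ : ℝ) : ℂ)) • mN k N v ξ))
      = (∏ i, ⟪ξ, b J i⟫ : ℝ) • τ (Real.fourierChar ⟪ξ, x⟫ • ((cut N ξ : ℝ) : ℂ)) • v ξ := by
      intro J
      rw [← kapT_emb, ← map_smul]
      congr 1
      ext w
      simp only [mN, Circle.smul_def, ContinuousLinearMap.smul_apply, smul_eq_mul, Complex.real_smul]
      field_simp [twopi_ne]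
    simp_rw [h2, map_smul]
    have h3 := congrArg (fun F => F (v ξ)) (symbol_expand A ξ)
    simp only [ContinuousLinearMap.sum_apply, ContinuousLinearMap.smul_apply] at h3
    by_cases h0 : ξ = 0
    · subst h0; simp [cut_zero]
    · rw [hve ξ h0] at h3
      rw [h3, Finset.smul_sum]
      refine Finset.sum_congr rfl fun J _ => ?_
      rw [smul_comm]
  · intro J _
    exact ((A.comp (tens (b J))).comp (kapT τ)).integrable_comp (test_conv (hmJ J) x)

end Nec2
end HardyCanc

namespace HardyCanc
open FourierTransform Filter

section Nec3
variable {X : Type*} [NormedAddCommGroup X] [InnerProductSpace ℝ X] [FiniteDimensional ℝ X]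
  [MeasurableSpace X] [BorelSpace X]
  {k : ℕ} {V E : Type*} [NormedAddCommGroup V] [InnerProductSpace ℝ V] [FiniteDimensional ℝ V]
  [NormedAddCommGroup E] [InnerProductSpace ℝ E] [FiniteDimensional ℝ E]

lemma pairing {h g : X → ℂ} (hh : IsTestFun h) (hg : IsTestFun g) :
    ∫ x, 𝓕⁻ h x * 𝓕 g x = ∫ ξ, h ξ * g ξ := by
  set H := hh.2.toSchwartzMap hh.1 with hH
  set Γ := hg.2.toSchwartzMap hg.1 with hΓ
  have h1 := SchwartzMap.integral_fourier_smul_eq (𝓕⁻ H) Γ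
  rw [FourierTransform.fourier_fourierInv_eq, SchwartzMap.fourierInv_coe, SchwartzMap.fourier_coe] at h1
  exact h1.symm

lemma pairing_scale {h g : X → ℂ} (hh : IsTestFun h) (hg : IsTestFun g) {a : ℝ} (ha : 0 < a) :
    ∫ x, 𝓕⁻ h x * 𝓕 g (a • x) = ∫ ζ, h (a • ζ) * g ζ := by
  have hga : IsTestFun (fun ξ => g (a⁻¹ • ξ)) :=
    ⟨hg.1.comp (contDiff_const_smul _), hg.2.comp_smul (inv_ne_zero ha.ne')⟩
  have h1 := pairing hh hga
  have h2 : ∀ x, 𝓕 (fun ξ => g (a⁻¹ • ξ)) x = ((a ^ Module.finrank ℝ X : ℝ) : ℂ) * 𝓕 g (a • x) := by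
    intro x
    have := fourierInv_scale g ha (-x)
    rwa [Real.fourierInv_eq_fourier_neg, Real.fourierInv_eq_fourier_neg, neg_neg, smul_neg,
      neg_neg] at this
  have h3 : ∫ ξ, h ξ * g (a⁻¹ • ξ) = (a ^ Module.finrank ℝ X : ℝ) • ∫ ζ, h (a • ζ) * g ζ := by
    rw [← Measure.integral_comp_inv_smul_of_nonneg _ _ ha.le]
    congr 1
    ext ξ
    rw [smul_smul, mul_inv_cancel₀ ha.ne', one_smul]
  rw [h3] at h1
  simp_rw [h2, mul_left_comm] at h1
  rw [integral_const_mul, Complex.real_smul] at h1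
  refine mul_left_cancel₀ ?_ h1
  exact_mod_cast (pow_pos ha _).ne'

lemma lower (hd : 0 < Module.finrank ℝ X) {P : X → ℂ} {l : ℕ} (hl : 1 ≤ l)
    (hP : ∀ ξ, ξ ≠ 0 → ContDiffAt ℝ (⊤ : ℕ∞) P ξ)
    (hPs : ∀ ξ, ξ ≠ 0 → ∀ t : ℝ, 0 < t → ((t ^ l : ℝ) : ℂ) * P (t • ξ) = P ξ)
    {ξ0 : X} (hξ0 : ‖ξ0‖ = 2) (hP0 : P ξ0 ≠ 0) {B : ℝ≥0∞} (hB : B ≠ ⊤)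
    (hbd : ∀ N, ∫⁻ x, ‖𝓕⁻ (fun ξ => cut N ξ • P ξ) x‖ₑ * ENNReal.ofReal ((‖x‖ ^ l)⁻¹) ≤ B) :
    False := by
  have : Nontrivial X := Module.nontrivial_of_finrank_pos hd
  set g : X → ℂ := fun ξ => rho ξ • (starRingEnd ℂ) (P ξ) with hg
  have hgt : IsTestFun g := by
    refine ⟨rho_smul_contDiff fun ξ h => ?_, rho_smul_supp (fun ξ => (starRingEnd ℂ) (P ξ))⟩
    exact (Complex.conjCLE.contDiff.contDiffAt).comp ξ (hP ξ h)
  have hht : ∀ N, IsTestFun (fun ξ => cut N ξ • P ξ) := fun N =>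
    ⟨cut_smul_contDiff N hP, cut_smul_supp N P⟩
  have hgn : IsTestFun (fun ξ => g (-ξ)) :=
    ⟨hgt.1.comp contDiff_neg, hgt.2.comp_homeomorph (Homeomorph.neg X)⟩
  obtain ⟨hφs, C, hC, hφb, -⟩ := kernel_props hgn.1 hgn.2 (l + 1)
  have hφe : 𝓕⁻ (fun ξ => g (-ξ)) = 𝓕 g := by
    rw [Real.fourierInv_eq_fourier_comp_neg]; simp
  rw [hφe] at hφs hφb
  have hφi : Integrable (𝓕 g) := test_fourier_integrable hgt
  set c : ℝ := ∫ ξ, rho ξ * ‖P ξ‖ ^ 2 with hc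
  have hgP : ∀ ξ, P ξ * g ξ = ((rho ξ * ‖P ξ‖ ^ 2 : ℝ) : ℂ) := by
    intro ξ
    simp only [hg, Complex.real_smul]
    rw [mul_left_comm, Complex.mul_conj, Complex.normSq_eq_norm_sq]
    push_cast; rfl
  have hcpos : 0 < c := by
    have hcont : Continuous (fun ξ => rho ξ * ‖P ξ‖ ^ 2) := by
      have h1 : ContDiff ℝ (⊤ : ℕ∞) (fun ξ => rho ξ • ‖P ξ‖ ^ 2) :=
        rho_smul_contDiff fun ξ h => (hP ξ h).norm_sq ℝ
      exact h1.continuous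
    refine hcont.integral_pos_of_hasCompactSupport_nonneg_nonzero (x := ξ0) ?_ ?_ ?_
    · exact rho_smul_supp (fun ξ => ‖P ξ‖ ^ 2)
    · intro ξ; exact mul_nonneg (rho_nonneg ξ) (by positivity)
    · rw [rho_eq_one hξ0]; simpa using hP0
  have hGi : ∀ N, Integrable (𝓕⁻ (fun ξ => cut N ξ • P ξ)) := by
    intro N
    obtain ⟨S, hS⟩ := fourierInv_schwartz (hht N).1 (hht N).2
    rw [← hS]; exact S.integrable
  have hφbd : ∀ x, ‖𝓕 g x‖ ≤ C := by
    intro x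
    refine le_trans ?_ (hφb x)
    exact le_mul_of_one_le_right (norm_nonneg _) (one_le_pow₀ (by linarith [norm_nonneg x]))
  have hprodi : ∀ N (a : ℝ), Integrable (fun x => 𝓕⁻ (fun ξ => cut N ξ • P ξ) x * 𝓕 g (a • x)) := by
    intro N a
    refine (hGi N).mul_bdd (c := C) ?_ ?_
    · exact (hφs.continuous.comp (continuous_const_smul a)).aestronglyMeasurable
    · exact Eventually.of_forall fun x => hφbd _
  have key : ∀ M : ℕ, ∫ x, 𝓕⁻ (fun ξ => cut (M + 2) ξ • P ξ) x * dySum (𝓕 g) l 1 M x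
      = ((M * c : ℝ) : ℂ) := by
    intro M
    have h1 : ∀ x, 𝓕⁻ (fun ξ => cut (M + 2) ξ • P ξ) x * dySum (𝓕 g) l 1 M x
        = ∑ i ∈ Finset.range M, (((2 : ℝ) ^ i) ^ l : ℝ) •
          (𝓕⁻ (fun ξ => cut (M + 2) ξ • P ξ) x * 𝓕 g ((2 : ℝ) ^ i • x)) := by
      intro x
      simp only [dySum, mul_one, Finset.mul_sum, mul_smul_comm]
    simp_rw [h1]
    rw [integral_finset_sum]
    swap
    · exact fun i _ => (hprodi (M + 2) ((2 : ℝ) ^ i)).smul (((2 : ℝ) ^ i) ^ l)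
    have h2 : ∀ i ∈ Finset.range M, ∫ x, (((2 : ℝ) ^ i) ^ l : ℝ) •
          (𝓕⁻ (fun ξ => cut (M + 2) ξ • P ξ) x * 𝓕 g ((2 : ℝ) ^ i • x)) = ((c : ℝ) : ℂ) := by
      intro i hi
      have hi' : i < M := Finset.mem_range.1 hi
      have ha : (0 : ℝ) < 2 ^ i := by positivity
      rw [integral_smul, pairing_scale (hht _) hgt ha, ← integral_smul, hc, ← integral_complex_ofReal]
      congr 1
      ext ζ
      by_cases hr : rho ζ = 0
      · simp [hg, hr]
      have hz1 : 1 < ‖ζ‖ := by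
        by_contra hcon
        exact hr (rho_eq_zero_small (not_lt.1 hcon))
      have hz4 : ‖ζ‖ < 4 := by
        by_contra hcon
        exact hr (rho_eq_zero_large (not_lt.1 hcon))
      have hz0 : ζ ≠ 0 := by rw [← norm_pos_iff]; linarith
      have hone : cut (M + 2) ((2 : ℝ) ^ i • ζ) = 1 := by
        apply cut_one
        · rw [norm_smul, Real.norm_of_nonneg ha.le]
          have h5 : 2 * ((2 : ℝ) ^ (M + 2))⁻¹ ≤ 1 := by
            rw [← div_eq_mul_inv, div_le_one (by positivity), pow_succ]
            have : (1 : ℝ) ≤ 2 ^ (M + 1) := one_le_pow₀ (by norm_num)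
            linarith
          have h6 : (1 : ℝ) ≤ 2 ^ i := one_le_pow₀ (by norm_num)
          nlinarith
        · rw [norm_smul, Real.norm_of_nonneg ha.le]
          have h7 : (2 : ℝ) ^ i ≤ 2 ^ M := pow_le_pow_right₀ (by norm_num) hi'.le
          calc (2 : ℝ) ^ i * ‖ζ‖ ≤ 2 ^ M * 4 := by gcongr
            _ = 2 ^ (M + 2) := by ring
      rw [hone, one_smul, Complex.real_smul, ← mul_assoc, hPs ζ hz0 _ ha, hgP]
    rw [Finset.sum_congr rfl h2]
    simp
  set K : ℝ≥0∞ := ENNReal.ofReal (2 * C) * B with hK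
  have hKt : K ≠ ⊤ := ENNReal.mul_ne_top ENNReal.ofReal_ne_top hB
  have hle : ∀ M : ℕ, ENNReal.ofReal (M * c) ≤ K := by
    intro M
    have h1 : ENNReal.ofReal (M * c) = ‖∫ x, 𝓕⁻ (fun ξ => cut (M + 2) ξ • P ξ) x *
        dySum (𝓕 g) l 1 M x‖ₑ := by
      rw [key, ← ofReal_norm_eq_enorm, Complex.norm_real, Real.norm_of_nonneg (by positivity)]
    rw [h1]
    refine (enorm_integral_le_lintegral_enorm _).trans ?_
    refine le_trans ?_ (mul_le_mul_right (hbd (M + 2)) (ENNReal.ofReal (2 * C)))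
    rw [← lintegral_const_mul' _ _ ENNReal.ofReal_ne_top]
    have h0 : ∀ᵐ x : X, x ≠ 0 := by simp [ae_iff, measure_singleton]
    refine lintegral_mono_ae ?_
    filter_upwards [h0] with x hx
    have hx0 : 0 < ‖x‖ := norm_pos_iff.2 hx
    have h2 := dySum_bound hl hC.le hφb one_pos M x
    have h3 : ‖dySum (𝓕 g) l 1 M x‖ₑ ≤ ENNReal.ofReal (2 * C) * ENNReal.ofReal ((‖x‖ ^ l)⁻¹) := by
      rw [← ofReal_norm_eq_enorm, ← ENNReal.ofReal_mul (by positivity)]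
      refine ENNReal.ofReal_le_ofReal ?_
      rwa [← div_eq_mul_inv, le_div_iff₀ (by positivity)]
    rw [enorm_mul]
    calc _ ≤ ‖𝓕⁻ (fun ξ => cut (M + 2) ξ • P ξ) x‖ₑ *
          (ENNReal.ofReal (2 * C) * ENNReal.ofReal ((‖x‖ ^ l)⁻¹)) := by gcongr
      _ = _ := by ring
  obtain ⟨M, hM⟩ := exists_nat_gt (K.toReal / c)
  have h1 := hle M
  rw [ENNReal.ofReal_le_iff_le_toReal hKt] at h1
  rw [div_lt_iff₀ hcpos] at hM
  linarith

lemma nec_bound (A : DiffOperator X k V E) {j l : ℕ} {C : ℝ}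
    (H : ∀ u : X → V, IsTestFun u →
      ∫⁻ x, ‖iteratedFDeriv ℝ j u x‖ₑ * ENNReal.ofReal ((‖x‖ ^ l)⁻¹)
        ≤ ENNReal.ofReal C * ∫⁻ y, ‖A.app u y‖ₑ)
    {v : X → V} {e : E}
    (hv : ∀ ξ, ξ ≠ 0 → ContDiffAt ℝ (⊤ : ℕ∞) v ξ)
    (hve : ∀ ξ, ξ ≠ 0 → A.symbol ξ (v ξ) = e) (w : Fin j → X) (v0 : V) :
    ∃ B : ℝ≥0∞, B ≠ ⊤ ∧ ∀ N, ∫⁻ x, ‖(iteratedFDeriv ℝ j (𝓕⁻ (mN k N v)) x w) v0‖ₑ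
      * ENNReal.ofReal ((‖x‖ ^ l)⁻¹) ≤ B := by
  set I := ∫⁻ x, ‖𝓕⁻ (fun ξ : X => ((chi ξ : ℝ) : ℂ)) x‖ₑ with hI
  have hIt : I ≠ ⊤ := by
    obtain ⟨h1, h2⟩ := ofReal_test (X := X) (f := chi) ⟨chi_contDiff, chi_supp⟩
    obtain ⟨S, hS⟩ := fourierInv_schwartz h1 h2
    rw [hI, ← hS]
    exact (S.integrable (μ := volume)).2.ne
  set K : ℝ≥0∞ := ENNReal.ofReal ((∏ i, ‖w i‖) * ‖v0‖) with hK
  set R : (ℂ →L[ℝ] ℝ) → ℝ≥0∞ := fun τ => K * (ENNReal.ofReal C * (‖τ‖ₑ * ‖e‖ₑ * (2 * I))) with hR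
  have hRt : ∀ τ, R τ ≠ ⊤ := fun τ =>
    ENNReal.mul_ne_top ENNReal.ofReal_ne_top (ENNReal.mul_ne_top ENNReal.ofReal_ne_top
      (ENNReal.mul_ne_top (ENNReal.mul_ne_top enorm_ne_top enorm_ne_top)
        (ENNReal.mul_ne_top (by norm_num) hIt)))
  refine ⟨R Complex.reCLM + R Complex.imCLM, ENNReal.add_ne_top.2 ⟨hRt _, hRt _⟩, fun N => ?_⟩
  have hm := mN_test k N hv
  obtain ⟨S, hS⟩ := fourierInv_schwartz hm.1 hm.2
  have hs : ContDiff ℝ (⊤ : ℕ∞) (𝓕⁻ (mN k N v)) := (kernel_props hm.1 hm.2 0).1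
  have hwm : Measurable (fun x : X => ENNReal.ofReal ((‖x‖ ^ l)⁻¹)) := by fun_prop
  set s : X → (V →L[ℝ] ℂ) := 𝓕⁻ (mN k N v) with hsdef
  have hDc : Continuous (fun x => (iteratedFDeriv ℝ j s x w) v0) := by
    have h1 : Continuous (iteratedFDeriv ℝ j s) := hs.continuous_iteratedFDeriv (mod_cast le_top)
    have h2 : Continuous (fun x => iteratedFDeriv ℝ j s x w) :=
      (ContinuousMultilinearMap.apply ℝ (fun _ : Fin j => X) (V →L[ℝ] ℂ) w).continuous.comp h1
    exact h2.clm_apply continuous_const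
  have one : ∀ τ : ℂ →L[ℝ] ℝ, ∫⁻ x, ‖τ ((iteratedFDeriv ℝ j s x w) v0)‖ₑ
      * ENNReal.ofReal ((‖x‖ ^ l)⁻¹) ≤ R τ := by
    intro τ
    set u : X → V := fun x => kapT τ (s x) with hu
    have huc : ContDiff ℝ (⊤ : ℕ∞) u := (kapT τ).contDiff.comp hs
    have hui : ∀ i, Integrable (iteratedFDeriv ℝ i u) := by
      intro i
      have h1 := schwartz_deriv_int S i
      rw [hS] at h1
      refine (h1.norm.const_mul ‖(kapT τ : (V →L[ℝ] ℂ) →L[ℝ] V)‖).mono'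
        (huc.continuous_iteratedFDeriv (mod_cast le_top)).aestronglyMeasurable ?_
      refine Eventually.of_forall fun x => ?_
      exact (kapT τ).norm_iteratedFDeriv_comp_left hs.contDiffAt (mod_cast le_top)
    have h2 := hardy_ext A H huc hui
    have h3 : ∫⁻ y, ‖A.app u y‖ₑ ≤ ‖τ‖ₑ * ‖e‖ₑ * (2 * I) := by
      have : ∀ y, ‖A.app u y‖ₑ ≤ ‖τ‖ₑ * ‖e‖ₑ * ‖𝓕⁻ (fun ξ : X => ((cut N ξ : ℝ) : ℂ)) y‖ₑ := by
        intro y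
        rw [hu, hsdef, nec_app A hv hve, enorm_smul, mul_right_comm]
        gcongr
        exact ContinuousLinearMap.le_opENorm _ _
      refine (lintegral_mono this).trans ?_
      rw [lintegral_const_mul' _ _ (ENNReal.mul_ne_top enorm_ne_top enorm_ne_top)]
      gcongr
      exact cut_L1 N
    have h4 : ∀ x, ‖τ ((iteratedFDeriv ℝ j s x w) v0)‖ₑ ≤ K * ‖iteratedFDeriv ℝ j u x‖ₑ := by
      intro x
      rw [← inner_kapT, ← iteratedFDeriv_comp_clm hs, ← ofReal_norm_eq_enorm,
        ← ofReal_norm_eq_enorm, hK, ← ENNReal.ofReal_mul (by positivity)]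
      refine ENNReal.ofReal_le_ofReal ((norm_inner_le_norm _ _).trans ?_)
      have := (iteratedFDeriv ℝ j u x).le_opNorm w
      calc _ ≤ (‖iteratedFDeriv ℝ j u x‖ * ∏ i, ‖w i‖) * ‖v0‖ := by gcongr
        _ = _ := by ring
    calc _ ≤ ∫⁻ x, K * (‖iteratedFDeriv ℝ j u x‖ₑ * ENNReal.ofReal ((‖x‖ ^ l)⁻¹)) := by
          refine lintegral_mono fun x => ?_
          rw [← mul_assoc]
          gcongr
          exact h4 x
      _ = K * ∫⁻ x, (‖iteratedFDeriv ℝ j u x‖ₑ * ENNReal.ofReal ((‖x‖ ^ l)⁻¹)) :=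
          lintegral_const_mul' _ _ ENNReal.ofReal_ne_top
      _ ≤ _ := by
          refine mul_le_mul_right (h2.trans ?_) K
          exact mul_le_mul_right h3 _
  calc _ ≤ ∫⁻ x, (‖Complex.reCLM ((iteratedFDeriv ℝ j s x w) v0)‖ₑ * ENNReal.ofReal ((‖x‖ ^ l)⁻¹)
        + ‖Complex.imCLM ((iteratedFDeriv ℝ j s x w) v0)‖ₑ * ENNReal.ofReal ((‖x‖ ^ l)⁻¹)) := by
        refine lintegral_mono fun x => ?_
        rw [← add_mul]
        gcongr
        rw [← ofReal_norm_eq_enorm, ← ofReal_norm_eq_enorm, ← ofReal_norm_eq_enorm,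
          ← ENNReal.ofReal_add (norm_nonneg _) (norm_nonneg _)]
        exact ENNReal.ofReal_le_ofReal (Complex.norm_le_abs_re_add_abs_im _)
    _ = _ := by
        refine lintegral_add_left ?_ _
        exact (Complex.reCLM.continuous.comp hDc).enorm.measurable.mul hwm
    _ ≤ _ := add_le_add (one _) (one _)

/-- the scalar multiplier -/
def PP (k : ℕ) {j : ℕ} (v : X → V) (w : Fin j → X) (v0 : V) (ξ : X) : ℂ :=
  ((2 * Real.pi * Complex.I) ^ j * ((2 * Real.pi * Complex.I) ^ k)⁻¹) *
    (((∏ i, ⟪ξ, w i⟫) * ⟪v ξ, v0⟫ : ℝ) : ℂ)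

lemma deriv_eq_PP {j : ℕ} (N : ℕ) {v : X → V}
    (hv : ∀ ξ, ξ ≠ 0 → ContDiffAt ℝ (⊤ : ℕ∞) v ξ) (w : Fin j → X) (v0 : V) (x : X) :
    (iteratedFDeriv ℝ j (𝓕⁻ (mN k N v)) x w) v0 = 𝓕⁻ (fun ξ => cut N ξ • PP k v w v0 ξ) x := by
  have hm := mN_test k N hv
  have hmJ : IsTestFun (fun ξ => ((2 * Real.pi * Complex.I) ^ j *
      ((∏ i, ⟪ξ, w i⟫ : ℝ) : ℂ)) • mN k N v ξ) := by
    refine csmul_test ?_ hm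
    have h0 : ContDiff ℝ (⊤ : ℕ∞) (fun ξ : X => ∏ i, ⟪ξ, w i⟫) :=
      contDiff_prod fun i _ => contDiff_id.inner ℝ contDiff_const
    have h1 : ContDiff ℝ (⊤ : ℕ∞) (fun ξ : X => ((∏ i, ⟪ξ, w i⟫ : ℝ) : ℂ)) :=
      Complex.ofRealCLM.contDiff.comp h0
    exact contDiff_const.mul h1
  rw [iter_fourierInv hm.1 hm.2, Real.fourierInv_eq, Real.fourierInv_eq,
    ContinuousLinearMap.integral_apply (test_conv hmJ x)]
  congr 1
  ext ξ
  simp only [mN, PP, Circle.smul_def, ContinuousLinearMap.smul_apply, smul_eq_mul, Complex.real_smul,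
    emb_apply]
  push_cast
  ring

lemma necessity (hd : 0 < Module.finrank ℝ X) (A : DiffOperator X k V E) (hA : A.IsElliptic)
    {j l : ℕ} (hl : 1 ≤ l) (hjl : j + l = k) {C : ℝ}
    (H : ∀ u : X → V, IsTestFun u →
      ∫⁻ x, ‖iteratedFDeriv ℝ j u x‖ₑ * ENNReal.ofReal ((‖x‖ ^ l)⁻¹)
        ≤ ENNReal.ofReal C * ∫⁻ y, ‖A.app u y‖ₑ) : A.IsCanceling := by
  have : Nontrivial X := Module.nontrivial_of_finrank_pos hd
  refine Set.Subset.antisymm (fun e he => ?_) ?_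
  swap
  · rintro _ rfl
    simp only [Set.mem_iInter]
    exact fun ξ _ => ⟨0, map_zero _⟩
  simp only [Set.mem_iInter] at he
  by_contra hne
  have hne : e ≠ 0 := hne
  set v : X → V := fun ξ => pinv A ξ e with hvdef
  have hv : ∀ ξ, ξ ≠ 0 → ContDiffAt ℝ (⊤ : ℕ∞) v ξ := fun ξ h =>
    (contDiffAt_pinv A hA h).clm_apply contDiffAt_const
  have hve : ∀ ξ, ξ ≠ 0 → A.symbol ξ (v ξ) = e := by
    intro ξ h
    obtain ⟨y, hy⟩ := he ξ h
    have h1 := congrArg (fun F => F y) (pinv_comp A hA h)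
    simp only [ContinuousLinearMap.comp_apply, ContinuousLinearMap.id_apply, hy] at h1
    rw [hvdef]
    simp only
    rw [h1, hy]
  have hvs : ∀ ξ, ξ ≠ 0 → ∀ t : ℝ, 0 < t → t ^ k • v (t • ξ) = v ξ := by
    intro ξ h t ht
    apply hA ξ h
    rw [map_smul, hve ξ h, ← ContinuousLinearMap.smul_apply, ← symbol_smul,
      hve _ (smul_ne_zero ht.ne' h)]
  obtain ⟨ξ0, hξ0⟩ : ∃ ξ : X, ‖ξ‖ = 2 := exists_norm_eq X (by norm_num)
  have hξ00 : ξ0 ≠ 0 := by rw [← norm_pos_iff, hξ0]; norm_num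
  set w : Fin j → X := fun _ => ξ0 with hw
  obtain ⟨B, hB, hb⟩ := nec_bound A H hv hve w (v ξ0)
  simp_rw [deriv_eq_PP _ hv] at hb
  refine lower hd hl (P := PP k v w (v ξ0)) ?_ ?_ hξ0 ?_ hB hb
  · intro ξ h
    have h0 : ContDiffAt ℝ (⊤ : ℕ∞) (fun ξ : X => (∏ i, ⟪ξ, w i⟫) * ⟪v ξ, v ξ0⟫) ξ := by
      refine ContDiffAt.mul ?_ ((hv ξ h).inner ℝ contDiffAt_const)
      exact contDiffAt_prod fun i _ => contDiffAt_id.inner ℝ contDiffAt_const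
    have h1 : ContDiffAt ℝ (⊤ : ℕ∞) (fun ξ : X => (((∏ i, ⟪ξ, w i⟫) * ⟪v ξ, v ξ0⟫ : ℝ) : ℂ)) ξ :=
      Complex.ofRealCLM.contDiff.contDiffAt.comp ξ h0
    exact contDiffAt_const.mul h1
  · intro ξ h t ht
    simp only [PP]
    rw [mul_left_comm, ← Complex.ofReal_mul]
    congr 2
    rw [← hvs ξ h t ht, ← hjl]
    simp only [inner_smul_left, hw, Finset.prod_const, Finset.card_univ, Fintype.card_fin, mul_pow]
    simp only [conj_trivial, pow_add]
    ring
  · have hv0 : v ξ0 ≠ 0 := by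
      intro h
      have := hve ξ0 hξ00
      rw [h, map_zero] at this
      exact hne this.symm
    simp only [PP, hw]
    refine mul_ne_zero (mul_ne_zero (pow_ne_zero _ twopi_ne) (inv_ne_zero (pow_ne_zero _ twopi_ne))) ?_
    rw [Complex.ofReal_ne_zero]
    refine mul_ne_zero (Finset.prod_ne_zero_iff.2 fun i _ => ?_) ?_
    · exact inner_self_ne_zero.2 hξ00
    · exact inner_self_ne_zero.2 hv0

end Nec3
end HardyCanc

/-- Theorem: Hardy inequality for elliptic canceling operators.
For an elliptic homogeneous operator `A(D)` of order `k` on `ℝⁿ` (`n ≥ 2`) and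
`ℓ ∈ {1, …, min(k, n−1)}`, the Hardy estimate
`∫ |D^{k−ℓ}u(x)|/|x|^ℓ dx ≤ C ∫ |A(D)u|` holds for all `u ∈ C_c^∞(ℝⁿ; V)`
iff `A(D)` is canceling. -/
theorem statement1
    {V E : Type*} [NormedAddCommGroup V] [InnerProductSpace ℝ V] [FiniteDimensional ℝ V]
    [NormedAddCommGroup E] [InnerProductSpace ℝ E] [FiniteDimensional ℝ E]
    {n k ℓ : ℕ} (hn : 2 ≤ n) (hℓ1 : 1 ≤ ℓ) (hℓk : ℓ ≤ k) (hℓn : ℓ ≤ n - 1)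
    (A : DiffOperator (EuclideanSpace ℝ (Fin n)) k V E) (hA : A.IsElliptic) :
    (∃ C : ℝ, 0 < C ∧ ∀ u : EuclideanSpace ℝ (Fin n) → V, IsTestFun u →
        ∫⁻ x, (‖iteratedFDeriv ℝ (k - ℓ) u x‖₊ : ℝ≥0∞) / (‖x‖₊ : ℝ≥0∞) ^ (ℓ : ℝ)
          ≤ ENNReal.ofReal C * ∫⁻ x, (‖A.app u x‖₊ : ℝ≥0∞))
      ↔ A.IsCanceling := by
  classical
  have hfr : Module.finrank ℝ (EuclideanSpace ℝ (Fin n)) = n := finrank_euclideanSpace_fin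
  have hd : 0 < Module.finrank ℝ (EuclideanSpace ℝ (Fin n)) := by rw [hfr]; omega
  have hnt : Nontrivial (EuclideanSpace ℝ (Fin n)) := Module.nontrivial_of_finrank_pos hd
  have hae : ∀ᵐ x : EuclideanSpace ℝ (Fin n), x ≠ 0 := by
    simp [ae_iff, measure_singleton]
  have key : ∀ u : EuclideanSpace ℝ (Fin n) → V,
      ∫⁻ x, (‖iteratedFDeriv ℝ (k - ℓ) u x‖₊ : ℝ≥0∞) / (‖x‖₊ : ℝ≥0∞) ^ (ℓ : ℝ)
        = ∫⁻ x, ‖iteratedFDeriv ℝ (k - ℓ) u x‖ₑ * ENNReal.ofReal ((‖x‖ ^ ℓ)⁻¹) := by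
    intro u
    refine lintegral_congr_ae ?_
    filter_upwards [hae] with x hx
    have hx' : 0 < ‖x‖ := norm_pos_iff.mpr hx
    rw [ENNReal.rpow_natCast, div_eq_mul_inv, ENNReal.ofReal_inv_of_pos (pow_pos hx' _),
      ENNReal.ofReal_pow hx'.le, ofReal_norm_eq_enorm]
    rfl
  have hjl : (k - ℓ) + ℓ = k := by omega
  constructor
  · rintro ⟨C, -, hC⟩
    refine HardyCanc.necessity hd A hA hℓ1 hjl (C := C) ?_
    intro u hu
    have h := hC u hu
    rw [key u] at h
    exact h
  · intro hcan
    obtain ⟨C, hC0, hC⟩ := HardyCanc.sufficiency (q := n - ℓ - 1) hd A hA hcan hℓ1 hjl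
      (by rw [hfr]; omega)
    refine ⟨C, hC0, fun u hu => ?_⟩
    rw [key u]
    exact hC u hu
end
end

section
/- Let A(D) be a homogeneous linear differential operator of order k ≥ n on ℝⁿ from V to E. If A(D) is elliptic and canceling, then there exists a constant C > 0 such that sup_{x ∈ ℝⁿ} |D^{k−n}u(x)| ≤ C ∫_{ℝⁿ} |A(D)u(x)| dx for every u ∈ C_c^∞(ℝⁿ; V). -/
open MeasureTheory ENNReal
open scoped NNReal RealInnerProductSpace

noncomputable section

section Aux

set_option linter.unusedSectionVars false

open Filter Topology FourierTransform SchwartzMap Real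
open scoped ContDiff

variable {V E : Type*} [NormedAddCommGroup V] [InnerProductSpace ℝ V] [FiniteDimensional ℝ V]
    [NormedAddCommGroup E] [InnerProductSpace ℝ E] [FiniteDimensional ℝ E] {n k : ℕ}

/-- The elementary tensor `w ↦ (∏ ⟪φ s, w s⟫) • v`. -/
def ten {m : ℕ} (φ : Fin m → EuclideanSpace ℝ (Fin n)) (v : V) :
    ContinuousMultilinearMap ℝ (fun _ : Fin m => EuclideanSpace ℝ (Fin n)) V :=
  (ContinuousMultilinearMap.mkPiRing ℝ (Fin m) v).compContinuousLinearMap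
    (fun s => innerSL ℝ (φ s))

lemma ten_apply {m : ℕ} (φ w : Fin m → EuclideanSpace ℝ (Fin n)) (v : V) :
    ten φ v w = (∏ s, ⟪φ s, w s⟫) • v := by
  simp [ten]

lemma symbol_eq (A : DiffOperator (EuclideanSpace ℝ (Fin n)) k V E)
    (ξ : EuclideanSpace ℝ (Fin n)) (v : V) : A.symbol ξ v = A (ten (fun _ => ξ) v) := by
  rfl

/-- Standard basis vectors indexed by a word. -/
def ew {m : ℕ} (I : Fin m → Fin n) : Fin m → EuclideanSpace ℝ (Fin n) :=
  fun s => EuclideanSpace.basisFun (Fin n) ℝ (I s)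

lemma ten_expand {m : ℕ}
    (T : ContinuousMultilinearMap ℝ (fun _ : Fin m => EuclideanSpace ℝ (Fin n)) V) :
    T = ∑ I : Fin m → Fin n, ∑ i, ⟪stdOrthonormalBasis ℝ V i, T (ew I)⟫ •
      ten (ew I) (stdOrthonormalBasis ℝ V i) := by
  apply ContinuousMultilinearMap.toMultilinearMap_injective
  apply Module.Basis.ext_multilinear (fun _ => (EuclideanSpace.basisFun (Fin n) ℝ).toBasis)
  intro J
  have hJ : (fun i => (EuclideanSpace.basisFun (Fin n) ℝ).toBasis (J i)) = ew J := by
    funext i; simp [ew]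
  simp only [hJ, ContinuousMultilinearMap.coe_coe]
  have : ∀ I : Fin m → Fin n, ∏ s, ⟪ew I s, ew J s⟫ = if I = J then (1 : ℝ) else 0 := by
    intro I
    have h1 : ∀ s, ⟪ew I s, ew J s⟫ = if I s = J s then (1 : ℝ) else 0 := by
      intro s
      exact orthonormal_iff_ite.mp (EuclideanSpace.basisFun (Fin n) ℝ).orthonormal _ _
    simp only [h1]
    split_ifs with h
    · simp [h]
    · obtain ⟨s, hs⟩ := Function.ne_iff.mp h
      exact Finset.prod_eq_zero (Finset.mem_univ s) (by simp [hs])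
  simp only [sum_apply, smul_apply, ten_apply,
    this]
  simp [ite_smul, OrthonormalBasis.sum_repr']

lemma symbol_smul (A : DiffOperator (EuclideanSpace ℝ (Fin n)) k V E)
    (t : ℝ) (ξ : EuclideanSpace ℝ (Fin n)) (v : V) :
    A.symbol (t • ξ) v = t ^ k • A.symbol ξ v := by
  rw [symbol_eq, symbol_eq, ← map_smul]
  congr 1
  ext w
  simp [ten_apply, inner_smul_left, Finset.prod_mul_distrib, mul_smul]

/-- coefficients of the operator -/
def coef (A : DiffOperator (EuclideanSpace ℝ (Fin n)) k V E) (e : E) (I : Fin k → Fin n)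
    (i : Fin (Module.finrank ℝ V)) : ℝ := ⟪e, A (ten (ew I) (stdOrthonormalBasis ℝ V i))⟫

lemma inner_A_eq (A : DiffOperator (EuclideanSpace ℝ (Fin n)) k V E) (e : E)
    (T : ContinuousMultilinearMap ℝ (fun _ : Fin k => EuclideanSpace ℝ (Fin n)) V) :
    ⟪e, A T⟫ = ∑ I : Fin k → Fin n, ∑ i, coef A e I i * ⟪stdOrthonormalBasis ℝ V i, T (ew I)⟫ := by
  conv_lhs => rw [ten_expand T]
  simp only [map_sum, map_smul, inner_sum, inner_smul_right, coef]
  simp only [mul_comm]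

lemma inner_symbol_eq (A : DiffOperator (EuclideanSpace ℝ (Fin n)) k V E) (e : E)
    (ξ : EuclideanSpace ℝ (Fin n)) (i : Fin (Module.finrank ℝ V)) :
    ⟪e, A.symbol ξ (stdOrthonormalBasis ℝ V i)⟫ =
      ∑ I : Fin k → Fin n, coef A e I i * ∏ s, ⟪ξ, ew I s⟫ := by
  rw [symbol_eq, inner_A_eq]
  refine Finset.sum_congr rfl fun I _ => ?_
  simp [ten_apply, inner_smul_right, OrthonormalBasis.inner_eq_ite]

/-- complex coordinate of a vector valued function. -/
def coo (e : V) (u : EuclideanSpace ℝ (Fin n) → V) (x : EuclideanSpace ℝ (Fin n)) : ℂ :=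
  ((⟪e, u x⟫ : ℝ) : ℂ)

lemma coo_smooth (e : V) {u : EuclideanSpace ℝ (Fin n) → V} (hu : IsTestFun u) :
    ContDiff ℝ ∞ (coo e u) :=
  Complex.ofRealCLM.contDiff.comp ((innerSL ℝ e).contDiff.comp hu.1)

lemma coo_supp (e : V) {u : EuclideanSpace ℝ (Fin n) → V} (hu : IsTestFun u) :
    HasCompactSupport (coo e u) := by
  have := hu.2.comp_left (g := fun v => ((⟪e, v⟫ : ℝ) : ℂ)) (by simp)
  exact this

lemma coo_deriv (e : V) {u : EuclideanSpace ℝ (Fin n) → V} (hu : IsTestFun u) (m : ℕ)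
    (x : EuclideanSpace ℝ (Fin n)) (w : Fin m → EuclideanSpace ℝ (Fin n)) :
    iteratedFDeriv ℝ m (coo e u) x w = ((⟪e, iteratedFDeriv ℝ m u x w⟫ : ℝ) : ℂ) := by
  have h : coo e u = (Complex.ofRealCLM.comp (innerSL ℝ e)) ∘ u := by
    funext x; simp [coo]
  rw [h, ContinuousLinearMap.iteratedFDeriv_comp_left _ (hu.1.contDiffAt) (by exact_mod_cast le_top)]
  simp

/-- Fourier transform of a derivative. -/
lemma fourier_deriv {g : EuclideanSpace ℝ (Fin n) → ℂ} (hg : ContDiff ℝ ∞ g)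
    (hgs : HasCompactSupport g) (m : ℕ) (w : Fin m → EuclideanSpace ℝ (Fin n))
    (ξ : EuclideanSpace ℝ (Fin n)) :
    𝓕 (fun x => iteratedFDeriv ℝ m g x w) ξ =
      (2 * π * Complex.I) ^ m * (((∏ s, ⟪ξ, w s⟫ : ℝ)) : ℂ) * 𝓕 g ξ := by
  have hint : ∀ j : ℕ, Integrable (iteratedFDeriv ℝ j g) := fun j =>
    (hg.continuous_iteratedFDeriv (by exact_mod_cast le_top)).integrable_of_hasCompactSupport
      (hgs.iteratedFDeriv j)
  have h1 := Real.fourier_iteratedFDeriv (N := ⊤) hg (fun j _ => hint j) (n := m) le_top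
  have h2 : 𝓕 (fun x => iteratedFDeriv ℝ m g x w) ξ = (𝓕 (iteratedFDeriv ℝ m g) ξ) w := by
    rw [Real.fourier_continuousMultilinearMap_apply (hint m)]
  rw [h2, h1]
  simp only [VectorFourier.fourierPowSMulRight_apply]
  have h3 : (-(2 * π * Complex.I)) ^ m * (-1 : ℂ) ^ m = (2 * π * Complex.I) ^ m := by
    rw [← mul_pow]; ring
  have h4 : ∏ i, ((-innerSL ℝ) ξ) (w i) = (-1) ^ m * ∏ i, ⟪ξ, w i⟫ := by
    simp [Finset.prod_neg]
  rw [h4, ← h3, Complex.real_smul, smul_eq_mul]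
  push_cast
  ring

lemma symbol_contDiff (A : DiffOperator (EuclideanSpace ℝ (Fin n)) k V E) :
    ContDiff ℝ ∞ (fun ξ => A.symbol ξ) := by
  rw [contDiff_clm_apply_iff]
  intro v
  have : (fun ξ => A.symbol ξ v) = fun ξ => ∑ I : Fin k → Fin n, ∑ i,
      ((∏ s, ⟪ξ, ew I s⟫) * ⟪stdOrthonormalBasis ℝ V i, v⟫) •
      A (ten (ew I) (stdOrthonormalBasis ℝ V i)) := by
    funext ξ
    rw [symbol_eq]
    conv_lhs => rw [ten_expand (ten (fun _ => ξ) v)]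
    simp only [map_sum, map_smul, ten_apply, inner_smul_right]
  rw [this]
  refine ContDiff.sum fun I _ => ContDiff.sum fun i _ => ContDiff.smul ?_ contDiff_const
  refine ContDiff.mul ?_ contDiff_const
  refine contDiff_prod fun s _ => ?_
  exact contDiff_id.inner ℝ contDiff_const

/-- The operator `A(ξ)^* A(ξ)`. -/
def gram (A : DiffOperator (EuclideanSpace ℝ (Fin n)) k V E) (ξ : EuclideanSpace ℝ (Fin n)) :
    V →L[ℝ] V :=
  ∑ i, ((innerSL ℝ (A.symbol ξ (stdOrthonormalBasis ℝ V i))).comp (A.symbol ξ)).smulRight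
    (stdOrthonormalBasis ℝ V i)

lemma gram_apply (A : DiffOperator (EuclideanSpace ℝ (Fin n)) k V E)
    (ξ : EuclideanSpace ℝ (Fin n)) (v : V) : gram A ξ v =
      ∑ i, ⟪A.symbol ξ (stdOrthonormalBasis ℝ V i), A.symbol ξ v⟫ •
        stdOrthonormalBasis ℝ V i := by
  simp [gram]

lemma inner_sum_symbol (A : DiffOperator (EuclideanSpace ℝ (Fin n)) k V E)
    (ξ : EuclideanSpace ℝ (Fin n)) (e : E) (w : V) :
    ⟪∑ i, ⟪A.symbol ξ (stdOrthonormalBasis ℝ V i), e⟫ • stdOrthonormalBasis ℝ V i, w⟫ =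
      ⟪e, A.symbol ξ w⟫ := by
  conv_rhs => rw [← (stdOrthonormalBasis ℝ V).sum_repr' w]
  simp only [map_sum, map_smul, inner_sum, sum_inner, inner_smul_left, inner_smul_right]
  refine Finset.sum_congr rfl fun i _ => ?_
  rw [real_inner_comm e]
  simp [mul_comm]

lemma inner_gram (A : DiffOperator (EuclideanSpace ℝ (Fin n)) k V E)
    (ξ : EuclideanSpace ℝ (Fin n)) (v w : V) :
    ⟪gram A ξ v, w⟫ = ⟪A.symbol ξ v, A.symbol ξ w⟫ := by
  rw [gram_apply, inner_sum_symbol]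

lemma gram_contDiff (A : DiffOperator (EuclideanSpace ℝ (Fin n)) k V E) :
    ContDiff ℝ ∞ (gram A) := by
  rw [contDiff_clm_apply_iff]
  intro v
  simp only [gram_apply]
  have h := fun v => (symbol_contDiff A).clm_apply (contDiff_const (c := v))
  exact ContDiff.sum fun i _ => ContDiff.smul ((h _).inner ℝ (h _)) contDiff_const

lemma gram_inv (A : DiffOperator (EuclideanSpace ℝ (Fin n)) k V E) (hA : A.IsElliptic)
    {ξ : EuclideanSpace ℝ (Fin n)} (hξ : ξ ≠ 0) : (gram A ξ).IsInvertible := by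
  have hinj : Function.Injective (gram A ξ : V →ₗ[ℝ] V) := by
    rw [← LinearMap.ker_eq_bot, LinearMap.ker_eq_bot']
    intro v hv
    have h := inner_gram A ξ v v
    have hv' : gram A ξ v = 0 := hv
    rw [hv', inner_zero_left] at h
    have h0 : A.symbol ξ v = 0 := inner_self_eq_zero.mp h.symm
    exact hA ξ hξ (by rw [h0, map_zero])
  refine ⟨(LinearEquiv.ofInjectiveEndo _ hinj).toContinuousLinearEquiv, ?_⟩
  ext v
  rfl

/-- A smooth right inverse of `A(ξ)^*`. -/
def rinv (A : DiffOperator (EuclideanSpace ℝ (Fin n)) k V E) (ξ : EuclideanSpace ℝ (Fin n)) :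
    V →L[ℝ] E := (A.symbol ξ).comp (gram A ξ).inverse

lemma rinv_inner (A : DiffOperator (EuclideanSpace ℝ (Fin n)) k V E) (hA : A.IsElliptic)
    {ξ : EuclideanSpace ℝ (Fin n)} (hξ : ξ ≠ 0) (v w : V) :
    ⟪rinv A ξ v, A.symbol ξ w⟫ = ⟪v, w⟫ := by
  have h := (gram_inv A hA hξ).self_comp_inverse
  have h' : gram A ξ ((gram A ξ).inverse v) = v := by
    exact congrArg (fun f : V →L[ℝ] V => f v) h
  rw [rinv, ContinuousLinearMap.comp_apply, ← inner_gram, h']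

lemma rinv_contDiffAt (A : DiffOperator (EuclideanSpace ℝ (Fin n)) k V E) (hA : A.IsElliptic)
    {ξ : EuclideanSpace ℝ (Fin n)} (hξ : ξ ≠ 0) : ContDiffAt ℝ ∞ (rinv A) ξ := by
  have := FiniteDimensional.complete ℝ V
  have h1 : ContDiffAt ℝ ∞ (fun ξ => (gram A ξ).inverse) ξ :=
    ((gram_inv A hA hξ).contDiffAt_map_inverse (n := ∞)).comp ξ (gram_contDiff A).contDiffAt
  exact (symbol_contDiff A).contDiffAt.clm_comp h1

/-- Projection on the orthogonal complement of the range of `A(ξ)`. -/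
def prj (A : DiffOperator (EuclideanSpace ℝ (Fin n)) k V E) (e : E)
    (ξ : EuclideanSpace ℝ (Fin n)) : E :=
  e - rinv A ξ (∑ i, ⟪A.symbol ξ (stdOrthonormalBasis ℝ V i), e⟫ • stdOrthonormalBasis ℝ V i)

lemma prj_inner (A : DiffOperator (EuclideanSpace ℝ (Fin n)) k V E) (hA : A.IsElliptic) (e : E)
    {ξ : EuclideanSpace ℝ (Fin n)} (hξ : ξ ≠ 0) (w : V) :
    ⟪prj A e ξ, A.symbol ξ w⟫ = 0 := by
  rw [prj, inner_sub_left, rinv_inner A hA hξ, inner_sum_symbol, sub_self]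

lemma prj_contDiffAt (A : DiffOperator (EuclideanSpace ℝ (Fin n)) k V E) (hA : A.IsElliptic)
    (e : E) {ξ : EuclideanSpace ℝ (Fin n)} (hξ : ξ ≠ 0) : ContDiffAt ℝ ∞ (prj A e) ξ := by
  have h := fun v => (symbol_contDiff A).clm_apply (contDiff_const (c := v))
  refine contDiffAt_const.sub ((rinv_contDiffAt A hA hξ).clm_apply (ContDiff.contDiffAt ?_))
  exact ContDiff.sum fun i _ => ContDiff.smul ((h _).inner ℝ contDiff_const) contDiff_const

/-- Multiplying by a cutoff vanishing near zero. -/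
lemma cutoff_smooth {F : Type*} [NormedAddCommGroup F] [NormedSpace ℝ F]
    {χ : EuclideanSpace ℝ (Fin n) → ℝ} (hχ : ContDiff ℝ ∞ χ)
    (h0 : (0 : EuclideanSpace ℝ (Fin n)) ∉ tsupport χ)
    {g : EuclideanSpace ℝ (Fin n) → F} (hg : ∀ ξ ≠ 0, ContDiffAt ℝ ∞ g ξ) :
    ContDiff ℝ ∞ (fun ξ => χ ξ • g ξ) := by
  rw [contDiff_iff_contDiffAt]
  intro ξ
  by_cases hξ : ξ = 0
  · subst hξ
    have : (fun ξ => χ ξ • g ξ) =ᶠ[𝓝 0] fun _ => 0 := by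
      filter_upwards [notMem_tsupport_iff_eventuallyEq.mp h0] with x hx
      simp [hx]
    exact contDiffAt_const.congr_of_eventuallyEq this
  · exact hχ.contDiffAt.smul (hg ξ hξ)

/-- The space of integrals of smooth fields orthogonal to the range is everything. -/
lemma exists_annihilator (A : DiffOperator (EuclideanSpace ℝ (Fin n)) k V E) (hA : A.IsElliptic)
    (hAc : A.IsCanceling) (c : E) :
    ∃ ψ : EuclideanSpace ℝ (Fin n) → E, IsTestFun ψ ∧
      (∀ ξ w, ⟪ψ ξ, A.symbol ξ w⟫ = 0) ∧ ∫ ξ, ψ ξ = c := by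
  have hint : ∀ ψ : EuclideanSpace ℝ (Fin n) → E, IsTestFun ψ → Integrable ψ := fun ψ h =>
    h.1.continuous.integrable_of_hasCompactSupport h.2
  let S : Submodule ℝ E :=
    { carrier := {c | ∃ ψ : EuclideanSpace ℝ (Fin n) → E, IsTestFun ψ ∧
        (∀ ξ w, ⟪ψ ξ, A.symbol ξ w⟫ = 0) ∧ ∫ ξ, ψ ξ = c}
      add_mem' := by
        rintro a b ⟨ψ, h1, h2, h3⟩ ⟨ψ', h1', h2', h3'⟩
        refine ⟨fun x => ψ x + ψ' x, ⟨h1.1.add h1'.1, h1.2.add h1'.2⟩, fun ξ w => ?_, ?_⟩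
        · rw [inner_add_left, h2, h2', add_zero]
        · rw [integral_add (hint _ h1) (hint _ h1'), h3, h3']
      zero_mem' := ⟨fun _ => 0, ⟨contDiff_const, HasCompactSupport.zero⟩, by simp, by simp⟩
      smul_mem' := by
        rintro t a ⟨ψ, h1, h2, h3⟩
        refine ⟨fun x => t • ψ x, ⟨contDiff_const.smul h1.1, ?_⟩, fun ξ w => ?_, ?_⟩
        · exact h1.2.smul_left (f := fun _ => t)
        · rw [inner_smul_left, h2, mul_zero]
        · rw [integral_smul, h3] }
  suffices hS : S = ⊤ by
    have : c ∈ S := by rw [hS]; trivial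
    exact this
  have := FiniteDimensional.complete ℝ E
  rw [← Submodule.orthogonal_eq_bot_iff, Submodule.eq_bot_iff]
  intro e he
  have key : ∀ ξ₀ : EuclideanSpace ℝ (Fin n), ξ₀ ≠ 0 → e ∈ Set.range (A.symbol ξ₀) := by
    intro ξ₀ hξ₀
    have hpos : 0 < ‖ξ₀‖ := norm_pos_iff.mpr hξ₀
    let ζ : ContDiffBump ξ₀ := ⟨‖ξ₀‖ / 4, ‖ξ₀‖ / 2, by positivity, by linarith⟩
    have h0 : (0 : EuclideanSpace ℝ (Fin n)) ∉ tsupport ζ := by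
      rw [ζ.tsupport_eq, Metric.mem_closedBall, dist_zero_left]
      show ¬ (‖ξ₀‖ ≤ ‖ξ₀‖ / 2)
      linarith
    have hψ : IsTestFun (fun ξ => ζ ξ • prj A e ξ) :=
      ⟨cutoff_smooth ζ.contDiff h0 fun ξ hξ => prj_contDiffAt A hA e hξ,
        ζ.hasCompactSupport.smul_right⟩
    have hmem : ∫ ξ, ζ ξ • prj A e ξ ∈ S := by
      refine ⟨_, hψ, fun ξ w => ?_, rfl⟩
      by_cases hξ : ξ = 0
      · have : ζ ξ = 0 := by
          rw [hξ]; exact image_eq_zero_of_notMem_tsupport h0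
        rw [this, zero_smul, inner_zero_left]
      · rw [inner_smul_left, prj_inner A hA e hξ, mul_zero]
    have hz := (Submodule.mem_orthogonal' S e).mp he _ hmem
    rw [← integral_inner (hint _ hψ)] at hz
    have hpt : ∀ ξ, ⟪e, ζ ξ • prj A e ξ⟫ = ζ ξ * ‖prj A e ξ‖ ^ 2 := by
      intro ξ
      rw [inner_smul_right]
      by_cases hξ : ξ = 0
      · have : ζ ξ = 0 := by
          rw [hξ]; exact image_eq_zero_of_notMem_tsupport h0
        rw [this, zero_mul, zero_mul]
      · congr 1
        have h1 := prj_inner A hA e hξ ((gram A ξ).inverse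
          (∑ i, ⟪A.symbol ξ (stdOrthonormalBasis ℝ V i), e⟫ • stdOrthonormalBasis ℝ V i))
        have h2 : e = prj A e ξ + A.symbol ξ ((gram A ξ).inverse
          (∑ i, ⟪A.symbol ξ (stdOrthonormalBasis ℝ V i), e⟫ • stdOrthonormalBasis ℝ V i)) := by
          simp [prj, rinv]
        have h3 := congrArg (fun z => ⟪prj A e ξ, z⟫) h2
        simp only [inner_add_right] at h3
        rw [h1, add_zero, real_inner_self_eq_norm_sq] at h3
        rw [real_inner_comm, h3]
    have hcont : Continuous fun ξ => ⟪e, ζ ξ • prj A e ξ⟫ :=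
      continuous_const.inner hψ.1.continuous
    have hzero : prj A e ξ₀ = 0 := by
      by_contra hne
      have hp := hcont.integral_pos_of_hasCompactSupport_nonneg_nonzero (μ := volume)
        (hψ.2.comp_left (g := fun v => ⟪e, v⟫) (by simp))
        (fun ξ => by
          show (0 : ℝ) ≤ ⟪e, ζ ξ • prj A e ξ⟫
          rw [hpt]; exact mul_nonneg ζ.nonneg (by positivity))
        (x := ξ₀) (by
          rw [hpt, ζ.one_of_mem_closedBall (Metric.mem_closedBall_self ζ.rIn_pos.le), one_mul]
          exact pow_ne_zero _ (norm_ne_zero_iff.mpr hne))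
      exact hp.ne' hz
    rw [prj, sub_eq_zero] at hzero
    exact ⟨_, hzero.symm⟩
  have : e ∈ ⋂ (ξ : EuclideanSpace ℝ (Fin n)) (_ : ξ ≠ 0), Set.range (A.symbol ξ) := by
    simp only [Set.mem_iInter]
    exact key
  rw [hAc] at this
  exact this

/-- The multiplier. -/
lemma exists_multiplier (A : DiffOperator (EuclideanSpace ℝ (Fin n)) k V E) (hA : A.IsElliptic)
    (hAc : A.IsCanceling) {χ : EuclideanSpace ℝ (Fin n) → ℝ} (hχ : ContDiff ℝ ∞ χ)
    (h0 : (0 : EuclideanSpace ℝ (Fin n)) ∉ tsupport χ) (hs : HasCompactSupport χ) {m : ℕ}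
    (w : Fin m → EuclideanSpace ℝ (Fin n)) (b : V) :
    ∃ N : EuclideanSpace ℝ (Fin n) → E, IsTestFun N ∧
      (∀ ξ v, ⟪N ξ, A.symbol ξ v⟫ = χ ξ * (∏ s, ⟪ξ, w s⟫) * ⟪b, v⟫) ∧ ∫ ξ, N ξ = 0 := by
  have hint : ∀ ψ : EuclideanSpace ℝ (Fin n) → E, IsTestFun ψ → Integrable ψ := fun ψ h =>
    h.1.continuous.integrable_of_hasCompactSupport h.2
  have hN1 : IsTestFun (fun ξ => χ ξ • (∏ s, ⟪ξ, w s⟫) • rinv A ξ b) := by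
    refine ⟨cutoff_smooth hχ h0 fun ξ hξ => ContDiffAt.smul (ContDiff.contDiffAt ?_)
      ((rinv_contDiffAt A hA hξ).clm_apply contDiffAt_const), hs.smul_right⟩
    exact contDiff_prod fun s _ => contDiff_id.inner ℝ contDiff_const
  obtain ⟨ψ, h1, h2, h3⟩ := exists_annihilator A hA hAc
    (∫ ξ, χ ξ • (∏ s, ⟪ξ, w s⟫) • rinv A ξ b)
  refine ⟨fun ξ => χ ξ • (∏ s, ⟪ξ, w s⟫) • rinv A ξ b - ψ ξ, ⟨hN1.1.sub h1.1, hN1.2.sub h1.2⟩,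
    fun ξ v => ?_, ?_⟩
  · rw [inner_sub_left, h2, sub_zero]
    by_cases hξ : ξ = 0
    · have : χ ξ = 0 := by
        rw [hξ]; exact image_eq_zero_of_notMem_tsupport h0
      simp [this]
    · rw [inner_smul_left, inner_smul_left, rinv_inner A hA hξ]
      simp [mul_assoc]
  · rw [integral_sub (hint _ hN1) (hint _ h1), h3, sub_self]

lemma fourier_decay {N : EuclideanSpace ℝ (Fin n) → ℂ} (hN : ContDiff ℝ ∞ N)
    (hs : HasCompactSupport N) (h0 : ∫ ξ, N ξ = 0) :
    ∃ C : ℝ, 0 ≤ C ∧ ∀ y, ‖𝓕 N y‖ ≤ C * min ‖y‖ ‖y‖⁻¹ := by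
  let F : 𝓢(EuclideanSpace ℝ (Fin n), ℂ) := 𝓕 (hs.toSchwartzMap hN)
  have hF : ∀ y, F y = 𝓕 N y := fun y => rfl
  have hF0 : F 0 = 0 := by
    rw [hF, Real.fourier_eq]
    simpa using h0
  obtain ⟨C₁, hC₁⟩ := F.decay' 1 0
  obtain ⟨C₂, hC₂⟩ := F.decay' 0 1
  have hC₁' : ∀ y, ‖y‖ * ‖F y‖ ≤ C₁ := by
    intro y
    have := hC₁ y
    rw [pow_one, norm_iteratedFDeriv_zero] at this
    exact this
  have hC₂' : ∀ y, ‖F y‖ ≤ C₂ * ‖y‖ := by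
    intro y
    have hb : ∀ x ∈ (Set.univ : Set (EuclideanSpace ℝ (Fin n))), ‖fderiv ℝ F x‖ ≤ C₂ := by
      intro x _
      have := hC₂ x
      rw [pow_zero, one_mul, ← norm_iteratedFDeriv_one] at *
      exact this
    have := Convex.norm_image_sub_le_of_norm_fderiv_le (𝕜 := ℝ) (f := F) (x := 0) (y := y)
      (fun x _ => F.differentiableAt) hb convex_univ (Set.mem_univ _) (Set.mem_univ _)
    simpa [hF0] using this
  refine ⟨max 0 (max C₁ C₂), le_max_left _ _, fun y => ?_⟩
  rw [← hF]
  rcases eq_or_ne y 0 with rfl | hy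
  · simp [hF0]
  have hy' : 0 < ‖y‖ := norm_pos_iff.mpr hy
  have hC1 : C₁ ≤ max 0 (max C₁ C₂) := (le_max_left _ _).trans (le_max_right _ _)
  have hC2 : C₂ ≤ max 0 (max C₁ C₂) := (le_max_right _ _).trans (le_max_right _ _)
  rcases min_choice ‖y‖ ‖y‖⁻¹ with h | h <;> rw [h]
  · exact (hC₂' y).trans (by gcongr)
  · rw [← div_eq_mul_inv, le_div_iff₀ hy', mul_comm]
    exact (hC₁' y).trans hC1

lemma fourier_scale (N : EuclideanSpace ℝ (Fin n) → ℂ) {t : ℝ} (ht : 0 < t)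
    (y : EuclideanSpace ℝ (Fin n)) :
    𝓕 (fun ξ => ((t ^ n : ℝ) : ℂ) * N (t • ξ)) y = 𝓕 N (t⁻¹ • y) := by
  rw [Real.fourier_eq, Real.fourier_eq]
  have h := Measure.integral_comp_smul (volume : Measure (EuclideanSpace ℝ (Fin n)))
    (fun ζ => 𝐞 (-⟪ζ, t⁻¹ • y⟫) • N ζ) t
  have h2 : ∀ ξ : EuclideanSpace ℝ (Fin n), ⟪t • ξ, t⁻¹ • y⟫ = ⟪ξ, y⟫ := by
    intro ξ
    rw [inner_smul_left, inner_smul_right]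
    simp [ht.ne']
  simp only [h2] at h
  have h3 : ∀ ξ : EuclideanSpace ℝ (Fin n), 𝐞 (-⟪ξ, y⟫) • (((t ^ n : ℝ) : ℂ) * N (t • ξ)) =
      ((t ^ n : ℝ) : ℂ) * (𝐞 (-⟪ξ, y⟫) • N (t • ξ)) := by
    intro ξ
    exact (mul_smul_comm _ _ _).symm
  simp only [h3]
  rw [integral_const_mul, h, finrank_euclideanSpace_fin, abs_of_pos (by positivity),
    Complex.real_smul, ← mul_assoc, ← Complex.ofReal_mul, mul_inv_cancel₀ (by positivity)]
  simp

lemma summable_half : Summable fun j : ℤ => ((1 : ℝ) / 2) ^ j.natAbs := by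
  apply Summable.of_nat_of_neg
  · simpa using summable_geometric_two
  · simpa using summable_geometric_two

lemma min_le_half (j : ℤ) {r : ℝ} (h1 : 1 ≤ r) (h2 : r < 2) :
    min ((2 : ℝ) ^ j * r) ((2 : ℝ) ^ j * r)⁻¹ ≤ 2 * (1 / 2) ^ j.natAbs := by
  rcases le_total 0 j with h | h
  · lift j to ℕ using h
    refine (min_le_right _ _).trans ?_
    simp only [zpow_natCast, Int.natAbs_natCast, mul_inv, one_div, inv_pow]
    have : r⁻¹ ≤ 1 := inv_le_one_of_one_le₀ h1
    have h3 : (0 : ℝ) < ((2 : ℝ) ^ j)⁻¹ := by positivity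
    nlinarith
  · obtain ⟨m, rfl⟩ := Int.exists_eq_neg_ofNat h
    refine (min_le_left _ _).trans ?_
    simp only [zpow_neg, zpow_natCast, Int.natAbs_neg, Int.natAbs_natCast, one_div, inv_pow]
    have h3 : (0 : ℝ) < ((2 : ℝ) ^ m)⁻¹ := by positivity
    nlinarith

lemma sum_min_le (s : Finset ℤ) {r : ℝ} (hr : 0 ≤ r) :
    ∑ j ∈ s, min ((2 : ℝ) ^ j * r) ((2 : ℝ) ^ j * r)⁻¹ ≤
      2 * ∑' j : ℤ, ((1 : ℝ) / 2) ^ j.natAbs := by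
  rcases hr.eq_or_lt with rfl | hr
  · simpa using tsum_nonneg fun j : ℤ => by positivity
  obtain ⟨a, ha1, ha2⟩ := exists_mem_Ico_zpow hr (one_lt_two : (1 : ℝ) < 2)
  have h2a : (0 : ℝ) < 2 ^ a := by positivity
  have key : ∀ j : ℤ, min ((2 : ℝ) ^ j * r) ((2 : ℝ) ^ j * r)⁻¹ ≤ 2 * (1 / 2) ^ (j + a).natAbs := by
    intro j
    have h := min_le_half (j + a) (r := r / 2 ^ a) (by rwa [le_div_iff₀ h2a, one_mul])
      (by rw [div_lt_iff₀ h2a]; rwa [zpow_add_one₀ two_ne_zero, mul_comm] at ha2)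
    have e : (2 : ℝ) ^ (j + a) * (r / 2 ^ a) = 2 ^ j * r := by
      rw [zpow_add₀ two_ne_zero]; field_simp
    rwa [e] at h
  calc _ ≤ ∑ j ∈ s, 2 * ((1 : ℝ) / 2) ^ (j + a).natAbs := Finset.sum_le_sum fun j _ => key j
    _ = 2 * ∑ j ∈ s, ((1 : ℝ) / 2) ^ (j + a).natAbs := by rw [Finset.mul_sum]
    _ ≤ 2 * ∑' j : ℤ, ((1 : ℝ) / 2) ^ (j + a).natAbs := by
      gcongr
      exact ((Equiv.addRight a).summable_iff.mpr summable_half).sum_le_tsum s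
        (fun _ _ => by positivity)
    _ = _ := by
      congr 1
      exact (Equiv.addRight a).tsum_eq (fun j : ℤ => ((1 : ℝ) / 2) ^ j.natAbs)

lemma app_test (A : DiffOperator (EuclideanSpace ℝ (Fin n)) k V E)
    {u : EuclideanSpace ℝ (Fin n) → V} (hu : IsTestFun u) : IsTestFun (A.app u) := by
  refine ⟨A.contDiff.comp (hu.1.iteratedFDeriv_right (m := (⊤ : ℕ∞)) (i := k) ?_), ?_⟩
  · norm_cast
  · exact (hu.2.iteratedFDeriv k).comp_left (g := A) (map_zero A)

lemma deriv_smooth {g : EuclideanSpace ℝ (Fin n) → ℂ} (hg : ContDiff ℝ ∞ g) (m : ℕ)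
    (w : Fin m → EuclideanSpace ℝ (Fin n)) :
    ContDiff ℝ ∞ (fun x => iteratedFDeriv ℝ m g x w) := by
  have h := hg.iteratedFDeriv_right (m := (⊤ : ℕ∞)) (i := m) (by norm_cast)
  exact (ContinuousMultilinearMap.apply ℝ (fun _ : Fin m => EuclideanSpace ℝ (Fin n)) ℂ
    w).contDiff.comp h

lemma deriv_supp {g : EuclideanSpace ℝ (Fin n) → ℂ} (hg : HasCompactSupport g) (m : ℕ)
    (w : Fin m → EuclideanSpace ℝ (Fin n)) :
    HasCompactSupport (fun x => iteratedFDeriv ℝ m g x w) :=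
  (hg.iteratedFDeriv (𝕜 := ℝ) m).comp_left (g := fun
    T : ContinuousMultilinearMap ℝ (fun _ : Fin m => EuclideanSpace ℝ (Fin n)) ℂ => T w) rfl

lemma fourier_app (A : DiffOperator (EuclideanSpace ℝ (Fin n)) k V E)
    {u : EuclideanSpace ℝ (Fin n) → V} (hu : IsTestFun u) (e : E)
    (ξ : EuclideanSpace ℝ (Fin n)) :
    𝓕 (coo e (A.app u)) ξ = (2 * π * Complex.I) ^ k *
      ∑ i, ((⟪e, A.symbol ξ (stdOrthonormalBasis ℝ V i)⟫ : ℝ) : ℂ) *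
        𝓕 (coo (stdOrthonormalBasis ℝ V i) u) ξ := by
  have hfun : coo e (A.app u) = fun x => ∑ I : Fin k → Fin n, ∑ i, (coef A e I i : ℂ) *
      iteratedFDeriv ℝ k (coo (stdOrthonormalBasis ℝ V i) u) x (ew I) := by
    funext x
    simp only [coo_deriv _ hu]
    rw [coo, DiffOperator.app, inner_A_eq]
    push_cast
    rfl
  have hint : ∀ (i : Fin (Module.finrank ℝ V)) (I : Fin k → Fin n),
      Integrable (fun x => 𝐞 (-⟪x, ξ⟫) • ((coef A e I i : ℂ) *
      iteratedFDeriv ℝ k (coo (stdOrthonormalBasis ℝ V i) u) x (ew I))) := by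
    intro i I
    rw [Real.fourierIntegral_convergent_iff]
    refine Integrable.const_mul ?_ _
    exact (deriv_smooth (coo_smooth _ hu) k (ew I)).continuous.integrable_of_hasCompactSupport
      (deriv_supp (coo_supp _ hu) k (ew I))
  have h1 : 𝓕 (coo e (A.app u)) ξ = ∑ I : Fin k → Fin n, ∑ i, (coef A e I i : ℂ) *
      𝓕 (fun x => iteratedFDeriv ℝ k (coo (stdOrthonormalBasis ℝ V i) u) x (ew I)) ξ := by
    rw [hfun, Real.fourier_eq]
    simp only [Finset.smul_sum]
    rw [integral_finsetSum _ fun I _ => integrable_finsetSum _ fun i _ => hint i I]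
    refine Finset.sum_congr rfl fun I _ => ?_
    rw [integral_finsetSum _ fun i _ => hint i I]
    refine Finset.sum_congr rfl fun i _ => ?_
    rw [Real.fourier_eq, ← integral_const_mul]
    congr 1
    funext x
    exact (mul_smul_comm _ _ _).symm
  rw [h1]
  simp only [fourier_deriv (coo_smooth _ hu) (coo_supp _ hu), inner_symbol_eq]
  rw [Finset.sum_comm, Finset.mul_sum]
  refine Finset.sum_congr rfl fun i _ => ?_
  push_cast
  rw [Finset.sum_mul, Finset.mul_sum]
  refine Finset.sum_congr rfl fun I _ => ?_
  ring

/-- The pairing identity at scale `t`. -/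
lemma pairing (A : DiffOperator (EuclideanSpace ℝ (Fin n)) k V E)
    {χ : EuclideanSpace ℝ (Fin n) → ℝ} {m : ℕ} (hk : k = m + n)
    {w : Fin m → EuclideanSpace ℝ (Fin n)} {i₀ : Fin (Module.finrank ℝ V)}
    {N : EuclideanSpace ℝ (Fin n) → E} (hN : IsTestFun N)
    (hNA : ∀ ξ v, ⟪N ξ, A.symbol ξ v⟫ =
      χ ξ * (∏ s, ⟪ξ, w s⟫) * ⟪stdOrthonormalBasis ℝ V i₀, v⟫)
    {t : ℝ} (ht : 0 < t) {u : EuclideanSpace ℝ (Fin n) → V} (hu : IsTestFun u) :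
    (2 * π * Complex.I) ^ k * ∫ ξ, ((χ (t • ξ) : ℝ) : ℂ) * (((∏ s, ⟪ξ, w s⟫ : ℝ) : ℂ) *
      𝓕 (coo (stdOrthonormalBasis ℝ V i₀) u) ξ) =
    ∑ l, ∫ y, 𝓕 (coo (stdOrthonormalBasis ℝ E l) N) (t⁻¹ • y) *
      coo (stdOrthonormalBasis ℝ E l) (A.app u) y := by
  have hf := app_test A hu
  -- the rescaled multiplier
  have hMs : ∀ l, ContDiff ℝ ∞
      (fun ξ => ((t ^ n : ℝ) : ℂ) * coo (stdOrthonormalBasis ℝ E l) N (t • ξ)) := fun l =>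
    contDiff_const.mul ((coo_smooth _ hN).comp (contDiff_const_smul t))
  have hMc : ∀ l, HasCompactSupport
      (fun ξ => ((t ^ n : ℝ) : ℂ) * coo (stdOrthonormalBasis ℝ E l) N (t • ξ)) := fun l =>
    ((coo_supp _ hN).comp_smul ht.ne').mul_left
  have h1 : ∀ l, ∫ y, 𝓕 (coo (stdOrthonormalBasis ℝ E l) N) (t⁻¹ • y) *
      coo (stdOrthonormalBasis ℝ E l) (A.app u) y =
      ∫ ξ, (((t ^ n : ℝ) : ℂ) * coo (stdOrthonormalBasis ℝ E l) N (t • ξ)) *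
        𝓕 (coo (stdOrthonormalBasis ℝ E l) (A.app u)) ξ := by
    intro l
    have := SchwartzMap.integral_fourier_mul_eq ((hMc l).toSchwartzMap (hMs l))
      ((coo_supp (stdOrthonormalBasis ℝ E l) hf).toSchwartzMap (coo_smooth _ hf))
    simp only [← fourier_scale _ ht]
    exact this
  simp only [h1]
  rw [← integral_finsetSum, ← integral_const_mul]
  · congr 1
    funext ξ
    simp only [fourier_app A hu]
    have h2 : ∀ i, ∑ l, ⟪stdOrthonormalBasis ℝ E l, N (t • ξ)⟫ *
        ⟪stdOrthonormalBasis ℝ E l, A.symbol ξ (stdOrthonormalBasis ℝ V i)⟫ =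
        (t ^ n)⁻¹ * χ (t • ξ) * (∏ s, ⟪ξ, w s⟫) * (if i₀ = i then 1 else 0) := by
      intro i
      have e1 := (stdOrthonormalBasis ℝ E).sum_inner_mul_inner (N (t • ξ))
        (A.symbol ξ (stdOrthonormalBasis ℝ V i))
      have e2 := hNA (t • ξ) (stdOrthonormalBasis ℝ V i)
      rw [symbol_smul, inner_smul_right, OrthonormalBasis.inner_eq_ite] at e2
      simp only [inner_smul_left, Finset.prod_mul_distrib, Finset.prod_const, Finset.card_univ,
        Fintype.card_fin, conj_trivial] at e2
      simp only [real_inner_comm (N (t • ξ))] at e1 ⊢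
      rw [e1]
      have htk : t ^ k ≠ 0 := by positivity
      apply mul_left_cancel₀ htk
      rw [e2, hk, pow_add]
      field_simp
    have h3 : ∀ i, ∑ l, (coo (stdOrthonormalBasis ℝ E l) N (t • ξ)) *
        ((⟪stdOrthonormalBasis ℝ E l, A.symbol ξ (stdOrthonormalBasis ℝ V i)⟫ : ℝ) : ℂ) =
        (((t ^ n)⁻¹ * χ (t • ξ) * (∏ s, ⟪ξ, w s⟫) * (if i₀ = i then 1 else 0) : ℝ) : ℂ) := by
      intro i
      rw [← h2 i]
      push_cast
      rfl
    have h4 : ∑ l, ((t ^ n : ℝ) : ℂ) * coo (stdOrthonormalBasis ℝ E l) N (t • ξ) *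
        ((2 * π * Complex.I) ^ k *
          ∑ i, ((⟪stdOrthonormalBasis ℝ E l, A.symbol ξ (stdOrthonormalBasis ℝ V i)⟫ : ℝ) : ℂ) *
            𝓕 (coo (stdOrthonormalBasis ℝ V i) u) ξ) =
        ∑ i, ((t ^ n : ℝ) : ℂ) * (2 * π * Complex.I) ^ k *
          (∑ l, (coo (stdOrthonormalBasis ℝ E l) N (t • ξ)) *
          ((⟪stdOrthonormalBasis ℝ E l, A.symbol ξ (stdOrthonormalBasis ℝ V i)⟫ : ℝ) : ℂ)) *
            𝓕 (coo (stdOrthonormalBasis ℝ V i) u) ξ := by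
      simp only [Finset.mul_sum, Finset.sum_mul]
      rw [Finset.sum_comm]
      refine Finset.sum_congr rfl fun i _ => Finset.sum_congr rfl fun l _ => ?_
      ring
    rw [h4]
    simp only [h3]
    rw [Finset.sum_eq_single i₀]
    · have htn : ((t : ℂ) ^ n) ≠ 0 := pow_ne_zero _ (by exact_mod_cast ht.ne')
      push_cast
      rw [if_pos rfl, Complex.ofReal_one]
      field_simp
    · intro i _ hi
      simp [hi.symm]
    · simp
  · intro l _
    have hF : Continuous (𝓕 (coo (stdOrthonormalBasis ℝ E l) (A.app u))) :=
      (𝓕 ((coo_supp (stdOrthonormalBasis ℝ E l) hf).toSchwartzMap (coo_smooth _ hf)) :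
        𝓢(EuclideanSpace ℝ (Fin n), ℂ)).continuous
    exact ((hMs l).continuous.mul hF).integrable_of_hasCompactSupport (hMc l).mul_right

/-- A radial cutoff. -/
lemma exists_cutoff (n : ℕ) : ∃ η : EuclideanSpace ℝ (Fin n) → ℝ, ContDiff ℝ ∞ η ∧
    HasCompactSupport η ∧ (∀ ξ, ‖ξ‖ ≤ 1 → η ξ = 1) ∧ (∀ ξ, 2 ≤ ‖ξ‖ → η ξ = 0) ∧
    ∀ ξ, |η ξ| ≤ 1 := by
  let ζ : ContDiffBump (0 : EuclideanSpace ℝ (Fin n)) := ⟨1, 2, by norm_num, by norm_num⟩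
  refine ⟨ζ, ζ.contDiff, ζ.hasCompactSupport, fun ξ h => ?_, fun ξ h => ?_, fun ξ => ?_⟩
  · exact ζ.one_of_mem_closedBall (by simpa [ζ] using h)
  · exact ζ.zero_of_le_dist (by simpa [ζ] using h)
  · rw [abs_of_nonneg ζ.nonneg]; exact ζ.le_one

/-- The estimate for one component of the derivative at the origin. -/
lemma component_bound (hn : 0 < n) (A : DiffOperator (EuclideanSpace ℝ (Fin n)) k V E) (hA : A.IsElliptic)
    (hAc : A.IsCanceling) {m : ℕ} (hk : k = m + n)
    (w : Fin m → EuclideanSpace ℝ (Fin n)) (i₀ : Fin (Module.finrank ℝ V)) :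
    ∃ C : ℝ, 0 ≤ C ∧ ∀ u : EuclideanSpace ℝ (Fin n) → V, IsTestFun u →
      |⟪stdOrthonormalBasis ℝ V i₀, iteratedFDeriv ℝ m u 0 w⟫| ≤ C * ∫ x, ‖A.app u x‖ := by
  obtain ⟨η, hη, hηc, hη1, hη2, hηb⟩ := exists_cutoff n
  let χ : EuclideanSpace ℝ (Fin n) → ℝ := fun ξ => η ξ - η ((2 : ℝ) • ξ)
  have hχ : ContDiff ℝ ∞ χ := hη.sub (hη.comp (contDiff_const_smul (2 : ℝ)))
  have hχc : HasCompactSupport χ := hηc.sub (hηc.comp_smul two_ne_zero)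
  have hχ0 : (0 : EuclideanSpace ℝ (Fin n)) ∉ tsupport χ := by
    rw [notMem_tsupport_iff_eventuallyEq]
    filter_upwards [Metric.ball_mem_nhds (0 : EuclideanSpace ℝ (Fin n))
      (by norm_num : (0 : ℝ) < 1 / 2)] with ξ hξ
    rw [mem_ball_zero_iff] at hξ
    have e1 := hη1 ξ (by linarith)
    have e2 := hη1 ((2 : ℝ) • ξ) (by rw [norm_smul]; norm_num; linarith)
    simp [χ, e1, e2]
  obtain ⟨N, hN, hNA, hN0⟩ := exists_multiplier A hA hAc hχ hχ0 hχc w (stdOrthonormalBasis ℝ V i₀)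
  have hNint : Integrable N := hN.1.continuous.integrable_of_hasCompactSupport hN.2
  have hdec : ∀ l, ∃ C : ℝ, 0 ≤ C ∧ ∀ y,
      ‖𝓕 (coo (stdOrthonormalBasis ℝ E l) N) y‖ ≤ C * min ‖y‖ ‖y‖⁻¹ := by
    intro l
    refine fourier_decay (coo_smooth _ hN) (coo_supp _ hN) ?_
    have : CompleteSpace E := FiniteDimensional.complete ℝ E
    simp only [coo]
    rw [integral_complex_ofReal, integral_inner hNint, hN0, inner_zero_right, Complex.ofReal_zero]
  choose D hD0 hD using hdec
  let S : ℝ := 2 * ∑' j : ℤ, ((1 : ℝ) / 2) ^ j.natAbs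
  have hS : 0 ≤ S := mul_nonneg zero_le_two (tsum_nonneg fun j => by positivity)
  have hDs : 0 ≤ ∑ l, D l := Finset.sum_nonneg fun l _ => hD0 l
  have hc : (2 * π * Complex.I : ℂ) ≠ 0 := by simp [Real.pi_ne_zero]
  refine ⟨‖(2 * π * Complex.I : ℂ)‖ ^ m * ((‖(2 * π * Complex.I : ℂ)‖ ^ k)⁻¹ *
    ((∑ l, D l) * S)), by positivity, fun u hu => ?_⟩
  have hf := app_test A hu
  have hfint : Integrable (A.app u) := hf.1.continuous.integrable_of_hasCompactSupport hf.2
  set U : EuclideanSpace ℝ (Fin n) → ℂ := fun ξ => ((∏ s, ⟪ξ, w s⟫ : ℝ) : ℂ) *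
    𝓕 (coo (stdOrthonormalBasis ℝ V i₀) u) ξ with hU
  have hmint : ∀ t : ℝ, 0 < t →
      Integrable fun y => min (t⁻¹ * ‖y‖) (t⁻¹ * ‖y‖)⁻¹ * ‖A.app u y‖ := by
    intro t ht
    refine hfint.norm.bdd_mul (c := 1) ?_ (Eventually.of_forall fun y => ?_)
    · exact Measurable.aestronglyMeasurable (by fun_prop)
    · have h0 : 0 ≤ t⁻¹ * ‖y‖ := by positivity
      rw [Real.norm_of_nonneg (le_min h0 (inv_nonneg.mpr h0))]
      rcases le_total (t⁻¹ * ‖y‖) 1 with h | h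
      · exact (min_le_left _ _).trans h
      · exact (min_le_right _ _).trans (inv_le_one_of_one_le₀ h)
  -- bound at a single scale
  have hsingle : ∀ t : ℝ, 0 < t → ‖∫ ξ, ((χ (t • ξ) : ℝ) : ℂ) * U ξ‖ ≤
      (‖(2 * π * Complex.I : ℂ)‖ ^ k)⁻¹ * ((∑ l, D l) *
        ∫ y, min (t⁻¹ * ‖y‖) (t⁻¹ * ‖y‖)⁻¹ * ‖A.app u y‖) := by
    intro t ht
    have hp := congrArg norm (pairing A hk hN hNA ht hu)
    rw [norm_mul, norm_pow] at hp
    have hb : ‖∑ l, ∫ y, 𝓕 (coo (stdOrthonormalBasis ℝ E l) N) (t⁻¹ • y) *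
        coo (stdOrthonormalBasis ℝ E l) (A.app u) y‖ ≤ (∑ l, D l) *
        ∫ y, min (t⁻¹ * ‖y‖) (t⁻¹ * ‖y‖)⁻¹ * ‖A.app u y‖ := by
      rw [Finset.sum_mul]
      refine (norm_sum_le _ _).trans (Finset.sum_le_sum fun l _ => ?_)
      rw [← integral_const_mul]
      refine norm_integral_le_of_norm_le ((hmint t ht).const_mul _) (Eventually.of_forall fun y => ?_)
      rw [norm_mul, ← mul_assoc]
      refine mul_le_mul ?_ ?_ (norm_nonneg _) ?_
      · have := hD l (t⁻¹ • y)
        rwa [norm_smul, Real.norm_of_nonneg (by positivity : 0 ≤ t⁻¹)] at this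
      · rw [coo, Complex.norm_real]
        refine (norm_inner_le_norm _ _).trans ?_
        simp
      · exact mul_nonneg (hD0 l) (le_min (by positivity) (by positivity))
    rw [← hp] at hb
    have hpos : 0 < ‖(2 * π * Complex.I : ℂ)‖ ^ k := pow_pos (norm_pos_iff.mpr hc) k
    rw [inv_mul_eq_div, le_div_iff₀ hpos, mul_comm]
    exact hb
  -- Fourier inversion at the origin
  have hg1 := deriv_smooth (coo_smooth (stdOrthonormalBasis ℝ V i₀) hu) m w
  have hg2 := deriv_supp (coo_supp (stdOrthonormalBasis ℝ V i₀) hu) m w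
  have hgF := fourier_deriv (coo_smooth (stdOrthonormalBasis ℝ V i₀) hu)
    (coo_supp (stdOrthonormalBasis ℝ V i₀) hu) m w
  have hFint : Integrable
      (𝓕 (fun x => iteratedFDeriv ℝ m (coo (stdOrthonormalBasis ℝ V i₀) u) x w)) :=
    (𝓕 (hg2.toSchwartzMap hg1) : 𝓢(EuclideanSpace ℝ (Fin n), ℂ)).integrable
  have hFeq : 𝓕 (fun x => iteratedFDeriv ℝ m (coo (stdOrthonormalBasis ℝ V i₀) u) x w) =
      fun ξ => (2 * π * Complex.I) ^ m * U ξ := by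
    funext ξ
    rw [hgF, hU, mul_assoc]
  have hcm : (2 * π * Complex.I : ℂ) ^ m ≠ 0 := pow_ne_zero _ hc
  have hUint : Integrable U := by
    rw [hFeq] at hFint
    have := hFint.const_mul ((2 * π * Complex.I : ℂ) ^ m)⁻¹
    simpa [← mul_assoc, inv_mul_cancel₀ hcm] using this
  have hinv : ((⟪stdOrthonormalBasis ℝ V i₀, iteratedFDeriv ℝ m u 0 w⟫ : ℝ) : ℂ) =
      (2 * π * Complex.I) ^ m * ∫ ξ, U ξ := by
    have h := congrFun (hg1.continuous.fourierInv_fourier_eq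
      (hg1.continuous.integrable_of_hasCompactSupport hg2) hFint) 0
    rw [coo_deriv _ hu] at h
    rw [← h, hFeq, Real.fourierInv_eq, ← integral_const_mul]
    simp
  -- the telescoping sums
  let J : ℕ → ℂ := fun M => ∫ ξ, ((η (((2 : ℝ) ^ (-(M : ℤ))) • ξ) -
    η (((2 : ℝ) ^ (M : ℤ)) • ξ) : ℝ) : ℂ) * U ξ
  have hJbound : ∀ M, ‖J M‖ ≤ (‖(2 * π * Complex.I : ℂ)‖ ^ k)⁻¹ * ((∑ l, D l) *
      (S * ∫ x, ‖A.app u x‖)) := by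
    intro M
    have htel : ∀ ξ, ((η (((2 : ℝ) ^ (-(M : ℤ))) • ξ) - η (((2 : ℝ) ^ (M : ℤ)) • ξ) : ℝ) : ℂ) * U ξ
        = ∑ j ∈ Finset.range (2 * M), ((χ (((2 : ℝ) ^ ((M : ℤ) - (j + 1 : ℤ))) • ξ) : ℝ) : ℂ)
          * U ξ := by
      intro ξ
      rw [← Finset.sum_mul, ← Complex.ofReal_sum]
      congr 2
      have h := Finset.sum_range_sub
        (fun j : ℕ => η (((2 : ℝ) ^ ((M : ℤ) - (j : ℤ))) • ξ)) (2 * M)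
      have e1 : (M : ℤ) - ((2 * M : ℕ) : ℤ) = -(M : ℤ) := by push_cast; ring
      rw [e1, Nat.cast_zero, sub_zero] at h
      rw [← h]
      refine Finset.sum_congr rfl fun j _ => ?_
      have e2 : (2 : ℝ) * 2 ^ ((M : ℤ) - (j + 1 : ℤ)) = 2 ^ ((M : ℤ) - (j : ℤ)) := by
        rw [← zpow_one_add₀ two_ne_zero]; congr 1; ring
      simp only [χ, smul_smul, e2]
      push_cast
      rfl
    have hχint : ∀ t : ℝ, Integrable fun ξ => ((χ (t • ξ) : ℝ) : ℂ) * U ξ := by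
      intro t
      refine hUint.bdd_mul (c := 2) ?_ (Eventually.of_forall fun ξ => ?_)
      · exact (Complex.continuous_ofReal.comp
          (hχ.continuous.comp (continuous_const_smul t))).aestronglyMeasurable
      · rw [Complex.norm_real, Real.norm_eq_abs]
        exact (abs_sub _ _).trans (by linarith [hηb (t • ξ), hηb ((2 : ℝ) • t • ξ)])
    have hJ : J M = ∑ j ∈ Finset.range (2 * M),
        ∫ ξ, ((χ (((2 : ℝ) ^ ((M : ℤ) - (j + 1 : ℤ))) • ξ) : ℝ) : ℂ) * U ξ := by
      simp only [J, htel]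
      exact integral_finsetSum _ fun j _ => hχint _
    rw [hJ]
    refine (norm_sum_le _ _).trans
      ((Finset.sum_le_sum fun j _ => hsingle _ (by positivity)).trans ?_)
    rw [← Finset.mul_sum, ← Finset.mul_sum]
    refine mul_le_mul_of_nonneg_left (mul_le_mul_of_nonneg_left ?_ hDs) (by positivity)
    rw [← integral_finsetSum _ fun j _ => hmint _ (by positivity), ← integral_const_mul]
    refine integral_mono (integrable_finsetSum _ fun j _ => hmint _ (by positivity))
      (hfint.norm.const_mul _) fun y => ?_
    show ∑ j ∈ Finset.range (2 * M), _ ≤ S * ‖A.app u y‖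
    rw [← Finset.sum_mul]
    refine mul_le_mul_of_nonneg_right ?_ (norm_nonneg _)
    have h := sum_min_le ((Finset.range (2 * M)).image fun j : ℕ => -((M : ℤ) - (j + 1 : ℤ)))
      (norm_nonneg y)
    rw [Finset.sum_image (by intro a _ b _ hab; simp at hab; exact hab)] at h
    simp only [zpow_neg] at h
    exact h
  have hlim : Tendsto J atTop (𝓝 (∫ ξ, U ξ)) := by
    refine tendsto_integral_of_dominated_convergence (fun ξ => 2 * ‖U ξ‖) (fun M => ?_)
      (hUint.norm.const_mul 2) (fun M => Eventually.of_forall fun ξ => ?_) ?_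
    · refine AEStronglyMeasurable.mul (Continuous.aestronglyMeasurable ?_) hUint.1
      exact Complex.continuous_ofReal.comp ((hη.continuous.comp (continuous_const_smul _)).sub
        (hη.continuous.comp (continuous_const_smul _)))
    · rw [norm_mul, Complex.norm_real, Real.norm_eq_abs]
      refine mul_le_mul_of_nonneg_right ?_ (norm_nonneg _)
      exact (abs_sub _ _).trans (by
        linarith [hηb (((2 : ℝ) ^ (-(M : ℤ))) • ξ), hηb (((2 : ℝ) ^ (M : ℤ)) • ξ)])
    · have : Nonempty (Fin n) := ⟨⟨0, hn⟩⟩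
      have hne : ∀ᵐ ξ : EuclideanSpace ℝ (Fin n), ξ ≠ 0 :=
        compl_mem_ae_iff.mpr (measure_singleton 0)
      filter_upwards [hne] with ξ hξ
      · refine tendsto_const_nhds.congr' ?_
        have hpos : 0 < ‖ξ‖ := norm_pos_iff.mpr hξ
        have hpow : Tendsto (fun M : ℕ => (2 : ℝ) ^ M) atTop atTop :=
          tendsto_pow_atTop_atTop_of_one_lt one_lt_two
        filter_upwards [hpow.eventually_ge_atTop ‖ξ‖, hpow.eventually_ge_atTop (2 / ‖ξ‖)]
          with M h1 h2
        have e1 : η (((2 : ℝ) ^ (-(M : ℤ))) • ξ) = 1 := by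
          apply hη1
          rw [norm_smul, zpow_neg, zpow_natCast, norm_inv, norm_pow, Real.norm_ofNat,
            inv_mul_le_one₀ (by positivity)]
          exact h1
        have e2 : η (((2 : ℝ) ^ (M : ℤ)) • ξ) = 0 := by
          apply hη2
          rw [norm_smul, zpow_natCast, norm_pow, Real.norm_ofNat]
          rwa [div_le_iff₀ hpos] at h2
        rw [e1, e2]
        simp
  have hfinal : ‖∫ ξ, U ξ‖ ≤ _ := le_of_tendsto hlim.norm (Eventually.of_forall hJbound)
  have : |⟪stdOrthonormalBasis ℝ V i₀, iteratedFDeriv ℝ m u 0 w⟫| =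
      ‖(2 * π * Complex.I : ℂ)‖ ^ m * ‖∫ ξ, U ξ‖ := by
    rw [← norm_pow, ← norm_mul, ← hinv, Complex.norm_real, Real.norm_eq_abs]
  rw [this]
  refine (mul_le_mul_of_nonneg_left hfinal (by positivity)).trans (le_of_eq ?_)
  ring

end Aux

/-- Theorem: limiting `L^∞` Sobolev estimate.
If `A(D)` is an elliptic and canceling homogeneous operator of order `k ≥ n` on `ℝⁿ`,
then `sup_x |D^{k−n}u(x)| ≤ C ∫ |A(D)u|` for all `u ∈ C_c^∞(ℝⁿ; V)`. -/
theorem statement2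
    {V E : Type*} [NormedAddCommGroup V] [InnerProductSpace ℝ V] [FiniteDimensional ℝ V]
    [NormedAddCommGroup E] [InnerProductSpace ℝ E] [FiniteDimensional ℝ E]
    {n k : ℕ} (hn : 0 < n) (hnk : n ≤ k)
    (A : DiffOperator (EuclideanSpace ℝ (Fin n)) k V E)
    (hA : A.IsElliptic) (hAc : A.IsCanceling) :
    ∃ C : ℝ, 0 < C ∧ ∀ u : EuclideanSpace ℝ (Fin n) → V, IsTestFun u →
      (⨆ x : EuclideanSpace ℝ (Fin n), (‖iteratedFDeriv ℝ (k - n) u x‖₊ : ℝ≥0∞))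
        ≤ ENNReal.ofReal C * ∫⁻ x, (‖A.app u x‖₊ : ℝ≥0∞) := by
  obtain ⟨m, hk⟩ : ∃ m, k = m + n := ⟨k - n, by omega⟩
  have hm : k - n = m := by omega
  rw [hm]
  choose C hC0 hC using fun (I : Fin m → Fin n) (i : Fin (Module.finrank ℝ V)) =>
    component_bound hn A hA hAc hk (ew I) i
  set K : ℝ := ∑ I : Fin m → Fin n, ∑ i, C I i *
    ‖ten (n := n) (ew I) (stdOrthonormalBasis ℝ V i)‖ with hK
  have hK0 : 0 ≤ K := Finset.sum_nonneg fun I _ => Finset.sum_nonneg fun i _ =>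
    mul_nonneg (hC0 I i) (norm_nonneg _)
  -- the estimate at the origin
  have horigin : ∀ u : EuclideanSpace ℝ (Fin n) → V, IsTestFun u →
      ‖iteratedFDeriv ℝ m u 0‖ ≤ K * ∫ x, ‖A.app u x‖ := by
    intro u hu
    rw [ten_expand (iteratedFDeriv ℝ m u 0), hK, Finset.sum_mul]
    refine (norm_sum_le _ _).trans (Finset.sum_le_sum fun I _ => ?_)
    rw [Finset.sum_mul]
    refine (norm_sum_le _ _).trans (Finset.sum_le_sum fun i _ => ?_)
    rw [norm_smul, Real.norm_eq_abs, mul_right_comm]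
    exact mul_le_mul_of_nonneg_right (hC I i u hu) (norm_nonneg _)
  refine ⟨K + 1, by positivity, fun u hu => iSup_le fun x => ?_⟩
  have hv : IsTestFun (fun y => u (y + x)) :=
    ⟨hu.1.comp (contDiff_id.add contDiff_const), hu.2.comp_homeomorph (Homeomorph.addRight x)⟩
  have h1 := horigin _ hv
  have happ : ∀ y, A.app (fun y => u (y + x)) y = A.app u (y + x) := by
    intro y
    rw [DiffOperator.app, DiffOperator.app, iteratedFDeriv_comp_add_right]
  simp only [happ] at h1
  rw [iteratedFDeriv_comp_add_right, zero_add,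
    integral_add_right_eq_self (fun y => ‖A.app u y‖) x] at h1
  have hf := app_test A hu
  have hfint : Integrable (A.app u) := hf.1.continuous.integrable_of_hasCompactSupport hf.2
  have h2 : ∫⁻ x, (‖A.app u x‖₊ : ℝ≥0∞) = ENNReal.ofReal (∫ x, ‖A.app u x‖) :=
    (ofReal_integral_norm_eq_lintegral_enorm hfint).symm
  rw [h2, ← ENNReal.ofReal_mul (by positivity)]
  have h3 : (‖iteratedFDeriv ℝ m u x‖₊ : ℝ≥0∞) = ENNReal.ofReal ‖iteratedFDeriv ℝ m u x‖ :=
    (ofReal_norm _).symm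
  rw [h3]
  apply ENNReal.ofReal_le_ofReal
  refine h1.trans (mul_le_mul_of_nonneg_right (by linarith) ?_)
  exact integral_nonneg fun _ => norm_nonneg _
end
end
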